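/- Let Q ∈ H¹(ℝ²) be the unique positive radial solution of −ΔQ + Q − Q³ = 0, and set a_* = ‖Q‖²_{L²}. Then for every u ∈ H¹(ℝ²), (∫_{ℝ²} |∇u|²)(∫_{ℝ²} |u|²) ≥ (a_*/2) ∫_{ℝ²} |u|⁴. -/

import Mathlib

open MeasureTheory

noncomputable section

abbrev E2 := EuclideanSpace ℝ (Fin 2)

/-- The Laplacian of a function on `ℝ²`, as the trace of the second derivative. -/
def lap (f : E2 → ℝ) (x : E2) : ℝ :=
  ∑ i : Fin 2,
    iteratedFDeriv ℝ 2 f x ![EuclideanSpace.single i 1, EuclideanSpace.single i 1]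

section GNProof
set_option autoImplicit false
set_option linter.unusedSectionVars false

section Part1
open Set Filter Topology
open scoped Pointwise ENNReal

lemma bm1_compact {A B : Set ℝ} (hA : IsCompact A) (hB : IsCompact B) (hA0 : A.Nonempty)
    (hB0 : B.Nonempty) : volume A + volume B ≤ volume (A + B) := by
  have ha := hA.sSup_mem hA0
  have hb := hB.sInf_mem hB0
  set a := sSup A
  set b := sInf B
  have h1 : (fun x => x + b) '' A ∪ (fun x => a + x) '' B ⊆ A + B := by
    rintro x (⟨y, hy, rfl⟩ | ⟨y, hy, rfl⟩)
    · exact ⟨y, hy, b, hb, rfl⟩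
    · exact ⟨a, ha, y, hy, rfl⟩
  have h2 : (fun x => x + b) '' A ∩ (fun x => a + x) '' B ⊆ {a + b} := by
    rintro x ⟨⟨y, hy, rfl⟩, ⟨z, hz, hzz⟩⟩
    have e1 : y ≤ a := le_csSup hA.bddAbove hy
    have e2 : b ≤ z := csInf_le hB.bddBelow hz
    simp only [mem_singleton_iff]
    simp only at hzz
    linarith
  have h3 : MeasurableSet ((fun x => a + x) '' B) := by
    exact (hB.image (by fun_prop)).measurableSet
  have h4 := measure_union_add_inter (μ := volume) ((fun x => x + b) '' A) h3
  have h5 : volume ((fun x => x + b) '' A ∩ (fun x => a + x) '' B) = 0 :=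
    measure_mono_null h2 (by simp)
  have h6 : volume ((fun x => x + b) '' A) = volume A := by
    rw [Set.image_add_right]; simp
  have h7 : volume ((fun x => a + x) '' B) = volume B := by
    rw [Set.image_add_left]; simp
  rw [h5, h6, h7, add_zero] at h4
  rw [← h4]
  exact measure_mono h1

lemma bm1 {A B : Set ℝ} (hA : MeasurableSet A) (hB : MeasurableSet B) (hA0 : A.Nonempty)
    (hB0 : B.Nonempty) : volume A + volume B ≤ volume (A + B) := by
  obtain ⟨a, ha⟩ := hA0
  obtain ⟨b, hb⟩ := hB0
  rw [hA.measure_eq_iSup_isCompact, hB.measure_eq_iSup_isCompact]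
  simp only [iSup_and']
  refine ENNReal.biSup_add_biSup_le' (p := fun K => K ⊆ A ∧ IsCompact K)
    (q := fun K => K ⊆ B ∧ IsCompact K) ⟨∅, by simp⟩ ⟨∅, by simp⟩ ?_
  rintro K ⟨hK, hKc⟩ K' ⟨hK', hKc'⟩
  calc volume K + volume K' ≤ volume (insert a K) + volume (insert b K') := by
        gcongr <;> simp
    _ ≤ volume (insert a K + insert b K') :=
        bm1_compact (hKc.insert a) (hKc'.insert b) (by simp) (by simp)
    _ ≤ volume (A + B) := by
        apply measure_mono
        apply Set.add_subset_add
        · exact insert_subset ha hK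
        · exact insert_subset hb hK'

/-- normalised layer cake comparison -/
lemma bm2_aux {A B C : Set (ℝ × ℝ)} (hA : MeasurableSet A) (hB : MeasurableSet B)
    (hC : MeasurableSet C) (hABC : A + B ⊆ C)
    (f g h : ℝ → ℝ)
    (hf : ∀ x, volume (Prod.mk x ⁻¹' A) = ENNReal.ofReal (f x))
    (hg : ∀ x, volume (Prod.mk x ⁻¹' B) = ENNReal.ofReal (g x))
    (hh : ∀ x, volume (Prod.mk x ⁻¹' C) = ENNReal.ofReal (h x))
    (hfm : Measurable f) (hgm : Measurable g) (hhm : Measurable h)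
    (hf0 : ∀ x, 0 ≤ f x) (hg0 : ∀ x, 0 ≤ g x) (hh0 : ∀ x, 0 ≤ h x)
    (F G : ℝ) (hF : 0 < F) (hG : 0 < G) (hFf : IsLUB (range f) F) (hGg : IsLUB (range g) G) :
    volume A / ENNReal.ofReal F + volume B / ENNReal.ofReal G
      ≤ volume C / ENNReal.ofReal (F + G) := by
  have key : ∀ (S : Set (ℝ × ℝ)) (k : ℝ → ℝ) (K : ℝ), MeasurableSet S → Measurable k →
      (∀ x, 0 ≤ k x) → 0 < K → (∀ x, volume (Prod.mk x ⁻¹' S) = ENNReal.ofReal (k x)) →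
      volume S / ENNReal.ofReal K = ∫⁻ t in Ioi (0:ℝ), volume {x | t < k x / K} := by
    intro S k K hS hk hk0 hK hSk
    rw [← lintegral_eq_lintegral_meas_lt volume
      (Eventually.of_forall fun x => div_nonneg (hk0 x) hK.le) (by fun_prop)]
    rw [Measure.volume_eq_prod, Measure.prod_apply hS]
    simp_rw [hSk, ENNReal.ofReal_div_of_pos hK, div_eq_mul_inv]
    rw [lintegral_mul_const _ (by fun_prop)]
  rw [key A f F hA hfm hf0 hF hf, key B g G hB hgm hg0 hG hg,
    key C h (F + G) hC hhm hh0 (by positivity) hh, ← lintegral_add_left]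
  · refine setLIntegral_mono' measurableSet_Ioi ?_
    intro t ht
    rcases lt_or_ge t 1 with h1 | h1
    · have e1 : ({x | t < f x / F}).Nonempty := by
        obtain ⟨_, ⟨x, rfl⟩, hx, _⟩ := hFf.exists_between (show t * F < F by nlinarith)
        exact ⟨x, by simpa [lt_div_iff₀ hF] using hx⟩
      have e2 : ({x | t < g x / G}).Nonempty := by
        obtain ⟨_, ⟨x, rfl⟩, hx, _⟩ := hGg.exists_between (show t * G < G by nlinarith)
        exact ⟨x, by simpa [lt_div_iff₀ hG] using hx⟩
      refine (bm1 (measurableSet_lt (by fun_prop) (by fun_prop))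
        (measurableSet_lt (by fun_prop) (by fun_prop)) e1 e2).trans (measure_mono ?_)
      rintro _ ⟨x, hx, y, hy, rfl⟩
      have ht0 : 0 < t := ht
      simp only [mem_ofPred_eq] at hx hy ⊢
      rw [lt_div_iff₀ hF] at hx
      rw [lt_div_iff₀ hG] at hy
      rw [lt_div_iff₀ (by positivity)]
      have hxy : ENNReal.ofReal (f x) + ENNReal.ofReal (g y) ≤ ENNReal.ofReal (h (x + y)) := by
        rw [← hf, ← hg, ← hh]
        have n1 : (Prod.mk x ⁻¹' A).Nonempty := by
          apply nonempty_of_measure_ne_zero (μ := volume)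
          rw [hf]
          have : 0 < f x := lt_trans (by positivity) hx
          simpa using this
        have n2 : (Prod.mk y ⁻¹' B).Nonempty := by
          apply nonempty_of_measure_ne_zero (μ := volume)
          rw [hg]
          have : 0 < g y := lt_trans (by positivity) hy
          simpa using this
        refine (bm1 (measurable_prodMk_left hA) (measurable_prodMk_left hB) n1 n2).trans
          (measure_mono ?_)
        rintro _ ⟨p, hp, q, hq, rfl⟩
        exact hABC ⟨(x, p), hp, (y, q), hq, rfl⟩
      rw [← ENNReal.ofReal_add (hf0 _) (hg0 _), ENNReal.ofReal_le_ofReal_iff (hh0 _)] at hxy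
      linarith
    · have e1 : {x | t < f x / F} = ∅ := by
        ext x; simp only [mem_ofPred_eq, mem_empty_iff_false, iff_false, not_lt]
        have := hFf.1 ⟨x, rfl⟩
        exact le_trans (by rw [div_le_one hF]; exact this) h1
      have e2 : {x | t < g x / G} = ∅ := by
        ext x; simp only [mem_ofPred_eq, mem_empty_iff_false, iff_false, not_lt]
        have := hGg.1 ⟨x, rfl⟩
        exact le_trans (by rw [div_le_one hG]; exact this) h1
      simp [e1, e2]
  · have : Antitone (fun t => volume {x | t < f x / F}) := by
      intro s t hst
      exact measure_mono (fun x hx => lt_of_le_of_lt hst hx)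
    exact this.measurable

lemma bm2 {A B C : Set (ℝ × ℝ)} (hA : MeasurableSet A) (hB : MeasurableSet B)
    (hC : MeasurableSet C) (hABC : A + B ⊆ C) (hAb : Bornology.IsBounded A)
    (hBb : Bornology.IsBounded B) (hCb : Bornology.IsBounded C)
    (hA0 : 0 < volume A) (hB0 : 0 < volume B) :
    √(volume A).toReal + √(volume B).toReal ≤ √(volume C).toReal := by
  have key : ∀ (S : Set (ℝ × ℝ)), MeasurableSet S → Bornology.IsBounded S → ∃ f : ℝ → ℝ,
      (∀ x, volume (Prod.mk x ⁻¹' S) = ENNReal.ofReal (f x)) ∧ Measurable f ∧ (∀ x, 0 ≤ f x) ∧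
      (0 < volume S → ∃ F, 0 < F ∧ IsLUB (range f) F) := by
    intro S hS hSb
    obtain ⟨R, hR⟩ := hSb.subset_closedBall 0
    have hb : ∀ x, volume (Prod.mk x ⁻¹' S) ≤ volume (Metric.closedBall (0:ℝ) R) := by
      intro x
      apply measure_mono
      intro y hy
      have := hR hy
      simp only [Metric.mem_closedBall, dist_zero_right, Prod.norm_mk, sup_le_iff] at this ⊢
      exact this.2
    have hlt : volume (Metric.closedBall (0:ℝ) R) < ∞ := measure_closedBall_lt_top
    have hSf : ∀ x, volume (Prod.mk x ⁻¹' S) = ENNReal.ofReal (volume (Prod.mk x ⁻¹' S)).toReal :=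
      fun x => (ENNReal.ofReal_toReal ((hb x).trans_lt hlt).ne).symm
    refine ⟨fun x => (volume (Prod.mk x ⁻¹' S)).toReal, hSf, 
      (measurable_measure_prodMk_left hS).ennreal_toReal, fun x => by positivity, ?_⟩
    intro hpos
    have hbdd : BddAbove (range fun x => (volume (Prod.mk x ⁻¹' S)).toReal) := by
      refine ⟨(volume (Metric.closedBall (0:ℝ) R)).toReal, ?_⟩
      rintro _ ⟨x, rfl⟩
      exact ENNReal.toReal_mono hlt.ne (hb x)
    refine ⟨sSup (range fun x => (volume (Prod.mk x ⁻¹' S)).toReal), ?_, 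
      isLUB_csSup (range_nonempty _) hbdd⟩
    by_contra hcon
    push Not at hcon
    have : ∀ x, volume (Prod.mk x ⁻¹' S) = 0 := by
      intro x
      rw [hSf x]
      simp only [ENNReal.ofReal_eq_zero]
      exact (le_csSup hbdd ⟨x, rfl⟩).trans hcon
    rw [Measure.volume_eq_prod, Measure.prod_apply hS] at hpos
    simp [this] at hpos
  obtain ⟨f, hf, hfm, hf0, hF⟩ := key A hA hAb
  obtain ⟨g, hg, hgm, hg0, hG⟩ := key B hB hBb
  obtain ⟨h, hh, hhm, hh0, -⟩ := key C hC hCb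
  obtain ⟨F, hF0, hF⟩ := hF hA0
  obtain ⟨G, hG0, hG⟩ := hG hB0
  have main := bm2_aux hA hB hC hABC f g h hf hg hh hfm hgm hhm hf0 hg0 hh0 F G hF0 hG0 hF hG
  have fA := hAb.measure_lt_top (μ := volume)
  have fB := hBb.measure_lt_top (μ := volume)
  have fC := hCb.measure_lt_top (μ := volume)
  rw [← ENNReal.ofReal_toReal fA.ne, ← ENNReal.ofReal_toReal fB.ne, ← ENNReal.ofReal_toReal fC.ne,
    ← ENNReal.ofReal_div_of_pos hF0, ← ENNReal.ofReal_div_of_pos hG0,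
    ← ENNReal.ofReal_div_of_pos (by positivity), ← ENNReal.ofReal_add (by positivity) (by positivity),
    ENNReal.ofReal_le_ofReal_iff (by positivity)] at main
  set a := (volume A).toReal
  set b := (volume B).toReal
  set c := (volume C).toReal
  have ha : 0 ≤ a := ENNReal.toReal_nonneg
  have hb : 0 ≤ b := ENNReal.toReal_nonneg
  apply Real.le_sqrt_of_sq_le
  have h1 : (a / F + b / G) * (F + G) ≤ c := by
    rwa [← le_div_iff₀ (by positivity)]
  refine le_trans ?_ h1
  have h2 : (a / F + b / G) * (F + G) = a + b + (a * G / F + b * F / G) := by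
    field_simp; ring
  rw [h2]
  have sa := Real.sq_sqrt ha
  have sb := Real.sq_sqrt hb
  have h3 : 2 * (√a * √b) ≤ a * G / F + b * F / G := by
    have e1 : a * G / F = (√a)^2 * (G / F) := by rw [sa]; ring
    have e2 : b * F / G = (√b)^2 / (G / F) := by rw [sb]; field_simp
    rw [e1, e2]
    have hk : 0 < G / F := by positivity
    set k := G / F
    have : (√a)^2 * k + (√b)^2 / k - 2 * (√a * √b) = (√a * k - √b)^2 / k := by
      field_simp; ring
    have : 0 ≤ (√a * k - √b)^2 / k := by positivity
    linarith
  nlinarith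

/-- Brunn-Minkowski with a ball in `E2`. -/
lemma bm_ball {A C : Set E2} (hA : IsOpen A) (hA0 : A.Nonempty) (hAb : Bornology.IsBounded A)
    (hC : MeasurableSet C) (hCb : Bornology.IsBounded C) {ρ : ℝ} (hρ : 0 ≤ ρ)
    (hAC : ∀ a ∈ A, ∀ y, ‖y - a‖ < ρ → y ∈ C) (hAC' : A ⊆ C) :
    √((volume A).toReal / Real.pi) + ρ ≤ √((volume C).toReal / Real.pi) := by
  rcases hρ.eq_or_lt with rfl | hρ
  · rw [add_zero]
    gcongr
    exact (hCb.measure_lt_top (μ := volume)).ne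
  let e : E2 ≃ᵐ ℝ × ℝ := (MeasurableEquiv.toLp 2 (Fin 2 → ℝ)).symm.trans MeasurableEquiv.finTwoArrow
  have he : MeasurePreserving e volume volume :=
    (EuclideanSpace.volume_preserving_symm_measurableEquiv_toLp (Fin 2)).trans
      (volume_preserving_finTwoArrow ℝ)
  have hex : ∀ x, e x = (x 0, x 1) := fun x => rfl
  have hesx : ∀ p : ℝ × ℝ, e.symm p = !₂[p.1, p.2] := by
    intro p
    rw [MeasurableEquiv.symm_apply_eq, hex]; simp
  have hes : MeasurePreserving e.symm volume volume := he.symm e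
  have hadd : ∀ p q, e.symm (p + q) = e.symm p + e.symm q := by
    intro p q
    rw [hesx, hesx, hesx]
    ext i; fin_cases i <;> simp
  have hbdd : ∀ S : Set E2, Bornology.IsBounded S → Bornology.IsBounded (e.symm ⁻¹' S) := by
    intro S hS
    obtain ⟨R, hR⟩ := hS.subset_closedBall 0
    refine (Metric.isBounded_closedBall (x := (0 : ℝ × ℝ)) (r := R)).subset ?_
    intro p hp
    have := hR hp
    simp only [Metric.mem_closedBall, dist_zero_right] at this ⊢
    have h0 := PiLp.norm_apply_le (e.symm p) 0
    have h1 := PiLp.norm_apply_le (e.symm p) 1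
    rw [hesx] at h0 h1 this
    simp at h0 h1
    rw [Prod.norm_def]
    simp only [Real.norm_eq_abs]
    exact max_le (h0.trans this) (h1.trans this)
  have hm : ∀ S : Set E2, MeasurableSet S → volume (e.symm ⁻¹' S) = volume S := fun S hS =>
    hes.measure_preimage hS.nullMeasurableSet
  have hball : volume (Metric.ball (0:E2) ρ) = ENNReal.ofReal (ρ^2 * Real.pi) := by
    rw [EuclideanSpace.volume_ball_fin_two, ENNReal.ofReal_mul (by positivity), ENNReal.ofReal_pow hρ.le]
  have main := bm2 (A := e.symm ⁻¹' A) (B := e.symm ⁻¹' (Metric.ball 0 ρ)) (C := e.symm ⁻¹' C)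
    (e.symm.measurable hA.measurableSet) (e.symm.measurable measurableSet_ball) (e.symm.measurable hC)
    (by
      rintro _ ⟨p, hp, q, hq, rfl⟩
      simp only [mem_preimage, hadd] at *
      refine hAC _ hp _ ?_
      simpa using hq)
    (hbdd _ hAb) (hbdd _ Metric.isBounded_ball) (hbdd _ hCb)
    (by rw [hm _ hA.measurableSet]; exact hA.measure_pos _ hA0)
    (by rw [hm _ measurableSet_ball]; exact Metric.measure_ball_pos _ _ hρ)
  rw [hm _ hA.measurableSet, hm _ measurableSet_ball, hm _ hC, hball,
    ENNReal.toReal_ofReal (by positivity)] at main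
  have hpi := Real.pi_pos
  rw [Real.sqrt_div' _ hpi.le, Real.sqrt_div' _ hpi.le]
  rw [Real.sqrt_mul (by positivity), Real.sqrt_sq hρ.le] at main
  have : 0 < √Real.pi := by positivity
  rw [div_add' _ _ _ this.ne']
  gcongr

end Part1

section Part2
open Set Filter Topology
open scoped Pointwise ENNReal NNReal

/-- radius of the ball with the same area as the superlevel set -/
def rad (u : E2 → ℝ) (t : ℝ) : ℝ := √((volume {x | t < u x}).toReal / Real.pi)

/-- the decreasing rearrangement profile -/
def prof (u : E2 → ℝ) (r : ℝ) : ℝ := sSup {t | t = 0 ∨ (0 ≤ t ∧ max r 0 < rad u t)}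

/-- the measure `2 π r dr` on `(0, ∞)` -/
def nu : Measure ℝ := (volume.restrict (Ioi 0)).withDensity (fun r => ENNReal.ofReal (2 * Real.pi * r))

structure Good (u : E2 → ℝ) : Prop where
  c1 : ContDiff ℝ 1 u
  cs : HasCompactSupport u
  nn : ∀ x, 0 ≤ u x

namespace Good
variable {u : E2 → ℝ} (hu : Good u)
include hu

lemma isOpen_lt (t : ℝ) : IsOpen {x | t < u x} :=
  _root_.isOpen_lt continuous_const hu.c1.continuous

lemma bdd {t : ℝ} (ht : 0 ≤ t) : Bornology.IsBounded {x | t < u x} := by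
  refine hu.cs.isCompact.isBounded.subset ?_
  intro x hx
  apply subset_tsupport
  have : t < u x := hx
  simp only [Function.mem_support]
  linarith

lemma exists_max : ∃ m, 0 ≤ m ∧ ∀ x, u x ≤ m := by
  obtain ⟨C, hC⟩ := hu.cs.exists_bound_of_continuous hu.c1.continuous
  exact ⟨C, (norm_nonneg _).trans (hC 0), fun x => (le_abs_self _).trans (hC x)⟩

lemma exists_lip : ∃ L : ℝ≥0, 0 < L ∧ LipschitzWith L u := by
  obtain ⟨C, hC⟩ := hu.c1.lipschitzWith_of_hasCompactSupport hu.cs (by simp)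
  exact ⟨C + 1, by positivity, hC.weaken (by simp)⟩

lemma rad_nonneg (t : ℝ) : 0 ≤ rad u t := Real.sqrt_nonneg _

lemma rad_sq (t : ℝ) (ht : 0 ≤ t) : ENNReal.ofReal (Real.pi * rad u t ^ 2) = volume {x | t < u x} := by
  unfold rad
  rw [Real.sq_sqrt (by positivity), mul_div_cancel₀ _ Real.pi_pos.ne', ENNReal.ofReal_toReal]
  exact ((hu.bdd ht).measure_lt_top (μ := volume)).ne

lemma rad_anti {s t : ℝ} (hs : 0 ≤ s) (hst : s ≤ t) : rad u t ≤ rad u s := by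
  unfold rad
  gcongr
  · exact ((hu.bdd hs).measure_lt_top (μ := volume)).ne

lemma nonempty_of_rad {t : ℝ} (h : 0 < rad u t) : ({x | t < u x}).Nonempty := by
  by_contra hc
  rw [not_nonempty_iff_eq_empty] at hc
  simp [rad, hc] at h

lemma rad_right {t r : ℝ} (ht : 0 ≤ t) (h : r < rad u t) : ∃ t', t < t' ∧ r < rad u t' := by
  have h1 : Tendsto (fun n : ℕ => volume {x | t + 1 / ((n:ℝ) + 1) < u x}) atTop (𝓝 (volume {x | t < u x})) := by
    have e : {x | t < u x} = ⋃ n : ℕ, {x | t + 1 / ((n:ℝ) + 1) < u x} := by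
      ext x
      simp only [mem_iUnion, mem_ofPred_eq]
      constructor
      · intro hx
        obtain ⟨n, hn⟩ := exists_nat_one_div_lt (sub_pos.2 hx)
        exact ⟨n, by linarith⟩
      · rintro ⟨n, hn⟩
        have : 0 < 1 / ((n:ℝ) + 1) := by positivity
        linarith
    rw [e]
    apply tendsto_measure_iUnion_atTop
    intro m n hmn x hx
    simp only [mem_ofPred_eq] at hx ⊢
    have : 1 / ((n:ℝ) + 1) ≤ 1 / ((m:ℝ) + 1) := by gcongr
    linarith
  have h2 : Tendsto (fun n : ℕ => rad u (t + 1 / ((n:ℝ) + 1))) atTop (𝓝 (rad u t)) := by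
    unfold rad
    apply Tendsto.sqrt
    apply Tendsto.div_const
    exact (ENNReal.tendsto_toReal ((hu.bdd ht).measure_lt_top (μ := volume)).ne).comp h1
  obtain ⟨n, hn⟩ := ((h2.eventually (lt_mem_nhds h))).exists
  exact ⟨_, by have : 0 < 1 / ((n:ℝ) + 1) := by positivity
               linarith, hn⟩

lemma bddAbove_prof (r : ℝ) : BddAbove {t | t = 0 ∨ (0 ≤ t ∧ max r 0 < rad u t)} := by
  obtain ⟨m, hm0, hm⟩ := hu.exists_max
  refine ⟨m, ?_⟩
  rintro t (rfl | ⟨ht, h⟩)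
  · exact hm0
  · obtain ⟨x, hx⟩ := hu.nonempty_of_rad ((le_max_right _ _).trans_lt h)
    exact le_of_lt (lt_of_lt_of_le hx (hm x))

lemma prof_nonneg (r : ℝ) : 0 ≤ prof u r := le_csSup (hu.bddAbove_prof r) (Or.inl rfl)

lemma prof_le_max {m : ℝ} (hm0 : 0 ≤ m) (hm : ∀ x, u x ≤ m) (r : ℝ) : prof u r ≤ m := by
  refine csSup_le ⟨0, Or.inl rfl⟩ ?_
  rintro t (rfl | ⟨ht, h⟩)
  · exact hm0
  · obtain ⟨x, hx⟩ := hu.nonempty_of_rad ((le_max_right _ _).trans_lt h)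
    exact le_of_lt (lt_of_lt_of_le hx (hm x))

lemma lt_prof_iff {t : ℝ} (ht : 0 ≤ t) (r : ℝ) : t < prof u r ↔ max r 0 < rad u t := by
  constructor
  · intro h
    obtain ⟨t', ht', htt⟩ := exists_lt_of_lt_csSup (s := {t | t = 0 ∨ (0 ≤ t ∧ max r 0 < rad u t)}) ⟨0, Or.inl rfl⟩ h
    rcases ht' with rfl | ⟨_, h2⟩
    · linarith
    · exact h2.trans_le (hu.rad_anti ht htt.le)
  · intro h
    obtain ⟨t', htt, h'⟩ := hu.rad_right ht h
    exact htt.trans_le (le_csSup (hu.bddAbove_prof r) (Or.inr ⟨ht.trans htt.le, h'⟩))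

lemma prof_anti : Antitone (prof u) := by
  intro r s hrs
  by_contra! h
  have h0 := hu.prof_nonneg r
  have := (hu.lt_prof_iff h0 s).1 h
  have h2 := (hu.lt_prof_iff h0 r).2 (lt_of_le_of_lt (max_le_max_right 0 hrs) this)
  exact lt_irrefl _ h2

lemma prof_max (r : ℝ) : prof u (max r 0) = prof u r := by
  unfold prof; simp

lemma prof_lip_aux {L : ℝ≥0} (hL : LipschitzWith L u) {r h : ℝ} (hr : 0 ≤ r) (hh : 0 ≤ h) :
    prof u r ≤ prof u (r + h) + L * h := by
  by_contra! hc
  have h0 := hu.prof_nonneg (r + h)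
  have ht0 : 0 ≤ prof u (r + h) + L * h := by positivity
  have h1 := (hu.lt_prof_iff ht0 r).1 hc
  rw [max_eq_left hr] at h1
  have h2 := bm_ball (hu.isOpen_lt _) (hu.nonempty_of_rad (hr.trans_lt h1)) (hu.bdd ht0)
    (hu.isOpen_lt (prof u (r+h))).measurableSet (hu.bdd h0) hh (by
      intro a ha y hy
      simp only [mem_ofPred_eq] at ha ⊢
      have := hL.dist_le_mul a y
      rw [Real.dist_eq, dist_comm, dist_eq_norm] at this
      have h3 := (le_abs_self _).trans this
      have : (L:ℝ) * ‖y - a‖ ≤ L * h := by gcongr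
      linarith) (by
      intro a ha
      simp only [mem_ofPred_eq] at ha ⊢
      have : 0 ≤ (L:ℝ) * h := by positivity
      linarith)
  have h3 : max (r + h) 0 < rad u (prof u (r + h)) := by
    rw [max_eq_left (by positivity)]
    refine lt_of_lt_of_le ?_ h2
    have : r < √((volume {x | prof u (r + h) + ↑L * h < u x}).toReal / Real.pi) := h1
    linarith
  exact lt_irrefl _ ((hu.lt_prof_iff h0 _).2 h3)

lemma prof_lip {L : ℝ≥0} (hL : LipschitzWith L u) : LipschitzWith L (prof u) := by
  apply LipschitzWith.of_le_add_mul
  intro r s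
  have hd : max s 0 - max r 0 ≤ dist r s := by
    rw [dist_comm, Real.dist_eq]
    exact (le_abs_self _).trans (abs_max_sub_max_le_abs s r 0)
  rcases le_total s r with h | h
  · have := hu.prof_anti h
    have : 0 ≤ (L:ℝ) * dist r s := by positivity
    linarith
  · have h1 := hu.prof_lip_aux hL (le_max_right r 0) (sub_nonneg.2 (max_le_max_right 0 h))
    rw [add_sub_cancel, hu.prof_max, hu.prof_max] at h1
    have : (L:ℝ) * (max s 0 - max r 0) ≤ L * dist r s := by gcongr
    linarith

omit hu in
lemma nu_Iio {R : ℝ} (hR : 0 ≤ R) : nu (Iio R) = ENNReal.ofReal (Real.pi * R ^ 2) := by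
  unfold nu
  rw [withDensity_apply _ measurableSet_Iio, Measure.restrict_restrict measurableSet_Iio,
    Iio_inter_Ioi, ← ofReal_integral_eq_lintegral_ofReal]
  · congr 1
    rw [← integral_Ioc_eq_integral_Ioo, ← intervalIntegral.integral_of_le hR,
      intervalIntegral.integral_const_mul, integral_id]
    ring
  · exact (Continuous.integrableOn_Icc (by fun_prop)).mono_set Ioo_subset_Icc_self
  · refine (ae_restrict_iff' measurableSet_Ioo).2 (Eventually.of_forall fun r hr => ?_)
    have := hr.1
    have := Real.pi_pos
    simp only [Pi.zero_apply]
    positivity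

omit hu in
lemma nu_ae_pos : ∀ᵐ r ∂nu, 0 < r := by
  unfold nu
  apply (withDensity_absolutelyContinuous _ _).ae_le
  exact ae_restrict_mem measurableSet_Ioi

lemma nu_lt {t : ℝ} (ht : 0 ≤ t) : nu {r | t < prof u r} = volume {x | t < u x} := by
  rw [← hu.rad_sq t ht, ← nu_Iio (hu.rad_nonneg t)]
  apply measure_congr
  filter_upwards [nu_ae_pos] with r hr
  have := hu.lt_prof_iff ht r
  rw [max_eq_left hr.le] at this
  exact propext this

lemma lintegral_prof {p : ℝ} (hp : 0 < p) :
    ∫⁻ r, ENNReal.ofReal (prof u r ^ p) ∂nu = ∫⁻ x, ENNReal.ofReal (u x ^ p) := by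
  rw [lintegral_rpow_eq_lintegral_meas_lt_mul nu (Eventually.of_forall hu.prof_nonneg)
    hu.prof_anti.measurable.aemeasurable hp,
    lintegral_rpow_eq_lintegral_meas_lt_mul volume (Eventually.of_forall hu.nn)
    hu.c1.continuous.measurable.aemeasurable hp]
  congr 1
  apply setLIntegral_congr_fun measurableSet_Ioi
  intro t ht
  simp only
  rw [hu.nu_lt (le_of_lt ht)]

end Good

end Part2

section Part3
open Set Filter Topology
open scoped Pointwise ENNReal NNReal

/-- Hopf-Lax sup-convolution on the plane -/
def hl (u : E2 → ℝ) (h : ℝ) (x : E2) : ℝ := ⨆ y, (u y - ‖x - y‖ ^ 2 / (4 * h))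

/-- Hopf-Lax sup-convolution of a profile -/
def hlr (v : ℝ → ℝ) (h : ℝ) (r : ℝ) : ℝ := ⨆ s, (v s - (r - s) ^ 2 / (4 * h))

namespace Good
variable {u : E2 → ℝ} (hu : Good u)
include hu

lemma hl_bdd {h : ℝ} (hh : 0 < h) (x : E2) : BddAbove (range fun y => u y - ‖x - y‖ ^ 2 / (4 * h)) := by
  obtain ⟨m, hm0, hm⟩ := hu.exists_max
  refine ⟨m, ?_⟩
  rintro _ ⟨y, rfl⟩
  have : 0 ≤ ‖x - y‖ ^ 2 / (4 * h) := by positivity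
  have := hm y
  simp only
  linarith

lemma hlr_bdd {h : ℝ} (hh : 0 < h) (r : ℝ) : BddAbove (range fun s => prof u s - (r - s) ^ 2 / (4 * h)) := by
  obtain ⟨m, hm0, hm⟩ := hu.exists_max
  refine ⟨m, ?_⟩
  rintro _ ⟨y, rfl⟩
  have : 0 ≤ (r - y) ^ 2 / (4 * h) := by positivity
  have := hu.prof_le_max hm0 hm y
  simp only
  linarith

lemma le_hl {h : ℝ} (hh : 0 < h) (x : E2) : u x ≤ hl u h x := by
  have := le_ciSup (hu.hl_bdd hh x) x
  simpa [hl] using this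

lemma le_hlr {h : ℝ} (hh : 0 < h) (r : ℝ) : prof u r ≤ hlr (prof u) h r := by
  have := le_ciSup (hu.hlr_bdd hh r) r
  simpa [hlr] using this

lemma lt_hl_iff {h : ℝ} (hh : 0 < h) (x : E2) (t : ℝ) :
    t < hl u h x ↔ ∃ y, t < u y - ‖x - y‖ ^ 2 / (4 * h) := lt_ciSup_iff (hu.hl_bdd hh x)

lemma lt_hlr_iff {h : ℝ} (hh : 0 < h) (r : ℝ) (t : ℝ) :
    t < hlr (prof u) h r ↔ ∃ s, t < prof u s - (r - s) ^ 2 / (4 * h) := lt_ciSup_iff (hu.hlr_bdd hh r)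

lemma hl_open {h : ℝ} (hh : 0 < h) (t : ℝ) : IsOpen {x | t < hl u h x} := by
  have : {x | t < hl u h x} = ⋃ y, {x | t < u y - ‖x - y‖ ^ 2 / (4 * h)} := by
    ext x; simp [hu.lt_hl_iff hh]
  rw [this]
  exact isOpen_iUnion fun y => _root_.isOpen_lt continuous_const (by fun_prop)

lemma hlr_open {h : ℝ} (hh : 0 < h) (t : ℝ) : IsOpen {r | t < hlr (prof u) h r} := by
  have : {r | t < hlr (prof u) h r} = ⋃ y, {x | t < prof u y - (x - y) ^ 2 / (4 * h)} := by
    ext x; simp [hu.lt_hlr_iff hh]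
  rw [this]
  exact isOpen_iUnion fun y => _root_.isOpen_lt continuous_const (by fun_prop)

lemma hl_meas {h : ℝ} (hh : 0 < h) : Measurable (hl u h) :=
  measurable_of_Ioi fun t => (hu.hl_open hh t).measurableSet

lemma hlr_meas {h : ℝ} (hh : 0 < h) : Measurable (hlr (prof u) h) :=
  measurable_of_Ioi fun t => (hu.hlr_open hh t).measurableSet

lemma hl_supp : ∃ R : ℝ, ∀ h, 0 < h → h ≤ 1 → ∀ x, 0 < hl u h x → x ∈ Metric.closedBall (0:E2) R := by
  obtain ⟨m, hm0, hm⟩ := hu.exists_max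
  obtain ⟨R, hR⟩ := (hu.bdd le_rfl).subset_closedBall 0
  refine ⟨R + (4 * m + 1), ?_⟩
  intro h hh h1 x hx
  obtain ⟨y, hy⟩ := (hu.lt_hl_iff hh x 0).1 hx
  have h0 : 0 ≤ ‖x - y‖ ^ 2 / (4 * h) := by positivity
  have hyR := hR (show 0 < u y by linarith)
  simp only [Metric.mem_closedBall, dist_zero_right] at hyR ⊢
  have h2 : ‖x - y‖ ^ 2 / (4 * h) < m := by have := hm y; linarith
  rw [div_lt_iff₀ (by positivity)] at h2
  have h3 : ‖x - y‖ ≤ 4 * m + 1 := by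
    have : m * (4 * h) ≤ 4 * m := by nlinarith
    by_contra! hc
    have h5 : 1 ≤ ‖x - y‖ := by linarith
    nlinarith
  calc ‖x‖ = ‖y + (x - y)‖ := by congr 1; abel
    _ ≤ ‖y‖ + ‖x - y‖ := norm_add_le _ _
    _ ≤ _ := by linarith

lemma nu_hlr {h t : ℝ} (hh : 0 < h) (h1 : h ≤ 1) (ht : 0 ≤ t) :
    nu {r | t < hlr (prof u) h r} ≤ volume {x | t < hl u h x} := by
  obtain ⟨R, hR⟩ := hu.hl_supp
  have hCb : Bornology.IsBounded {x | t < hl u h x} :=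
    (Metric.isBounded_closedBall (x := (0:E2)) (r := R)).subset
      (fun x hx => hR h hh h1 x (ht.trans_lt hx))
  set C := {x | t < hl u h x} with hC
  have hfin := (hCb.measure_lt_top (μ := volume)).ne
  have key : ∀ r, 0 < r → t < hlr (prof u) h r → r < √((volume C).toReal / Real.pi) := by
    intro r hr htr
    obtain ⟨s, hs⟩ := (hu.lt_hlr_iff hh r t).1 htr
    wlog hs0 : 0 ≤ s generalizing s
    · refine this (max s 0) ?_ (le_max_right _ _)
      rw [hu.prof_max]
      have : (r - max s 0) ^ 2 ≤ (r - s)^2 := by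
        push Not at hs0
        rw [max_eq_right hs0.le]
        nlinarith
      have : (r - max s 0) ^ 2 / (4 * h) ≤ (r - s)^2 / (4 * h) := by gcongr
      linarith
    set τ := (r - s) ^ 2 / (4 * h) with hτ
    have hτ0 : 0 ≤ τ := by positivity
    have h2 : t + τ < prof u s := by linarith
    have h3 := (hu.lt_prof_iff (by positivity) s).1 h2
    rw [max_eq_left hs0] at h3
    have h4 := bm_ball (hu.isOpen_lt (t + τ)) (hu.nonempty_of_rad (hs0.trans_lt h3))
      (hu.bdd (by positivity)) (hu.hl_open hh t).measurableSet hCb (abs_nonneg (r - s)) (by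
        intro a ha y hy
        refine (hu.lt_hl_iff hh y t).2 ⟨a, ?_⟩
        have : ‖y - a‖ ^ 2 / (4 * h) ≤ τ := by
          rw [hτ, ← sq_abs (r - s)]
          gcongr
        have ha : t + τ < u a := ha
        linarith) (by
        intro a ha
        refine (hu.lt_hl_iff hh a t).2 ⟨a, ?_⟩
        have ha : t + τ < u a := ha
        simp
        linarith)
    have h5 : s < √((volume {x | t + τ < u x}).toReal / Real.pi) := h3
    have := le_abs_self (r - s)
    linarith
  calc nu {r | t < hlr (prof u) h r} ≤ nu (Iio (√((volume C).toReal / Real.pi))) := by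
        apply measure_mono_ae
        filter_upwards [nu_ae_pos] with r hr
        exact key r hr
    _ = volume C := by
        rw [nu_Iio (Real.sqrt_nonneg _), Real.sq_sqrt (by positivity),
          mul_div_cancel₀ _ Real.pi_pos.ne', ENNReal.ofReal_toReal hfin]

lemma lint_hlr {h : ℝ} (hh : 0 < h) (h1 : h ≤ 1) :
    ∫⁻ r, ENNReal.ofReal (hlr (prof u) h r) ∂nu ≤ ∫⁻ x, ENNReal.ofReal (hl u h x) := by
  rw [lintegral_eq_lintegral_meas_lt nu
    (Eventually.of_forall fun r => (hu.prof_nonneg r).trans (hu.le_hlr hh r))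
    (hu.hlr_meas hh).aemeasurable,
    lintegral_eq_lintegral_meas_lt volume
    (Eventually.of_forall fun r => (hu.nn r).trans (hu.le_hl hh r))
    (hu.hl_meas hh).aemeasurable]
  apply setLIntegral_mono' measurableSet_Ioi
  intro t ht
  exact hu.nu_hlr hh h1 (le_of_lt ht)

lemma lint_diff {h : ℝ} (hh : 0 < h) (h1 : h ≤ 1) :
    ∫⁻ r, ENNReal.ofReal (hlr (prof u) h r - prof u r) ∂nu
      ≤ ∫⁻ x, ENNReal.ofReal (hl u h x - u x) := by
  have e1 : ∫⁻ r, ENNReal.ofReal (prof u r) ∂nu = ∫⁻ x, ENNReal.ofReal (u x) := by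
    simpa using hu.lintegral_prof (p := 1) one_pos
  have fin : ∫⁻ x, ENNReal.ofReal (u x) ≠ ∞ := by
    have := (hu.c1.continuous.integrable_of_hasCompactSupport hu.cs (μ := volume)).lintegral_lt_top
    exact this.ne
  have e2 : ∫⁻ r, ENNReal.ofReal (hlr (prof u) h r) ∂nu = ∫⁻ r, ENNReal.ofReal (prof u r) ∂nu
      + ∫⁻ r, ENNReal.ofReal (hlr (prof u) h r - prof u r) ∂nu := by
    rw [← lintegral_add_left hu.prof_anti.measurable.ennreal_ofReal]
    congr 1; ext r
    rw [← ENNReal.ofReal_add (hu.prof_nonneg r) (sub_nonneg.2 (hu.le_hlr hh r)), add_sub_cancel]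
  have e3 : ∫⁻ x, ENNReal.ofReal (hl u h x) = (∫⁻ x, ENNReal.ofReal (u x))
      + ∫⁻ x, ENNReal.ofReal (hl u h x - u x) := by
    rw [← lintegral_add_left hu.c1.continuous.measurable.ennreal_ofReal]
    congr 1; ext r
    rw [← ENNReal.ofReal_add (hu.nn r) (sub_nonneg.2 (hu.le_hl hh r)), add_sub_cancel]
  have := hu.lint_hlr hh h1
  rw [e2, e3, e1] at this
  exact (ENNReal.add_le_add_iff_left fin).1 this

lemma hl_upper {ε : ℝ} (hε : 0 < ε) : ∃ h0, 0 < h0 ∧ ∀ h, 0 < h → h ≤ h0 → ∀ x,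
    hl u h x - u x ≤ h * (‖fderiv ℝ u x‖ + ε) ^ 2 := by
  obtain ⟨L, hL0, hL⟩ := hu.exists_lip
  have hc : Continuous (fderiv ℝ u) := hu.c1.continuous_fderiv (by simp)
  have huc : UniformContinuous (fderiv ℝ u) :=
    (hu.cs.fderiv (𝕜 := ℝ)).uniformContinuous_of_continuous hc
  obtain ⟨δ, hδ, hδ'⟩ := Metric.uniformContinuous_iff.1 huc ε hε
  refine ⟨δ / (4 * L), by positivity, ?_⟩
  intro h hh hh0 x
  rw [le_div_iff₀ (by positivity)] at hh0
  rw [sub_le_iff_le_add]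
  apply ciSup_le
  intro y
  set d := ‖x - y‖ with hd
  have hd0 : 0 ≤ d := norm_nonneg _
  have hG : 0 ≤ h * (‖fderiv ℝ u x‖ + ε) ^ 2 := by positivity
  rcases lt_or_ge d δ with h2 | h2
  · have hmv : ‖u y - u x‖ ≤ (‖fderiv ℝ u x‖ + ε) * ‖y - x‖ := by
      refine (convex_ball x δ).norm_image_sub_le_of_norm_fderiv_le (𝕜 := ℝ) (f := u) ?_ ?_
        (Metric.mem_ball_self hδ) ?_
      · intro z _
        exact (hu.c1.differentiable (by simp)) z
      · intro z hz
        have := hδ' (Metric.mem_ball.1 hz)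
        rw [dist_eq_norm] at this
        have h3 : ‖fderiv ℝ u z‖ ≤ ‖fderiv ℝ u x‖ + ‖fderiv ℝ u z - fderiv ℝ u x‖ := by
          calc _ = ‖fderiv ℝ u x + (fderiv ℝ u z - fderiv ℝ u x)‖ := by congr 1; abel
            _ ≤ _ := norm_add_le _ _
        linarith
      · rw [Metric.mem_ball, dist_comm, dist_eq_norm]; exact h2
    rw [norm_sub_rev y x, ← hd] at hmv
    have h3 := (le_abs_self _).trans hmv
    set G := ‖fderiv ℝ u x‖ + ε
    have h4 : G * d ≤ h * G ^ 2 + d ^ 2 / (4 * h) := by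
      have : h * G ^ 2 + d ^ 2 / (4 * h) - G * d = (2 * h * G - d) ^ 2 / (4 * h) := by
        field_simp; ring
      have : 0 ≤ (2 * h * G - d) ^ 2 / (4 * h) := by positivity
      linarith
    linarith
  · have h3 := hL.dist_le_mul y x
    rw [Real.dist_eq, dist_comm, dist_eq_norm, ← hd] at h3
    have h4 := (le_abs_self _).trans h3
    have h5 : L * d ≤ d ^ 2 / (4 * h) := by
      rw [le_div_iff₀ (by positivity)]
      have : h * (4 * L) ≤ d := hh0.trans h2
      nlinarith
    linarith

lemma lint_hl_upper {R : ℝ} (hR : ∀ h, 0 < h → h ≤ 1 → ∀ x, 0 < hl u h x → x ∈ Metric.closedBall (0:E2) R)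
    {ε : ℝ} (hε : 0 < ε) : ∃ h0, 0 < h0 ∧ ∀ h, 0 < h → h ≤ h0 →
    ∫⁻ x, ENNReal.ofReal ((hl u h x - u x) / h)
      ≤ ∫⁻ x in Metric.closedBall (0:E2) R, ENNReal.ofReal ((‖fderiv ℝ u x‖ + ε) ^ 2) := by
  obtain ⟨h0, hh0, H⟩ := hu.hl_upper hε
  refine ⟨min h0 1, by positivity, ?_⟩
  intro h hh hhm
  rw [← lintegral_indicator measurableSet_closedBall]
  apply lintegral_mono
  intro x
  by_cases hx : x ∈ Metric.closedBall (0:E2) R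
  · simp only [indicator_of_mem hx]
    apply ENNReal.ofReal_le_ofReal
    rw [div_le_iff₀ hh, mul_comm]
    exact H h hh (hhm.trans (min_le_left _ _)) x
  · have h1 : hl u h x ≤ 0 := by
      by_contra! hc
      exact hx (hR h hh (hhm.trans (min_le_right _ _)) x hc)
    simp only [indicator_of_notMem hx]
    have := hu.nn x
    simp only [nonpos_iff_eq_zero, ENNReal.ofReal_eq_zero]
    apply div_nonpos_of_nonpos_of_nonneg _ hh.le
    linarith

lemma hlr_lower {r : ℝ} (hd : DifferentiableAt ℝ (prof u) r) :
    ENNReal.ofReal (deriv (prof u) r ^ 2) ≤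
      liminf (fun n : ℕ => ENNReal.ofReal ((hlr (prof u) (1 / ((n:ℝ) + 1)) r - prof u r) / (1 / ((n:ℝ) + 1)))) atTop := by
  set d := deriv (prof u) r with hdd
  have hder : HasDerivAt (fun h : ℝ => prof u (r + 2 * h * d)) (d * (2 * d)) 0 := by
    have h1 : HasDerivAt (fun h : ℝ => r + 2 * h * d) (2 * d) 0 := by
      have := (((hasDerivAt_id (0:ℝ)).const_mul 2).mul_const d).const_add r
      simpa using this
    have h2 : HasDerivAt (prof u) d (r + 2 * 0 * d) := by
      rw [mul_zero, zero_mul, add_zero]; exact hd.hasDerivAt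
    exact h2.comp (0:ℝ) h1
  have ht := hasDerivAt_iff_tendsto_slope_zero.1 hder
  have hs : Tendsto (fun n : ℕ => 1 / ((n:ℝ) + 1)) atTop (𝓝[≠] 0) := by
    rw [tendsto_nhdsWithin_iff]
    refine ⟨tendsto_one_div_add_atTop_nhds_zero_nat, Eventually.of_forall fun n => ?_⟩
    have : 0 < 1 / ((n:ℝ) + 1) := by positivity
    exact this.ne'
  have ht2 := (ht.comp hs).sub_const (d ^ 2)
  have e : d * (2 * d) - d ^ 2 = d ^ 2 := by ring
  rw [e] at ht2
  have ht3 := ENNReal.tendsto_ofReal ht2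
  rw [← ht3.liminf_eq]
  refine liminf_le_liminf (Eventually.of_forall fun n => ?_)
  apply ENNReal.ofReal_le_ofReal
  have hh : 0 < 1 / ((n:ℝ) + 1) := by positivity
  simp only [Function.comp_apply, smul_eq_mul]
  set h := 1 / ((n:ℝ) + 1)
  rw [le_div_iff₀ hh]
  have := le_ciSup (hu.hlr_bdd hh r) (r + 2 * h * d)
  have h2 : (r - (r + 2 * h * d)) ^ 2 / (4 * h) = h * d ^ 2 := by field_simp; ring
  simp only [h2] at this
  have h3 : hlr (prof u) h r = ⨆ s, (prof u s - (r - s) ^ 2 / (4 * h)) := rfl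
  rw [← h3] at this
  have h4 : (h⁻¹ * (prof u (r + 2 * (0 + h) * d) - prof u (r + 2 * 0 * d)) - d ^ 2) * h
     = prof u (r + 2 * h * d) - prof u r - h * d ^ 2 := by
    simp only [zero_add, mul_zero, zero_mul, add_zero]
    field_simp
  rw [h4]
  linarith

lemma energy_eps {R : ℝ} (hR : ∀ h, 0 < h → h ≤ 1 → ∀ x, 0 < hl u h x → x ∈ Metric.closedBall (0:E2) R)
    {ε : ℝ} (hε : 0 < ε) :
    ∫⁻ r, ENNReal.ofReal (deriv (prof u) r ^ 2) ∂nu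
     ≤ ∫⁻ x in Metric.closedBall (0:E2) R, ENNReal.ofReal ((‖fderiv ℝ u x‖ + ε) ^ 2) := by
  obtain ⟨L, hL0, hL⟩ := hu.exists_lip
  have hd : ∀ᵐ r ∂nu, DifferentiableAt ℝ (prof u) r := by
    have h1 : nu ≪ volume := (withDensity_absolutelyContinuous _ _).trans Measure.absolutelyContinuous_restrict
    exact h1.ae_le (hu.prof_lip hL).ae_differentiableAt
  obtain ⟨h0, hh0, H⟩ := hu.lint_hl_upper hR hε
  calc _ ≤ ∫⁻ r, liminf (fun n : ℕ => ENNReal.ofReal ((hlr (prof u) (1 / ((n:ℝ) + 1)) r - prof u r) / (1 / ((n:ℝ) + 1)))) atTop ∂nu := by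
        apply lintegral_mono_ae
        filter_upwards [hd] with r hr using hu.hlr_lower hr
    _ ≤ liminf (fun n : ℕ => ∫⁻ r, ENNReal.ofReal ((hlr (prof u) (1 / ((n:ℝ) + 1)) r - prof u r) / (1 / ((n:ℝ) + 1))) ∂nu) atTop := by
        apply lintegral_liminf_le
        intro n
        have hh : 0 < 1 / ((n:ℝ) + 1) := by positivity
        have := hu.hlr_meas hh
        have := hu.prof_anti.measurable
        fun_prop
    _ ≤ _ := by
        apply liminf_le_of_frequently_le'
        apply Eventually.frequently
        have hs : ∀ᶠ n : ℕ in atTop, 1 / ((n:ℝ) + 1) < min h0 1 :=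
          (tendsto_one_div_add_atTop_nhds_zero_nat (𝕜 := ℝ)).eventually (gt_mem_nhds (by positivity))
        filter_upwards [hs] with n hn
        have hh : 0 < 1 / ((n:ℝ) + 1) := by positivity
        refine le_trans ?_ (H _ hh (hn.le.trans (min_le_left _ _)))
        simp_rw [ENNReal.ofReal_div_of_pos hh, div_eq_mul_inv]
        have m1 := hu.hlr_meas hh
        have m2 := hu.prof_anti.measurable
        have m3 := hu.hl_meas hh
        have m4 := hu.c1.continuous.measurable
        rw [lintegral_mul_const _ (by fun_prop), lintegral_mul_const _ (by fun_prop)]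
        gcongr
        exact hu.lint_diff hh (hn.le.trans (min_le_right _ _))

/-- Polya-Szego. -/
lemma energy : ∫⁻ r, ENNReal.ofReal (deriv (prof u) r ^ 2) ∂nu
     ≤ ∫⁻ x, ENNReal.ofReal (‖fderiv ℝ u x‖ ^ 2) := by
  obtain ⟨R, hR⟩ := hu.hl_supp
  obtain ⟨L, hL0, hL⟩ := hu.exists_lip
  have hV : volume (Metric.closedBall (0:E2) R) ≠ ∞ := measure_closedBall_lt_top.ne
  set V := volume (Metric.closedBall (0:E2) R)
  have key : ∀ ε : ℝ, 0 < ε → ε ≤ 1 → ∫⁻ r, ENNReal.ofReal (deriv (prof u) r ^ 2) ∂nu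
     ≤ (∫⁻ x, ENNReal.ofReal (‖fderiv ℝ u x‖ ^ 2)) + ENNReal.ofReal (ε * (2 * L + 1)) * V := by
    intro ε hε hε1
    refine (hu.energy_eps hR hε).trans ?_
    calc _ ≤ ∫⁻ x in Metric.closedBall (0:E2) R, (ENNReal.ofReal (‖fderiv ℝ u x‖ ^ 2) + ENNReal.ofReal (ε * (2 * L + 1))) := by
          apply lintegral_mono
          intro x
          simp only
          rw [← ENNReal.ofReal_add (by positivity) (by positivity)]
          apply ENNReal.ofReal_le_ofReal
          have : ‖fderiv ℝ u x‖ ≤ L := norm_fderiv_le_of_lipschitz ℝ hL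
          nlinarith
      _ ≤ _ := by
          rw [lintegral_add_right _ measurable_const, setLIntegral_const]
          gcongr
          exact Measure.restrict_le_self
  have hlim : Tendsto (fun ε : ℝ => (∫⁻ x, ENNReal.ofReal (‖fderiv ℝ u x‖ ^ 2)) + ENNReal.ofReal (ε * (2 * L + 1)) * V)
      (𝓝[>] 0) (𝓝 ((∫⁻ x, ENNReal.ofReal (‖fderiv ℝ u x‖ ^ 2)) + ENNReal.ofReal (0 * (2 * L + 1)) * V)) := by
    apply Tendsto.mono_left _ nhdsWithin_le_nhds
    apply Tendsto.const_add
    apply ENNReal.Tendsto.mul_const _ (Or.inr hV)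
    apply ENNReal.tendsto_ofReal
    exact (continuous_id.mul continuous_const).tendsto 0
  have := ge_of_tendsto hlim (by
    filter_upwards [Ioc_mem_nhdsGT (zero_lt_one' ℝ)] with ε hε using key ε hε.1 hε.2)
  simpa using this

end Good

end Part3

section Part4
open Set Filter Topology
open scoped Pointwise ENNReal NNReal

/-- one-dimensional class, `τ = log r` -/
structure Pair (v g : ℝ → ℝ) : Prop where
  g2 : MemLp g 2 volume
  ftc : ∀ a b, v b - v a = ∫ x in a..b, g x
  m : Integrable (fun τ => v τ ^ 2 * Real.exp (2 * τ))

/-- Dirichlet -/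
def D1 (g : ℝ → ℝ) : ℝ := ∫ x, g x ^ 2
/-- mass -/
def M1 (v : ℝ → ℝ) : ℝ := ∫ x, v x ^ 2 * Real.exp (2 * x)
/-- quartic -/
def N1 (v : ℝ → ℝ) : ℝ := ∫ x, v x ^ 4 * Real.exp (2 * x)

lemma D1_nonneg (g : ℝ → ℝ) : 0 ≤ D1 g := integral_nonneg fun x => by positivity
lemma M1_nonneg (g : ℝ → ℝ) : 0 ≤ M1 g := integral_nonneg fun x => by positivity
lemma N1_nonneg (g : ℝ → ℝ) : 0 ≤ N1 g := integral_nonneg fun x => by positivity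

namespace Pair
variable {v g : ℝ → ℝ} (h : Pair v g)
include h

lemma g2i : Integrable (fun x => g x ^ 2) := h.g2.integrable_sq

lemma gint (a b : ℝ) : IntervalIntegrable g volume a b := by
  rw [intervalIntegrable_iff]
  exact (h.g2.locallyIntegrable (by norm_num)).integrableOn_isCompact isCompact_uIcc |>.mono_set uIoc_subset_uIcc

lemma g2int (a b : ℝ) : IntervalIntegrable (fun x => g x ^ 2) volume a b :=
  h.g2i.intervalIntegrable

lemma holder {a b : ℝ} (hab : a ≤ b) : (v b - v a) ^ 2 ≤ D1 g * (b - a) := by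
  rcases hab.eq_or_lt with rfl | hab'
  · simp
  have hL : 0 < b - a := by linarith
  rw [h.ftc]
  set I := ∫ x in a..b, g x
  have h0 : 0 ≤ ∫ x in a..b, (g x - I / (b - a)) ^ 2 :=
    intervalIntegral.integral_nonneg hab fun x _ => by positivity
  have e : ∫ x in a..b, (g x - I / (b - a)) ^ 2
      = (∫ x in a..b, g x ^ 2) - 2 * (I / (b - a)) * I + (b - a) * (I / (b - a)) ^ 2 := by
    have : ∀ x, (g x - I / (b - a)) ^ 2 = g x ^ 2 - 2 * (I / (b - a)) * g x + (I / (b - a)) ^ 2 := by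
      intro x; ring
    simp_rw [this]
    rw [intervalIntegral.integral_add, intervalIntegral.integral_sub, intervalIntegral.integral_const_mul,
      intervalIntegral.integral_const, smul_eq_mul]
    · exact h.g2int a b
    · exact (h.gint a b).const_mul _
    · exact (h.g2int a b).sub ((h.gint a b).const_mul _)
    · exact intervalIntegrable_const
  have h1 : ∫ x in a..b, g x ^ 2 ≤ D1 g := by
    rw [intervalIntegral.integral_of_le hab]
    exact setIntegral_le_integral h.g2i (Eventually.of_forall fun x => by positivity)
  rw [e] at h0
  have e2 : 2 * (I / (b - a)) * I - (b - a) * (I / (b - a)) ^ 2 = I ^ 2 / (b - a) := by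
    field_simp; ring
  have h2 : I ^ 2 / (b - a) ≤ D1 g := by linarith
  rwa [div_le_iff₀ hL] at h2

lemma holder_abs (a b : ℝ) : (v b - v a) ^ 2 ≤ D1 g * |b - a| := by
  rcases le_total a b with hab | hab
  · rw [abs_of_nonneg (by linarith)]; exact h.holder hab
  · rw [abs_of_nonpos (by linarith), ← neg_sq, neg_sub, neg_sub]; exact h.holder hab

lemma cont : Continuous v := by
  have : v = fun x => v 0 + ∫ t in (0:ℝ)..x, g t := by
    ext x; rw [← h.ftc 0 x]; ring
  rw [this]
  exact continuous_const.add (intervalIntegral.continuous_primitive h.gint 0)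

lemma bound (hD : D1 g ≤ 1) (hM : M1 v ≤ 1) (τ : ℝ) : |v τ| ≤ 2 * Real.exp (-τ / 2) := by
  by_contra! hc
  set L := Real.exp (-τ)
  have hL : 0 < L := Real.exp_pos _
  have hs : Real.exp (-τ / 2) ^ 2 = L := by
    rw [← Real.exp_nat_mul]; congr 1; push_cast; ring
  have hp : 0 < Real.exp (-τ / 2) := Real.exp_pos _
  set m := |v τ| - Real.exp (-τ / 2) with hm
  have hm1 : Real.exp (-τ / 2) < m := by linarith
  have hm2 : L < m ^ 2 := by rw [← hs]; gcongr
  have hw : ∀ x ∈ Icc τ (τ + L), m ^ 2 ≤ v x ^ 2 := by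
    intro x hx
    have h1 := h.holder hx.1
    have h2 : (v x - v τ) ^ 2 ≤ Real.exp (-τ / 2) ^ 2 := by
      rw [hs]
      have : D1 g * (x - τ) ≤ 1 * L := by
        have := D1_nonneg g
        have := hx.1; have := hx.2
        gcongr
        · linarith
      linarith
    have h3 := abs_le_of_sq_le_sq h2 hp.le
    have h4 : m ≤ |v x| := by
      have : |v τ| ≤ |v x| + |v x - v τ| := by
        have := abs_sub_abs_le_abs_sub (v τ) (v x)
        rw [abs_sub_comm] at this; linarith
      linarith
    rw [← sq_abs (v x)]
    have := hp.trans hm1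
    gcongr
  have hi : ∫ x in Icc τ (τ + L), (m ^ 2 * Real.exp (2 * τ)) ≤ M1 v := by
    calc ∫ x in Icc τ (τ + L), (m ^ 2 * Real.exp (2 * τ)) ≤ ∫ x in Icc τ (τ + L), v x ^ 2 * Real.exp (2 * x) := by
          apply setIntegral_mono_on _ h.m.integrableOn measurableSet_Icc
          · intro x hx
            have := hw x hx
            have := hx.1
            gcongr
          · exact (continuousOn_const.integrableOn_Icc)
      _ ≤ M1 v := setIntegral_le_integral h.m (Eventually.of_forall fun x => by positivity)
  rw [setIntegral_const] at hi
  simp only [measureReal_def, Real.volume_Icc, smul_eq_mul, add_sub_cancel_left] at hi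
  rw [ENNReal.toReal_ofReal hL.le] at hi
  have : L * (L * Real.exp (2 * τ)) = 1 := by
    simp only [L]
    rw [← Real.exp_add, ← Real.exp_add, ← Real.exp_zero]; congr 1; ring
  have : L * (L * Real.exp (2 * τ)) < L * (m ^ 2 * Real.exp (2 * τ)) := by gcongr
  linarith

lemma bound_neg (hD : D1 g ≤ 1) (hM : M1 v ≤ 1) {τ : ℝ} (hτ : τ ≤ 0) : |v τ| ≤ 2 + √(-τ) := by
  have h1 := h.bound hD hM 0
  have h2 := h.holder hτ
  have h3 : (v 0 - v τ) ^ 2 ≤ √(-τ) ^ 2 := by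
    rw [Real.sq_sqrt (by linarith)]; nlinarith [D1_nonneg g]
  have h4 := abs_le_of_sq_le_sq h3 (Real.sqrt_nonneg _)
  have h5 := abs_sub_abs_le_abs_sub (v τ) (v 0)
  rw [abs_sub_comm] at h5
  simp at h1
  linarith

lemma quart_bound (hD : D1 g ≤ 1) (hM : M1 v ≤ 1) (τ : ℝ) : v τ ^ 4 * Real.exp (2 * τ) ≤ 64 * Real.exp τ := by
  have e4 : v τ ^ 4 = |v τ| ^ 4 := by rw [show 4 = 2 * 2 from rfl, pow_mul, pow_mul, sq_abs]
  rw [e4]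
  rcases le_total 0 τ with hτ | hτ
  · have h1 := h.bound hD hM τ
    have : |v τ| ^ 4 ≤ (2 * Real.exp (-τ / 2)) ^ 4 := by gcongr
    have e : (2 * Real.exp (-τ / 2)) ^ 4 * Real.exp (2 * τ) = 16 := by
      rw [mul_pow, ← Real.exp_nat_mul, mul_assoc, ← Real.exp_add]
      norm_num
      ring_nf
    have : 1 ≤ Real.exp τ := Real.one_le_exp hτ
    have : |v τ| ^ 4 * Real.exp (2 * τ) ≤ (2 * Real.exp (-τ / 2)) ^ 4 * Real.exp (2 * τ) := by gcongr
    linarith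
  · have h1 := h.bound_neg hD hM hτ
    have h2 : (2 + √(-τ)) ^ 2 ≤ 8 * Real.exp (-τ / 2) := by
      have e1 := Real.add_one_le_exp (-τ / 2)
      have e2 := Real.sq_sqrt (show 0 ≤ -τ by linarith)
      nlinarith [sq_nonneg (√(-τ) - 1)]
    have h3 : |v τ| ^ 4 ≤ (8 * Real.exp (-τ / 2)) ^ 2 := by
      calc |v τ| ^ 4 ≤ (2 + √(-τ)) ^ 4 := by gcongr
        _ = ((2 + √(-τ)) ^ 2) ^ 2 := by ring
        _ ≤ _ := by gcongr
    have e : (8 * Real.exp (-τ / 2)) ^ 2 * Real.exp (2 * τ) = 64 * Real.exp τ := by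
      rw [mul_pow, ← Real.exp_nat_mul, mul_assoc, ← Real.exp_add]
      norm_num
      ring_nf
    rw [← e]
    gcongr

lemma quart_tail (hD : D1 g ≤ 1) (hM : M1 v ≤ 1) {T τ : ℝ} (hT : T ≤ τ) :
    v τ ^ 4 * Real.exp (2 * τ) ≤ 4 * Real.exp (-T) * (v τ ^ 2 * Real.exp (2 * τ)) := by
  have h1 := h.bound hD hM τ
  have h2 : v τ ^ 2 ≤ 4 * Real.exp (-T) := by
    rw [← sq_abs]
    calc |v τ| ^ 2 ≤ (2 * Real.exp (-τ / 2)) ^ 2 := by gcongr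
      _ = 4 * Real.exp (-τ) := by
        rw [mul_pow, ← Real.exp_nat_mul]; norm_num; ring_nf
      _ ≤ _ := by gcongr
  have : v τ ^ 4 * Real.exp (2 * τ) = v τ ^ 2 * (v τ ^ 2 * Real.exp (2 * τ)) := by ring
  rw [this]
  gcongr

lemma quart_cont : Continuous fun τ => v τ ^ 4 * Real.exp (2 * τ) := by
  have := h.cont
  fun_prop

lemma quart_int1 (hD : D1 g ≤ 1) (hM : M1 v ≤ 1) : Integrable fun τ => v τ ^ 4 * Real.exp (2 * τ) := by
  rw [← integrableOn_univ, ← Iic_union_Ioi (a := (0:ℝ)), integrableOn_union]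
  constructor
  · refine Integrable.mono' ((integrableOn_exp_Iic 0).const_mul 64) h.quart_cont.aestronglyMeasurable.restrict ?_
    refine Eventually.of_forall fun τ => ?_
    rw [Real.norm_of_nonneg (by positivity)]
    exact h.quart_bound hD hM τ
  · refine Integrable.mono' ((h.m.integrableOn (s := Ioi 0)).const_mul (4 * Real.exp (-0))) h.quart_cont.aestronglyMeasurable.restrict ?_
    refine (ae_restrict_mem measurableSet_Ioi).mono fun τ hτ => ?_
    rw [Real.norm_of_nonneg (by positivity)]
    exact h.quart_tail hD hM (le_of_lt hτ)

lemma quart_split (hD : D1 g ≤ 1) (hM : M1 v ≤ 1) (T : ℝ) :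
    N1 v ≤ (∫ τ in Iic T, v τ ^ 4 * Real.exp (2 * τ)) + 4 * Real.exp (-T) := by
  have hi := h.quart_int1 hD hM
  rw [N1, ← intervalIntegral.integral_Iic_add_Ioi (b := T) hi.integrableOn hi.integrableOn]
  gcongr
  calc ∫ τ in Ioi T, v τ ^ 4 * Real.exp (2 * τ)
      ≤ ∫ τ in Ioi T, 4 * Real.exp (-T) * (v τ ^ 2 * Real.exp (2 * τ)) := by
        apply setIntegral_mono_on hi.integrableOn (h.m.integrableOn.const_mul _) measurableSet_Ioi
        intro τ hτ
        exact h.quart_tail hD hM (le_of_lt hτ)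
    _ = 4 * Real.exp (-T) * ∫ τ in Ioi T, (v τ ^ 2 * Real.exp (2 * τ)) := integral_const_mul _ _
    _ ≤ 4 * Real.exp (-T) * M1 v := by
        gcongr
        exact setIntegral_le_integral h.m (Eventually.of_forall fun x => by positivity)
    _ ≤ 4 * Real.exp (-T) * 1 := by gcongr
    _ = _ := by ring

lemma quart_le (hD : D1 g ≤ 1) (hM : M1 v ≤ 1) : N1 v ≤ 68 := by
  refine (h.quart_split hD hM 0).trans ?_
  have hi := h.quart_int1 hD hM
  have : (∫ τ in Iic 0, v τ ^ 4 * Real.exp (2 * τ)) ≤ ∫ τ in Iic 0, 64 * Real.exp τ := by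
    apply setIntegral_mono_on hi.integrableOn ((integrableOn_exp_Iic 0).const_mul 64) measurableSet_Iic
    intro τ _
    exact h.quart_bound hD hM τ
  rw [integral_const_mul, integral_exp_Iic] at this
  simp at this ⊢
  linarith

lemma scale (l c : ℝ) : Pair (fun τ => l * v (τ + c)) (fun τ => l * g (τ + c)) where
  g2 := (h.g2.comp_measurePreserving (measurePreserving_add_right volume c)).const_mul l
  ftc a b := by
    rw [intervalIntegral.integral_const_mul, intervalIntegral.integral_comp_add_right, ← h.ftc]; ring
  m := by
    have := (h.m.comp_add_right c).const_mul (l ^ 2 * Real.exp (-(2 * c)))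
    refine this.congr (Eventually.of_forall fun τ => ?_)
    simp only
    rw [show 2 * (τ + c) = 2 * τ + 2 * c by ring, Real.exp_add, Real.exp_neg]
    field_simp

omit h
lemma D1_scale (l c : ℝ) : D1 (fun τ => l * g (τ + c)) = l ^ 2 * D1 g := by
  simp only [D1, mul_pow]
  rw [integral_const_mul, integral_add_right_eq_self (fun x => g x ^ 2) c]

lemma M1_scale (l c : ℝ) : M1 (fun τ => l * v (τ + c)) = l ^ 2 * Real.exp (-(2 * c)) * M1 v := by
  simp only [M1, mul_pow]
  rw [← integral_add_right_eq_self (fun x => v x ^ 2 * Real.exp (2 * x)) c, ← integral_const_mul]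
  congr 1; ext τ
  rw [show 2 * (τ + c) = 2 * τ + 2 * c by ring, Real.exp_add, Real.exp_neg]
  field_simp

lemma N1_scale (l c : ℝ) : N1 (fun τ => l * v (τ + c)) = l ^ 4 * Real.exp (-(2 * c)) * N1 v := by
  simp only [N1, mul_pow]
  rw [← integral_add_right_eq_self (fun x => v x ^ 4 * Real.exp (2 * x)) c, ← integral_const_mul]
  congr 1; ext τ
  rw [show 2 * (τ + c) = 2 * τ + 2 * c by ring, Real.exp_add, Real.exp_neg]
  field_simp
end Pair

/-- the admissible values -/
def KS : Set ℝ := {N | ∃ v g, Pair v g ∧ D1 g ≤ 1 ∧ M1 v ≤ 1 ∧ N1 v = N}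
/-- best one-dimensional constant -/
def KK : ℝ := sSup KS

lemma KS_bdd : BddAbove KS := ⟨68, by
  rintro _ ⟨v, g, h, hD, hM, rfl⟩; exact h.quart_le hD hM⟩

namespace Pair
variable {v g : ℝ → ℝ} (h : Pair v g)
include h

lemma le_KK (hD : D1 g ≤ 1) (hM : M1 v ≤ 1) : N1 v ≤ KK := le_csSup KS_bdd ⟨v, g, h, hD, hM, rfl⟩

lemma gn_aux {d m : ℝ} (hd : 0 < d) (hm : 0 < m) (hD : D1 g ≤ d) (hM : M1 v ≤ m) :
    (Integrable fun τ => v τ ^ 4 * Real.exp (2 * τ)) ∧ N1 v ≤ KK * d * m := by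
  set l := (√d)⁻¹
  set c := Real.log (m / d) / 2
  have hl : l ^ 2 = d⁻¹ := by simp only [l]; rw [inv_pow, Real.sq_sqrt hd.le]
  have hc : Real.exp (-(2 * c)) = d / m := by
    rw [Real.exp_neg, show 2 * c = Real.log (m / d) by simp only [c]; ring, Real.exp_log (by positivity), inv_div]
  have hs := h.scale l c
  have h1 : D1 (fun τ => l * g (τ + c)) ≤ 1 := by
    rw [D1_scale, hl, inv_mul_le_iff₀ hd]; linarith
  have h2 : M1 (fun τ => l * v (τ + c)) ≤ 1 := by
    rw [M1_scale, hl, hc, show d⁻¹ * (d / m) * M1 v = M1 v / m by field_simp, div_le_one hm]; exact hM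
  constructor
  · have := (hs.quart_int1 h1 h2).comp_add_right (-c)
    have := this.const_mul (l⁻¹ ^ 4 * Real.exp (2 * c))
    refine this.congr (Eventually.of_forall fun τ => ?_)
    have hl0 : l ≠ 0 := by positivity
    simp only
    rw [neg_add_cancel_right, show 2 * (τ + -c) = 2 * τ + -(2 * c) by ring, Real.exp_add, Real.exp_neg]
    field_simp
  · have := hs.le_KK h1 h2
    rw [N1_scale, show l ^ 4 = (l ^ 2) ^ 2 by ring, hl, hc,
      show d⁻¹ ^ 2 * (d / m) * N1 v = N1 v / (d * m) by field_simp, div_le_iff₀ (by positivity)] at this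
    linarith

lemma quart_int : Integrable fun τ => v τ ^ 4 * Real.exp (2 * τ) := by
  have := D1_nonneg g; have := M1_nonneg v
  exact (h.gn_aux (d := D1 g + 1) (m := M1 v + 1) (by linarith) (by linarith) (by linarith) (by linarith)).1

lemma gn : N1 v ≤ KK * D1 g * M1 v := by
  have h0 := D1_nonneg g; have h1 := M1_nonneg v
  have key : ∀ ε : ℝ, 0 < ε → N1 v ≤ KK * (D1 g + ε) * (M1 v + ε) := fun ε hε =>
    (h.gn_aux (by linarith) (by linarith) (by linarith) (by linarith)).2
  have hlim : Tendsto (fun ε : ℝ => KK * (D1 g + ε) * (M1 v + ε)) (𝓝[>] 0) (𝓝 (KK * (D1 g + 0) * (M1 v + 0))) := by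
    apply Tendsto.mono_left _ nhdsWithin_le_nhds
    apply Continuous.tendsto
    fun_prop
  have := ge_of_tendsto hlim (by filter_upwards [self_mem_nhdsWithin] with ε hε using key ε hε)
  simpa using this
end Pair

end Part4

section Part5
open Set Filter Topology
open scoped Pointwise ENNReal NNReal

namespace Pair
variable {v g : ℝ → ℝ} (h : Pair v g)
include h

lemma ac (a b : ℝ) : AbsolutelyContinuousOnInterval v a b := by
  have h1 := (h.gint a b).absolutelyContinuousOnInterval_intervalIntegral (c := a) left_mem_uIcc
  have e : (fun x => ∫ t in a..x, g t) = fun x => v x - v a := by ext x; rw [h.ftc]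
  rw [e, absolutelyContinuousOnInterval_iff] at h1
  rw [absolutelyContinuousOnInterval_iff]
  simpa using h1

lemma ac_abs (a b : ℝ) : AbsolutelyContinuousOnInterval (fun x => |v x|) a b := by
  have h1 := h.ac a b
  rw [absolutelyContinuousOnInterval_iff] at h1 ⊢
  intro ε hε
  obtain ⟨δ, hδ, h2⟩ := h1 ε hε
  refine ⟨δ, hδ, fun E hE hE2 => lt_of_le_of_lt ?_ (h2 E hE hE2)⟩
  apply Finset.sum_le_sum
  intro i _
  rw [Real.dist_eq, Real.dist_eq]
  exact abs_abs_sub_abs_le _ _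

lemma ae_deriv : ∀ᵐ x, HasDerivAt v (g x) x := by
  have := LocallyIntegrable.ae_hasDerivAt_integral (h.g2.locallyIntegrable (by norm_num))
  filter_upwards [this] with x hx
  have e : v = fun x => v 0 + ∫ t in (0:ℝ)..x, g t := by
    ext x; rw [← h.ftc 0 x]; ring
  rw [e]
  exact (hx 0).const_add _

lemma ae_abs_le : ∀ᵐ x, |deriv (fun x => |v x|) x| ≤ |g x| := by
  filter_upwards [h.ae_deriv] with x hx
  by_cases hd : DifferentiableAt ℝ (fun x => |v x|) x
  · have h1 := hd.hasDerivAt.tendsto_slope.abs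
    have h2 := hx.tendsto_slope.abs
    refine le_of_tendsto_of_tendsto h1 h2 (Eventually.of_forall fun y => ?_)
    simp only [slope_def_field, abs_div]
    exact div_le_div_of_nonneg_right (abs_abs_sub_abs_le (v y) (v x)) (abs_nonneg _)
  · rw [deriv_zero_of_not_differentiableAt hd]; simp

lemma abs' : ∃ g', Pair (fun x => |v x|) g' ∧ D1 g' ≤ D1 g ∧ M1 (fun x => |v x|) = M1 v
    ∧ N1 (fun x => |v x|) = N1 v := by
  have hm : MemLp (deriv (fun x => |v x|)) 2 volume := by
    refine h.g2.mono (measurable_deriv _).aestronglyMeasurable ?_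
    simpa using h.ae_abs_le
  refine ⟨deriv (fun x => |v x|), ⟨hm, fun a b => ?_, ?_⟩, ?_, ?_, ?_⟩
  · exact ((h.ac_abs a b).integral_deriv_eq_sub).symm
  · simpa using h.m
  · apply integral_mono_ae hm.integrable_sq h.g2i
    filter_upwards [h.ae_abs_le] with x hx
    exact sq_le_sq.2 hx
  · simp [M1]
  · simp only [N1]; congr 1; ext x; congr 1
    rw [show 4 = 2 * 2 from rfl, pow_mul, pow_mul, sq_abs]

end Pair

/-- tent function -/
def tent (a b c : ℝ) (x : ℝ) : ℝ := max 0 (min ((x - a) / (b - a)) ((c - x) / (c - b)))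
/-- its derivative -/
def tentd (a b c : ℝ) : ℝ → ℝ :=
  fun x => (Ioc a b).indicator (fun _ => (b - a)⁻¹) x - (Ioc b c).indicator (fun _ => (c - b)⁻¹) x

section tent
variable {a b c : ℝ} (hab : a < b) (hbc : b < c)
include hab hbc

lemma tent_cont : Continuous (tent a b c) := by unfold tent; fun_prop
lemma tent_nonneg (x : ℝ) : 0 ≤ tent a b c x := le_max_left _ _
lemma tent_le (x : ℝ) (h : x ≤ a) : tent a b c x = 0 := by
  apply max_eq_left
  apply (min_le_left _ _).trans
  exact div_nonpos_of_nonpos_of_nonneg (by linarith) (by linarith)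
lemma tent_ge (x : ℝ) (h : c ≤ x) : tent a b c x = 0 := by
  apply max_eq_left
  apply (min_le_right _ _).trans
  exact div_nonpos_of_nonpos_of_nonneg (by linarith) (by linarith)
lemma tent_l {x : ℝ} (h : x ∈ Icc a b) : tent a b c x = (x - a) / (b - a) := by
  have h1 : (x - a) / (b - a) ≤ 1 := by rw [div_le_one (by linarith)]; linarith [h.2]
  have h2 : 1 ≤ (c - x) / (c - b) := by rw [le_div_iff₀ (by linarith)]; linarith [h.2]
  have h3 : 0 ≤ (x - a) / (b - a) := div_nonneg (by linarith [h.1]) (by linarith)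
  rw [tent, min_eq_left (h1.trans h2), max_eq_right h3]
lemma tent_r {x : ℝ} (h : x ∈ Icc b c) : tent a b c x = (c - x) / (c - b) := by
  have h1 : 1 ≤ (x - a) / (b - a) := by rw [le_div_iff₀ (by linarith)]; linarith [h.1]
  have h2 : (c - x) / (c - b) ≤ 1 := by rw [div_le_one (by linarith)]; linarith [h.1]
  have h3 : 0 ≤ (c - x) / (c - b) := div_nonneg (by linarith [h.2]) (by linarith)
  rw [tent, min_eq_right (h2.trans h1), max_eq_right h3]

lemma tentd_memLp : MemLp (tentd a b c) 2 volume := by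
  apply MemLp.sub
  · exact memLp_indicator_const _ measurableSet_Ioc _ (Or.inr (by simp))
  · exact memLp_indicator_const _ measurableSet_Ioc _ (Or.inr (by simp))

lemma tent_deriv {x : ℝ} (ha : x ≠ a) (hb : x ≠ b) (hc : x ≠ c) : HasDerivAt (tent a b c) (tentd a b c x) x := by
  unfold tentd
  rcases lt_or_gt_of_ne ha with h1 | h1
  · have : tent a b c =ᶠ[𝓝 x] fun _ => 0 := by
      filter_upwards [Iio_mem_nhds h1] with y hy using tent_le hab hbc y (le_of_lt hy)
    rw [indicator_of_notMem, indicator_of_notMem, sub_zero]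
    · exact (hasDerivAt_const x (0:ℝ)).congr_of_eventuallyEq this
    · simp; intro h; linarith
    · simp; intro h; linarith
  rcases lt_or_gt_of_ne hb with h2 | h2
  · have : tent a b c =ᶠ[𝓝 x] fun y => (y - a) / (b - a) := by
      filter_upwards [Ioo_mem_nhds h1 h2] with y hy using tent_l hab hbc ⟨hy.1.le, hy.2.le⟩
    rw [indicator_of_mem, indicator_of_notMem, sub_zero]
    · refine HasDerivAt.congr_of_eventuallyEq ?_ this
      simpa using ((hasDerivAt_id x).sub_const a).div_const (b - a)
    · simp; intro h; linarith
    · exact ⟨h1, h2.le⟩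
  rcases lt_or_gt_of_ne hc with h3 | h3
  · have : tent a b c =ᶠ[𝓝 x] fun y => (c - y) / (c - b) := by
      filter_upwards [Ioo_mem_nhds h2 h3] with y hy using tent_r hab hbc ⟨hy.1.le, hy.2.le⟩
    rw [indicator_of_notMem, indicator_of_mem, zero_sub]
    · refine HasDerivAt.congr_of_eventuallyEq ?_ this
      have := ((hasDerivAt_id x).const_sub c).div_const (c - b)
      simpa [neg_div] using this
    · exact ⟨h2, h3.le⟩
    · simp; intro h; linarith
  · have : tent a b c =ᶠ[𝓝 x] fun _ => 0 := by
      filter_upwards [Ioi_mem_nhds h3] with y hy using tent_ge hab hbc y (le_of_lt hy)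
    rw [indicator_of_notMem, indicator_of_notMem, sub_zero]
    · exact (hasDerivAt_const x (0:ℝ)).congr_of_eventuallyEq this
    · simp; intro h; linarith
    · simp; intro h; linarith

lemma tent_supp {x : ℝ} (hx : x ∉ Icc a c) : tent a b c x = 0 := by
  simp only [mem_Icc, not_and_or, not_le] at hx
  rcases hx with hx | hx
  · exact tent_le hab hbc _ hx.le
  · exact tent_ge hab hbc _ hx.le

lemma tent_hcs : HasCompactSupport (tent a b c) :=
  HasCompactSupport.intro isCompact_Icc fun _ hx => tent_supp hab hbc hx

lemma tent_pair : Pair (tent a b c) (tentd a b c) where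
  g2 := tentd_memLp hab hbc
  ftc x y := by
    symm
    apply integral_eq_of_hasDerivAt_off_countable (s := {a, b, c})
    · exact (Set.toFinite _).countable
    · exact (tent_cont hab hbc).continuousOn
    · rintro z ⟨_, hz⟩
      simp only [mem_insert_iff, mem_singleton_iff, not_or] at hz
      exact tent_deriv hab hbc hz.1 hz.2.1 hz.2.2
    · rw [intervalIntegrable_iff]
      exact ((tentd_memLp hab hbc).locallyIntegrable (by norm_num)).integrableOn_isCompact isCompact_uIcc |>.mono_set uIoc_subset_uIcc
  m := by
    apply Continuous.integrable_of_hasCompactSupport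
    · have := tent_cont hab hbc; fun_prop
    · apply HasCompactSupport.mul_right
      have := (tent_hcs hab hbc)
      exact this.comp_left (g := fun x => x ^ 2) (by simp)

lemma Pair.cross {v g : ℝ → ℝ} (h : Pair v g) :
    Integrable (fun x => g x * tentd a b c x) ∧
    ∫ x, g x * tentd a b c x = (v b - v a) / (b - a) - (v c - v b) / (c - b) := by
  have e : (fun x => g x * tentd a b c x) = fun x => (Ioc a b).indicator (fun x => (b - a)⁻¹ * g x) x
      - (Ioc b c).indicator (fun x => (c - b)⁻¹ * g x) x := by
    ext x
    simp only [tentd, indicator]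
    split_ifs <;> ring
  have i1 : Integrable ((Ioc a b).indicator (fun x => (b - a)⁻¹ * g x)) := by
    rw [integrable_indicator_iff measurableSet_Ioc]
    exact ((h.gint a b).1).const_mul _
  have i2 : Integrable ((Ioc b c).indicator (fun x => (c - b)⁻¹ * g x)) := by
    rw [integrable_indicator_iff measurableSet_Ioc]
    exact ((h.gint b c).1).const_mul _
  rw [e]
  refine ⟨i1.sub i2, ?_⟩
  rw [integral_sub i1 i2, integral_indicator measurableSet_Ioc, integral_indicator measurableSet_Ioc,
    integral_const_mul, integral_const_mul, ← intervalIntegral.integral_of_le hab.le, 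
    ← intervalIntegral.integral_of_le hbc.le, ← h.ftc, ← h.ftc]
  field_simp

/-- mixed moments -/
def mix (a b c : ℝ) (k j : ℕ) (v : ℝ → ℝ) : ℝ := ∫ x, v x ^ k * tent a b c x ^ (j + 1) * Real.exp (2 * x)

lemma mix_int {v : ℝ → ℝ} (hv : Continuous v) (k j : ℕ) :
    Integrable fun x => v x ^ k * tent a b c x ^ (j + 1) * Real.exp (2 * x) := by
  apply Continuous.integrable_of_hasCompactSupport
  · have := tent_cont hab hbc; fun_prop
  · apply HasCompactSupport.mul_right
    apply HasCompactSupport.mul_left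
    exact (tent_hcs hab hbc).comp_left (g := fun x => x ^ (j + 1)) (by simp)

lemma mix_lim {vn : ℕ → ℝ → ℝ} {v B : ℝ → ℝ} (hvn : ∀ n, Continuous (vn n)) (hB : Continuous B)
    (hb : ∀ n x, |vn n x| ≤ B x) (hl : ∀ x, Tendsto (fun n => vn n x) atTop (𝓝 (v x))) (k j : ℕ) :
    Tendsto (fun n => mix a b c k j (vn n)) atTop (𝓝 (mix a b c k j v)) := by
  refine tendsto_integral_of_dominated_convergence _ (fun n => (mix_int hab hbc (hvn n) k j).aestronglyMeasurable)
    (mix_int hab hbc hB k j) (fun n => Eventually.of_forall fun x => ?_) (Eventually.of_forall fun x => ?_)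
  · rw [norm_mul, norm_mul, norm_pow, norm_pow, Real.norm_eq_abs, Real.norm_eq_abs,
      Real.norm_of_nonneg (Real.exp_pos _).le, abs_of_nonneg (tent_nonneg hab hbc x)]
    have := tent_nonneg hab hbc x
    have := hb n x
    gcongr
  · exact (((hl x).pow k).mul_const _).mul_const _

lemma Pair.pert {v g : ℝ → ℝ} (h : Pair v g) (t : ℝ) :
    N1 v + 4 * t * mix a b c 3 0 v + 6 * t ^ 2 * mix a b c 2 1 v + 4 * t ^ 3 * mix a b c 1 2 v
      + t ^ 4 * mix a b c 0 3 v ≤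
    KK * (D1 g + 2 * t * ((v b - v a) / (b - a) - (v c - v b) / (c - b)) + t ^ 2 * D1 (tentd a b c)) *
      (M1 v + 2 * t * mix a b c 1 0 v + t ^ 2 * mix a b c 0 1 v) ∧
    0 ≤ D1 g + 2 * t * ((v b - v a) / (b - a) - (v c - v b) / (c - b)) + t ^ 2 * D1 (tentd a b c) ∧
    0 ≤ M1 v + 2 * t * mix a b c 1 0 v + t ^ 2 * mix a b c 0 1 v := by
  have hT := tent_pair hab hbc
  obtain ⟨hcI, hcE⟩ := h.cross hab hbc
  have eD : D1 (fun x => g x + t * tentd a b c x) =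
      D1 g + 2 * t * ((v b - v a) / (b - a) - (v c - v b) / (c - b)) + t ^ 2 * D1 (tentd a b c) := by
    rw [← hcE]
    simp only [D1]
    have ed : (fun x => (g x + t * tentd a b c x) ^ 2) = fun x => g x ^ 2 + 2 * t * (g x * tentd a b c x)
        + t ^ 2 * tentd a b c x ^ 2 := by ext x; ring
    rw [ed, integral_add, integral_add, integral_const_mul, integral_const_mul]
    · exact h.g2i
    · exact hcI.const_mul _
    · exact (h.g2i.add (hcI.const_mul _))
    · exact (hT.g2i.const_mul _)
  have I := fun k j => mix_int hab hbc h.cont k j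
  have hm : Integrable (fun x => v x ^ 2 * Real.exp (2 * x) + 2 * t * (v x ^ 1 * tent a b c x ^ (0 + 1) * Real.exp (2 * x))
      + t ^ 2 * (v x ^ 0 * tent a b c x ^ (1 + 1) * Real.exp (2 * x))) :=
    (h.m.add ((I 1 0).const_mul _)).add ((I 0 1).const_mul _)
  have em : (fun x => (v x + t * tent a b c x) ^ 2 * Real.exp (2 * x)) =
    (fun x => v x ^ 2 * Real.exp (2 * x) + 2 * t * (v x ^ 1 * tent a b c x ^ (0 + 1) * Real.exp (2 * x))
      + t ^ 2 * (v x ^ 0 * tent a b c x ^ (1 + 1) * Real.exp (2 * x))) := by ext x; ring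
  have eM : M1 (fun x => v x + t * tent a b c x) = M1 v + 2 * t * mix a b c 1 0 v + t ^ 2 * mix a b c 0 1 v := by
    simp only [M1, mix]
    rw [em, integral_add, integral_add, integral_const_mul, integral_const_mul]
    · exact h.m
    · exact (I 1 0).const_mul _
    · exact (h.m.add ((I 1 0).const_mul _))
    · exact ((I 0 1).const_mul _)
  have hp : Pair (fun x => v x + t * tent a b c x) (fun x => g x + t * tentd a b c x) := by
    refine ⟨h.g2.add (hT.g2.const_mul t), fun x y => ?_, ?_⟩
    · rw [intervalIntegral.integral_add (h.gint x y) ((hT.gint x y).const_mul _), intervalIntegral.integral_const_mul,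
        ← h.ftc, ← hT.ftc]; ring
    · rw [em]; exact hm
  have eN : N1 (fun x => v x + t * tent a b c x) = N1 v + 4 * t * mix a b c 3 0 v + 6 * t ^ 2 * mix a b c 2 1 v + 4 * t ^ 3 * mix a b c 1 2 v
      + t ^ 4 * mix a b c 0 3 v := by
    have en : (fun x => (v x + t * tent a b c x) ^ 4 * Real.exp (2 * x)) =
      (fun x => v x ^ 4 * Real.exp (2 * x) + 4 * t * (v x ^ 3 * tent a b c x ^ (0 + 1) * Real.exp (2 * x))
       + 6 * t ^ 2 * (v x ^ 2 * tent a b c x ^ (1 + 1) * Real.exp (2 * x))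
       + 4 * t ^ 3 * (v x ^ 1 * tent a b c x ^ (2 + 1) * Real.exp (2 * x))
       + t ^ 4 * (v x ^ 0 * tent a b c x ^ (3 + 1) * Real.exp (2 * x))) := by ext x; ring
    have i1 := h.quart_int
    have i2 := i1.add ((I 3 0).const_mul (4 * t))
    have i3 := i2.add ((I 2 1).const_mul (6 * t ^ 2))
    have i4 := i3.add ((I 1 2).const_mul (4 * t ^ 3))
    simp only [N1, mix]
    rw [en, integral_add, integral_add, integral_add, integral_add, integral_const_mul, integral_const_mul
      , integral_const_mul, integral_const_mul]
    · exact i1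
    · exact (I 3 0).const_mul _
    · exact i2
    · exact (I 2 1).const_mul _
    · exact i3
    · exact (I 1 2).const_mul _
    · exact i4
    · exact (I 0 3).const_mul _
  have := hp.gn
  rw [eD, eM, eN] at this
  exact ⟨this, eD ▸ D1_nonneg _, eM ▸ M1_nonneg _⟩

end tent

end Part5

section Part6
open Set Filter Topology
open scoped Pointwise ENNReal NNReal

lemma zero_pair : Pair (fun _ => 0) (fun _ => 0) := ⟨by simp, by simp, by simp⟩

lemma KS_nonempty : KS.Nonempty := ⟨_, _, _, zero_pair, by simp [D1], by simp [M1], rfl⟩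

/-- normalized pair -/
structure NP (v g : ℝ → ℝ) : Prop where
  p : Pair v g
  D : D1 g ≤ 1
  M : M1 v ≤ 1
  nn : ∀ x, 0 ≤ v x

lemma exists_max_seq : ∃ vn gn : ℕ → ℝ → ℝ, (∀ n, NP (vn n) (gn n)) ∧
    Tendsto (fun n => N1 (vn n)) atTop (𝓝 KK) := by
  obtain ⟨s, -, hs, hs'⟩ := exists_seq_tendsto_sSup KS_nonempty KS_bdd
  have : ∀ n, ∃ v g, NP v g ∧ N1 v = s n := by
    intro n
    obtain ⟨v, g, h, hD, hM, hN⟩ := hs' n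
    obtain ⟨g', h', hD', hM', hN'⟩ := h.abs'
    exact ⟨_, g', ⟨h', hD'.trans hD, hM'.le.trans hM, fun x => abs_nonneg _⟩, hN'.trans hN⟩
  choose vn gn h1 h2 using this
  refine ⟨vn, gn, h1, ?_⟩
  simp_rw [h2]; exact hs

lemma NP.osc {v g : ℝ → ℝ} (h : NP v g) (x y : ℝ) : |v x - v y| ≤ √|x - y| := by
  apply Real.le_sqrt_of_sq_le
  rw [sq_abs]
  refine (h.p.holder_abs y x).trans ?_
  have := h.D
  have := D1_nonneg g
  nlinarith [abs_nonneg (x - y)]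

lemma exists_max_lim : ∃ (vn gn : ℕ → ℝ → ℝ) (v : ℝ → ℝ), (∀ n, NP (vn n) (gn n)) ∧
    Tendsto (fun n => N1 (vn n)) atTop (𝓝 KK) ∧ ∀ x, Tendsto (fun n => vn n x) atTop (𝓝 (v x)) := by
  obtain ⟨vn, gn, h1, h2⟩ := exists_max_seq
  have hc : IsCompact (Set.pi univ fun q : ℚ => Icc (-(2 * Real.exp (-(q:ℝ) / 2))) (2 * Real.exp (-(q:ℝ) / 2))) :=
    isCompact_univ_pi fun q => isCompact_Icc
  obtain ⟨w, -, φ, hφ, hw⟩ := hc.isSeqCompact (x := fun n q => vn n q) (fun n q _ => by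
    exact abs_le.1 ((h1 n).p.bound (h1 n).D (h1 n).M q))
  rw [tendsto_pi_nhds] at hw
  have key : ∀ x, ∃ y, Tendsto (fun n => vn (φ n) x) atTop (𝓝 y) := by
    intro x
    apply cauchySeq_tendsto_of_complete
    rw [Metric.cauchySeq_iff']
    intro ε hε
    obtain ⟨q, hq1, hq2⟩ := exists_rat_btwn (show x < x + (ε / 4) ^ 2 from lt_add_of_pos_right _ (by positivity))
    obtain ⟨N, hN⟩ := Metric.cauchySeq_iff'.1 (hw q).cauchySeq (ε / 4) (by positivity)
    refine ⟨N, fun n hn => ?_⟩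
    have a1 : ∀ n, |vn n x - vn n q| ≤ ε / 4 := by
      intro n
      refine ((h1 n).osc x q).trans ?_
      rw [Real.sqrt_le_left (by positivity), abs_sub_comm, abs_of_nonneg (by linarith)]
      linarith
    have a2 := hN n hn
    simp only [Function.comp, Real.dist_eq] at a2 ⊢
    have a3 := a1 (φ n)
    have a4 := a1 (φ N)
    rw [abs_le] at a3 a4
    rw [abs_lt] at a2 ⊢
    constructor <;> linarith
  choose v hv using key
  exact ⟨fun n => vn (φ n), fun n => gn (φ n), v, fun n => h1 _, h2.comp hφ.tendsto_atTop, hv⟩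

/-- polynomial first-order condition -/
lemma first_order {α β γ δ p q r s K : ℝ}
    (h : ∀ t : ℝ, K + 4 * t * α + 6 * t ^ 2 * β + 4 * t ^ 3 * γ + t ^ 4 * δ ≤
      K * (1 + 2 * t * p + t ^ 2 * q) * (1 + 2 * t * r + t ^ 2 * s)) : 4 * α = 2 * K * (p + r) := by
  let f : ℝ → ℝ := fun t => K * (1 + 2 * t * p + t ^ 2 * q) * (1 + 2 * t * r + t ^ 2 * s) -
    (K + 4 * t * α + 6 * t ^ 2 * β + 4 * t ^ 3 * γ + t ^ 4 * δ)
  have hm : IsLocalMin f 0 := by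
    refine Eventually.of_forall fun t => ?_
    have := h t
    simp only [f]; ring_nf at this ⊢; linarith
  have hd : HasDerivAt f (2 * K * (p + r) - 4 * α) 0 := by
    have i := hasDerivAt_id (0:ℝ)
    have e1 : HasDerivAt (fun t : ℝ => 1 + 2 * t * p + t ^ 2 * q) (2 * p) 0 := by
      refine (((((i.const_mul 2).mul_const p).const_add 1).add ((i.pow 2).mul_const q))).congr_deriv ?_
      simp
    have e2 : HasDerivAt (fun t : ℝ => 1 + 2 * t * r + t ^ 2 * s) (2 * r) 0 := by
      refine (((((i.const_mul 2).mul_const r).const_add 1).add ((i.pow 2).mul_const s))).congr_deriv ?_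
      simp
    have e3 : HasDerivAt (fun t : ℝ => K + 4 * t * α + 6 * t ^ 2 * β + 4 * t ^ 3 * γ + t ^ 4 * δ) (4 * α) 0 := by
      refine ((((((i.const_mul 4).mul_const α).const_add K).add (((i.pow 2).const_mul 6).mul_const β)).add
        (((i.pow 3).const_mul 4).mul_const γ)).add ((i.pow 4).mul_const δ)).congr_deriv ?_
      simp
    have := ((e1.const_mul K).mul e2).sub e3
    refine this.congr_deriv ?_
    simp; ring
  have := hm.hasDerivAt_eq_zero hd
  linarith

/-- The limit profile. -/
structure Lim (v : ℝ → ℝ) : Prop where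
  cont : Continuous v
  nn : ∀ x, 0 ≤ v x
  le : ∀ x, v x ≤ 2 * Real.exp (-x / 2)
  le' : ∀ x ≤ 0, v x ≤ 2 + √(-x)
  m : Integrable (fun τ => v τ ^ 2 * Real.exp (2 * τ))
  M : M1 v ≤ 1
  ne : ∃ x, v x ≠ 0
  el : ∀ a b c, a < b → b < c →
    (v c - v b) / (c - b) - (v b - v a) / (b - a) = mix a b c 1 0 v - 2 / KK * mix a b c 3 0 v

lemma exists_lim (hK : 0 < KK) : ∃ v, Lim v := by
  obtain ⟨vn, gn, v, h1, h2, h3⟩ := exists_max_lim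
  have hosc : ∀ x y, |v x - v y| ≤ √|x - y| := fun x y =>
    le_of_tendsto ((h3 x).sub (h3 y)).abs (Eventually.of_forall fun n => (h1 n).osc x y)
  have hcont : Continuous v := by
    rw [Metric.continuous_iff]
    intro x ε hε
    refine ⟨ε ^ 2, by positivity, fun y hy => ?_⟩
    rw [Real.dist_eq] at hy ⊢
    refine (hosc y x).trans_lt ?_
    rw [Real.sqrt_lt' hε]; exact hy
  have hnn : ∀ x, 0 ≤ v x := fun x => ge_of_tendsto (h3 x) (Eventually.of_forall fun n => (h1 n).nn x)
  have hb : ∀ n x, |vn n x| ≤ 2 * Real.exp (-x / 2) := fun n x => (h1 n).p.bound (h1 n).D (h1 n).M x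
  have hle : ∀ x, v x ≤ 2 * Real.exp (-x / 2) := fun x => le_of_tendsto (h3 x) (Eventually.of_forall fun n =>
    (le_abs_self _).trans (hb n x))
  have hle' : ∀ x ≤ 0, v x ≤ 2 + √(-x) := fun x hx => le_of_tendsto (h3 x) (Eventually.of_forall fun n =>
    (le_abs_self _).trans ((h1 n).p.bound_neg (h1 n).D (h1 n).M hx))
  have hfat : ∫⁻ x, ENNReal.ofReal (v x ^ 2 * Real.exp (2 * x)) ≤ 1 := by
    calc ∫⁻ x, ENNReal.ofReal (v x ^ 2 * Real.exp (2 * x))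
        = ∫⁻ x, liminf (fun n => ENNReal.ofReal (vn n x ^ 2 * Real.exp (2 * x))) atTop := by
          congr 1; ext x
          exact (ENNReal.tendsto_ofReal (((h3 x).pow 2).mul_const _)).liminf_eq.symm
      _ ≤ liminf (fun n => ∫⁻ x, ENNReal.ofReal (vn n x ^ 2 * Real.exp (2 * x))) atTop := by
          apply lintegral_liminf_le
          intro n
          have := (h1 n).p.cont
          exact (by fun_prop : Continuous fun x => vn n x ^ 2 * Real.exp (2 * x)).measurable.ennreal_ofReal
      _ ≤ liminf (fun n : ℕ => (1:ℝ≥0∞)) atTop := by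
          refine liminf_le_liminf (Eventually.of_forall fun n => ?_)
          rw [← ofReal_integral_eq_lintegral_ofReal (h1 n).p.m (Eventually.of_forall fun x => by positivity)]
          have := (h1 n).M
          rw [M1] at this
          exact ENNReal.ofReal_le_one.2 this
      _ = 1 := by simp
  have hmi : Integrable (fun τ => v τ ^ 2 * Real.exp (2 * τ)) := by
    refine ⟨(by fun_prop : Continuous fun x => v x ^ 2 * Real.exp (2 * x)).aestronglyMeasurable, ?_⟩
    rw [hasFiniteIntegral_iff_ofReal (Eventually.of_forall fun x => by positivity)]
    exact hfat.trans_lt (by simp)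
  have hM : M1 v ≤ 1 := by
    rw [M1, integral_eq_lintegral_of_nonneg_ae (Eventually.of_forall fun x => by positivity) hmi.1]
    exact ENNReal.toReal_le_of_le_ofReal zero_le_one (by simpa using hfat)
  have hmix : ∀ a b c, a < b → b < c → ∀ k j, Tendsto (fun n => mix a b c k j (vn n)) atTop (𝓝 (mix a b c k j v)) :=
    fun a b c hab hbc k j => mix_lim hab hbc (fun n => (h1 n).p.cont) (B := fun x => 2 * Real.exp (-x / 2)) (by fun_prop)
      hb h3 k j
  refine ⟨v, hcont, hnn, hle, hle', hmi, hM, ?_, ?_⟩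
  · by_contra! hz
    have hT : ∀ T, KK ≤ 4 * Real.exp (-T) := by
      intro T
      have hl : Tendsto (fun n => (∫ τ in Iic T, vn n τ ^ 4 * Real.exp (2 * τ)) + 4 * Real.exp (-T)) atTop
          (𝓝 ((∫ τ in Iic T, v τ ^ 4 * Real.exp (2 * τ)) + 4 * Real.exp (-T))) := by
        apply Tendsto.add_const
        refine tendsto_integral_of_dominated_convergence (fun x => 64 * Real.exp x)
          (fun n => (h1 n).p.quart_cont.aestronglyMeasurable) ((integrableOn_exp_Iic T).const_mul 64)
          (fun n => Eventually.of_forall fun x => ?_) (Eventually.of_forall fun x => ((h3 x).pow 4).mul_const _)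
        rw [Real.norm_of_nonneg (by positivity)]
        exact (h1 n).p.quart_bound (h1 n).D (h1 n).M x
      have := le_of_tendsto_of_tendsto h2 hl (Eventually.of_forall fun n => (h1 n).p.quart_split (h1 n).D (h1 n).M T)
      simpa [hz] using this
    have hl : Tendsto (fun T : ℝ => 4 * Real.exp (-T)) atTop (𝓝 (4 * 0)) :=
      (Real.tendsto_exp_neg_atTop_nhds_zero).const_mul 4
    have := ge_of_tendsto hl (Eventually.of_forall hT)
    linarith
  · intro a b c hab hbc
    have key := first_order (α := mix a b c 3 0 v) (β := mix a b c 2 1 v) (γ := mix a b c 1 2 v) (δ := mix a b c 0 3 v)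
      (p := (v b - v a) / (b - a) - (v c - v b) / (c - b)) (q := D1 (tentd a b c)) (r := mix a b c 1 0 v)
      (s := mix a b c 0 1 v) (K := KK) (fun t => by
        have m := hmix a b c hab hbc
        have l1 := (((h2.add ((m 3 0).const_mul (4 * t))).add ((m 2 1).const_mul (6 * t ^ 2))).add
          ((m 1 2).const_mul (4 * t ^ 3))).add ((m 0 3).const_mul (t ^ 4))
        have l2 := (((((((h3 b).sub (h3 a)).div_const (b - a)).sub (((h3 c).sub (h3 b)).div_const (c - b))).const_mul
          (2 * t)).const_add 1).add_const (t ^ 2 * D1 (tentd a b c))).const_mul KK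
        have l3 := (((m 1 0).const_mul (2 * t)).const_add 1).add ((m 0 1).const_mul (t ^ 2))
        refine le_of_tendsto_of_tendsto l1 (l2.mul l3) (Eventually.of_forall fun n => ?_)
        obtain ⟨p1, p2, p3⟩ := (h1 n).p.pert hab hbc t
        refine p1.trans ?_
        have := (h1 n).D
        have := (h1 n).M
        exact mul_le_mul (mul_le_mul_of_nonneg_left (by linarith) hK.le) (by linarith) p3
          (mul_nonneg hK.le (by linarith)))
    field_simp
    linarith

end Part6

section Part7
open Set Filter Topology
open scoped Pointwise ENNReal NNReal

lemma tent_integral {a b c : ℝ} (hab : a < b) (hbc : b < c) {W W' F : ℝ → ℝ} (hF : Continuous F)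
    (h1 : ∀ x, HasDerivAt W (W' x) x) (h2 : ∀ x, HasDerivAt W' (F x) x) :
    ∫ x, tent a b c x * F x = (W c - W b) / (c - b) - (W b - W a) / (b - a) := by
  have hT := tent_cont hab hbc
  have e1 : ∫ x, tent a b c x * F x = ∫ x in a..c, tent a b c x * F x := by
    rw [intervalIntegral.integral_of_le (hab.trans hbc).le, setIntegral_eq_integral_of_forall_compl_eq_zero]
    intro x hx
    simp only [mem_Ioc, not_and_or, not_lt, not_le] at hx
    rcases hx with hx | hx
    · rw [tent_le hab hbc _ hx, zero_mul]
    · rw [tent_ge hab hbc _ hx.le, zero_mul]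
  have hc : Continuous fun x => tent a b c x * F x := by fun_prop
  rw [e1, ← intervalIntegral.integral_add_adjacent_intervals (hc.intervalIntegrable a b) (hc.intervalIntegrable b c)]
  have e2 : ∫ x in a..b, tent a b c x * F x = ∫ x in a..b, (x - a) / (b - a) * F x := by
    apply intervalIntegral.integral_congr
    intro x hx
    rw [uIcc_of_le hab.le] at hx
    simp only
    rw [tent_l hab hbc hx]
  have e3 : ∫ x in b..c, tent a b c x * F x = ∫ x in b..c, (c - x) / (c - b) * F x := by
    apply intervalIntegral.integral_congr
    intro x hx
    rw [uIcc_of_le hbc.le] at hx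
    simp only
    rw [tent_r hab hbc hx]
  have hba : b - a ≠ 0 := by linarith
  have hcb : c - b ≠ 0 := by linarith
  have e4 : ∫ x in a..b, (x - a) / (b - a) * F x = ((b - a) / (b - a) * W' b - W b / (b - a)) - ((a - a) / (b - a) * W' a - W a / (b - a)) := by
    apply intervalIntegral.integral_eq_sub_of_hasDerivAt (f := fun x => (x - a) / (b - a) * W' x - W x / (b - a))
    · intro x _
      have := (((((hasDerivAt_id x).sub_const a).div_const (b - a)).mul (h2 x)).sub ((h1 x).div_const (b - a)))
      refine this.congr_deriv ?_
      simp; ring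
    · apply Continuous.intervalIntegrable; fun_prop
  have e5 : ∫ x in b..c, (c - x) / (c - b) * F x = ((c - c) / (c - b) * W' c + W c / (c - b)) - ((c - b) / (c - b) * W' b + W b / (c - b)) := by
    apply intervalIntegral.integral_eq_sub_of_hasDerivAt (f := fun x => (c - x) / (c - b) * W' x + W x / (c - b))
    · intro x _
      have := (((((hasDerivAt_id x).const_sub c).div_const (c - b)).mul (h2 x)).add ((h1 x).div_const (c - b)))
      refine this.congr_deriv ?_
      simp; ring
    · apply Continuous.intervalIntegrable; fun_prop
  rw [e2, e3, e4, e5, div_self hba, div_self hcb]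
  ring

lemma regularity {v F : ℝ → ℝ} (hF : Continuous F)
    (h : ∀ a b c, a < b → b < c → (v c - v b) / (c - b) - (v b - v a) / (b - a) = ∫ x, tent a b c x * F x) :
    ∃ v' : ℝ → ℝ, (∀ x, HasDerivAt v (v' x) x) ∧ ∀ x, HasDerivAt v' (F x) x := by
  set W' : ℝ → ℝ := fun x => ∫ t in (0:ℝ)..x, F t
  have h2 : ∀ x, HasDerivAt W' (F x) x := fun x => hF.integral_hasStrictDerivAt 0 x |>.hasDerivAt
  have hW' : Continuous W' := continuous_iff_continuousAt.2 fun x => (h2 x).continuousAt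
  set W : ℝ → ℝ := fun x => ∫ t in (0:ℝ)..x, W' t
  have h1 : ∀ x, HasDerivAt W (W' x) x := fun x => hW'.integral_hasStrictDerivAt 0 x |>.hasDerivAt
  set z : ℝ → ℝ := fun x => v x - W x
  have hz : ∀ a b c, a < b → b < c → (z c - z b) * (b - a) = (z b - z a) * (c - b) := by
    intro a b c hab hbc
    have e := h a b c hab hbc
    rw [tent_integral hab hbc hF h1 h2] at e
    have hba : b - a ≠ 0 := by linarith
    have hcb : c - b ≠ 0 := by linarith
    field_simp at e
    simp only [z]
    linarith
  have haff : ∀ x, z x = z 0 + x * (z 1 - z 0) := by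
    intro x
    rcases lt_trichotomy x 0 with hx | hx | hx
    · have := hz x 0 1 hx one_pos
      linarith
    · simp [hx]
    · rcases lt_trichotomy x 1 with hx1 | hx1 | hx1
      · have := hz 0 x 1 hx hx1
        linarith
      · simp [hx1]
      · have := hz 0 1 x one_pos hx1
        linarith
  have hv : v = fun x => W x + (z 0 + x * (z 1 - z 0)) := by
    ext x; rw [← haff]; simp only [z]; ring
  refine ⟨fun x => W' x + (z 1 - z 0), fun x => ?_, fun x => (h2 x).add_const _⟩
  have := (h1 x).add (((hasDerivAt_id x).mul_const (z 1 - z 0)).const_add (z 0))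
  rw [one_mul] at this
  rw [hv]; exact this

/-- solution of the radial equation in logarithmic variable -/
structure Sol (u u' : ℝ → ℝ) : Prop where
  d1 : ∀ x, HasDerivAt u (u' x) x
  d2 : ∀ x, HasDerivAt u' (Real.exp (2 * x) * (u x - u x ^ 3)) x

lemma Lim.sol {v : ℝ → ℝ} (hv : Lim v) (hK : 0 < KK) :
    ∃ u', Sol (fun x => √(2 / KK) * v x) u' := by
  have hc := hv.cont
  obtain ⟨v', h1, h2⟩ := regularity (v := v) (F := fun x => Real.exp (2 * x) * (v x - 2 / KK * v x ^ 3))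
    (by fun_prop) (fun a b c hab hbc => by
      rw [hv.el a b c hab hbc, mix, mix, ← integral_const_mul, ← integral_sub]
      · congr 1; ext x; ring
      · exact mix_int hab hbc hc 1 0
      · exact (mix_int hab hbc hc 3 0).const_mul _)
  refine ⟨fun x => √(2 / KK) * v' x, fun x => (h1 x).const_mul _, fun x => ?_⟩
  refine ((h2 x).const_mul _).congr_deriv ?_
  have := Real.sq_sqrt (show 0 ≤ 2 / KK by positivity)
  linear_combination (√(2 / KK) * Real.exp (2 * x) * v x ^ 3) * this

end Part7

section Part8
open Set Filter Topology
open scoped Pointwise ENNReal NNReal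

/-- positivity from the behaviour at `-∞` -/
lemma pos_of_bot {f f' : ℝ → ℝ} {T : ℝ} (hd : ∀ x, HasDerivAt f (f' x) x) (hp : ∀ x < T, 0 < f' x)
    (hl : Tendsto f atBot (𝓝 0)) : ∀ x ≤ T, 0 < f x := by
  have hm : StrictMonoOn f (Iic T) := by
    apply strictMonoOn_of_deriv_pos (convex_Iic T)
    · exact fun x _ => (hd x).continuousAt.continuousWithinAt
    · intro x hx
      rw [interior_Iic] at hx
      rw [(hd x).deriv]; exact hp x hx
  intro x hx
  have h1 : f (x - 1) < f x := hm (by simp; linarith) hx (by linarith)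
  have h2 : 0 ≤ f (x - 1) := by
    refine le_of_tendsto hl ?_
    filter_upwards [eventually_le_atBot (x - 1)] with y hy
    exact hm.monotoneOn (by simp; linarith) (by simp; linarith) hy
  linarith

lemma nonneg_of_bot {f f' : ℝ → ℝ} {T : ℝ} (hd : ∀ x, HasDerivAt f (f' x) x) (hp : ∀ x ≤ T, 0 ≤ f' x)
    (hl : Tendsto f atBot (𝓝 0)) : ∀ x ≤ T, 0 ≤ f x := by
  have hm : MonotoneOn f (Iic T) := by
    apply monotoneOn_of_deriv_nonneg (convex_Iic T)
    · exact fun x _ => (hd x).continuousAt.continuousWithinAt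
    · exact fun x _ => (hd x).differentiableAt.differentiableWithinAt
    · intro x hx
      rw [interior_Iic] at hx
      rw [(hd x).deriv]; exact hp x (le_of_lt hx)
  intro x hx
  refine le_of_tendsto hl ?_
  filter_upwards [eventually_le_atBot x] with y hy
  exact hm (hy.trans hx) hx hy

lemma hasDerivAt_expmul (l x : ℝ) : HasDerivAt (fun x => Real.exp (l * x)) (l * Real.exp (l * x)) x := by
  have := ((hasDerivAt_id x).const_mul l).exp
  simp at this
  refine this.congr_deriv (by ring)

lemma tendsto_expmul {l : ℝ} (hl : 0 < l) : Tendsto (fun x => Real.exp (l * x)) atBot (𝓝 0) :=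
  Real.tendsto_exp_atBot.comp (tendsto_id.const_mul_atBot hl)

lemma bound_of_bot {f f' : ℝ → ℝ} {T C l : ℝ} (hl0 : 0 < l) (hd : ∀ x, HasDerivAt f (f' x) x)
    (hp : ∀ x ≤ T, |f' x| ≤ C * Real.exp (l * x))
    (hl : Tendsto f atBot (𝓝 0)) : ∀ x ≤ T, |f x| ≤ C / l * Real.exp (l * x) := by
  have he := fun x => (hasDerivAt_expmul l x).const_mul (C / l)
  have ht : Tendsto (fun x => C / l * Real.exp (l * x)) atBot (𝓝 0) := by
    simpa using (tendsto_expmul hl0).const_mul (C / l)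
  have e : ∀ x, C / l * (l * Real.exp (l * x)) = C * Real.exp (l * x) := fun x => by field_simp
  have h1 := nonneg_of_bot (T := T) (fun x => (he x).sub (hd x)) (fun x hx => by
    have := abs_le.1 (hp x hx)
    rw [e]; linarith) (by have := ht.sub hl; rw [sub_zero] at this; exact this)
  have h2 := nonneg_of_bot (T := T) (fun x => (he x).add (hd x)) (fun x hx => by
    have := abs_le.1 (hp x hx)
    rw [e]; linarith) (by have := ht.add hl; rw [add_zero] at this; exact this)
  intro x hx
  have a1 := h1 x hx
  have a2 := h2 x hx
  simp only [Pi.sub_apply, Pi.add_apply] at a1 a2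
  rw [abs_le]; constructor <;> linarith

lemma lin_unique {y y' k : ℝ → ℝ} (hk : Continuous k) (h1 : ∀ x, HasDerivAt y (y' x) x)
    (h2 : ∀ x, HasDerivAt y' (k x * y x) x) {x0 : ℝ} (hy : y x0 = 0) (hy' : y' x0 = 0) : ∀ x, y x = 0 := by
  intro x
  set a := min x x0
  set b := max x x0
  obtain ⟨L, hL⟩ := (isCompact_Icc (a := a) (b := b)).exists_bound_of_continuousOn hk.continuousOn
  set E : ℝ → ℝ := fun s => y s ^ 2 + y' s ^ 2
  have hE : ∀ s, HasDerivAt E (2 * y s * y' s * (1 + k s)) s := fun s => by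
    refine (((h1 s).pow 2).add ((h2 s).pow 2)).congr_deriv ?_
    simp; ring
  have hE0 : E x0 = 0 := by simp [E, hy, hy']
  have hbd : ∀ s ∈ Icc a b, |2 * y s * y' s * (1 + k s)| ≤ (1 + L) * E s := by
    intro s hs
    have hk1 : |1 + k s| ≤ 1 + L := by
      have := hL s hs
      rw [Real.norm_eq_abs, abs_le] at this
      rw [abs_le]; constructor <;> linarith
    have : |2 * y s * y' s| ≤ E s := by
      simp only [E]; rw [abs_le]; constructor <;> nlinarith [sq_nonneg (y s - y' s), sq_nonneg (y s + y' s)]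
    rw [abs_mul, mul_comm]
    gcongr
    exact (abs_nonneg _).trans hk1
  have hx : x ∈ Icc a b := ⟨min_le_left _ _, le_max_left _ _⟩
  have hx0 : x0 ∈ Icc a b := ⟨min_le_right _ _, le_max_right _ _⟩
  have hEx : E x ≤ 0 := by
    rcases le_total x0 x with h | h
    · have hm : AntitoneOn (fun s => E s * Real.exp (-(1 + L) * s)) (Icc a b) := by
        apply antitoneOn_of_deriv_nonpos (convex_Icc a b)
        · exact fun s _ => ((hE s).mul (hasDerivAt_expmul (-(1 + L)) s)).continuousAt.continuousWithinAt
        · exact fun s _ => ((hE s).mul (hasDerivAt_expmul (-(1 + L)) s)).differentiableAt.differentiableWithinAt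
        · intro s hs
          have hs' := interior_subset hs
          have := ((hE s).mul (hasDerivAt_expmul (-(1 + L)) s)).deriv
          erw [this]
          have h3 := (abs_le.1 (hbd s hs')).2
          have := Real.exp_pos (-(1 + L) * s)
          nlinarith
      have := hm hx0 hx h
      simp only [hE0, zero_mul] at this
      exact nonpos_of_mul_nonpos_left this (Real.exp_pos _)
    · have hm : MonotoneOn (fun s => E s * Real.exp ((1 + L) * s)) (Icc a b) := by
        apply monotoneOn_of_deriv_nonneg (convex_Icc a b)
        · exact fun s _ => ((hE s).mul (hasDerivAt_expmul ((1 + L)) s)).continuousAt.continuousWithinAt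
        · exact fun s _ => ((hE s).mul (hasDerivAt_expmul ((1 + L)) s)).differentiableAt.differentiableWithinAt
        · intro s hs
          have hs' := interior_subset hs
          have := ((hE s).mul (hasDerivAt_expmul ((1 + L)) s)).deriv
          erw [this]
          have h3 := (abs_le.1 (hbd s hs')).1
          have := Real.exp_pos ((1 + L) * s)
          nlinarith
      have := hm hx hx0 h
      simp only [hE0, zero_mul] at this
      exact nonpos_of_mul_nonpos_left this (Real.exp_pos _)
  have : y x ^ 2 ≤ 0 := by simp only [E] at hEx; nlinarith [sq_nonneg (y' x)]
  exact pow_eq_zero_iff (two_ne_zero) |>.1 (le_antisymm this (sq_nonneg _))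

namespace Sol
variable {u u' : ℝ → ℝ} (h : Sol u u')
include h
lemma cont : Continuous u := continuous_iff_continuousAt.2 fun x => (h.d1 x).continuousAt
lemma cont' : Continuous u' := continuous_iff_continuousAt.2 fun x => (h.d2 x).continuousAt

lemma pos_of_nonneg (hn : ∀ x, 0 ≤ u x) (hne : ∃ x, u x ≠ 0) (x : ℝ) : 0 < u x := by
  rcases (hn x).lt_or_eq with h1 | h1
  · exact h1
  exfalso
  obtain ⟨z, hz⟩ := hne
  have hm : IsLocalMin u x := Eventually.of_forall fun y => h1 ▸ hn y
  have h0 := hm.hasDerivAt_eq_zero (h.d1 x)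
  have hc := h.cont
  apply hz
  refine lin_unique (k := fun x => Real.exp (2 * x) * (1 - u x ^ 2)) (by fun_prop) h.d1 (fun s => ?_) h1.symm h0 z
  exact (h.d2 s).congr_deriv (by ring)
end Sol

/-- positive solutions with decay -/
structure PS (u u' : ℝ → ℝ) (α : ℝ) : Prop where
  sol : Sol u u'
  pos : ∀ x, 0 < u x
  int : Integrable (fun x => u x ^ 2 * Real.exp (2 * x))
  top : Tendsto u atTop (𝓝 0)
  bot : Tendsto u atBot (𝓝 α)
  bd : ∃ C T, ∀ x ≤ T, |u' x| ≤ C * Real.exp x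

lemma PS.eq_of_eq {u1 u1' u2 u2' : ℝ → ℝ} {α : ℝ} (h1 : PS u1 u1' α) (h2 : PS u2 u2' α) : u1 = u2 := by
  obtain ⟨C1, T1, hb1⟩ := h1.bd
  obtain ⟨C2, T2, hb2⟩ := h2.bd
  have hc1 := h1.sol.cont
  have hc2 := h2.sol.cont
  set k : ℝ → ℝ := fun x => Real.exp (2 * x) * (1 - (u1 x ^ 2 + u1 x * u2 x + u2 x ^ 2))
  have hk : Continuous k := by fun_prop
  set d : ℝ → ℝ := fun x => u1 x - u2 x
  set d' : ℝ → ℝ := fun x => u1' x - u2' x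
  have hd : ∀ x, HasDerivAt d (d' x) x := fun x => (h1.sol.d1 x).sub (h2.sol.d1 x)
  have hd' : ∀ x, HasDerivAt d' (k x * d x) x := fun x => by
    refine ((h1.sol.d2 x).sub (h2.sol.d2 x)).congr_deriv ?_
    simp only [k, d]; ring
  have hdl : Tendsto d atBot (𝓝 0) := by simpa using h1.bot.sub h2.bot
  have hdl' : Tendsto d' atBot (𝓝 0) := by
    refine squeeze_zero_norm' (a := fun x => (C1 + C2) * Real.exp x) ?_ ?_
    · filter_upwards [eventually_le_atBot T1, eventually_le_atBot T2] with x hx1 hx2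
      have a1 := abs_le.1 (hb1 x hx1)
      have a2 := abs_le.1 (hb2 x hx2)
      rw [Real.norm_eq_abs, abs_le]
      simp only [d']
      constructor <;> linarith
    · simpa using Real.tendsto_exp_atBot.const_mul (C1 + C2)
  have hkl : Tendsto (fun x => k x) atBot (𝓝 0) := by
    have a : Tendsto (fun x => (1 - (u1 x ^ 2 + u1 x * u2 x + u2 x ^ 2))) atBot (𝓝 (1 - (α ^ 2 + α * α + α ^ 2))) :=
      (((h1.bot.pow 2).add (h1.bot.mul h2.bot)).add (h2.bot.pow 2)).const_sub 1
    simpa using (tendsto_expmul two_pos).mul a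
  set κ := |1 - (α ^ 2 + α * α + α ^ 2)| + 1
  have hκ : 0 < κ := by positivity
  have hkb : ∀ᶠ x in atBot, |k x| ≤ κ * Real.exp (2 * x) := by
    have a : Tendsto (fun x => |1 - (u1 x ^ 2 + u1 x * u2 x + u2 x ^ 2)|) atBot (𝓝 |1 - (α ^ 2 + α * α + α ^ 2)|) :=
      ((((h1.bot.pow 2).add (h1.bot.mul h2.bot)).add (h2.bot.pow 2)).const_sub 1).abs
    filter_upwards [a.eventually_le_const (lt_add_one _)] with x hx
    simp only [k]
    rw [abs_mul, abs_of_pos (Real.exp_pos _), mul_comm]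
    gcongr
  have hsm : ∀ᶠ x in atBot, κ * Real.exp (2 * x) ≤ 2 := by
    have : Tendsto (fun x => κ * Real.exp (2 * x)) atBot (𝓝 0) := by
      simpa using (tendsto_expmul two_pos).const_mul κ
    exact this.eventually_le_const (by norm_num)
  have hdb : ∀ᶠ x in atBot, |d x| ≤ 1 := by
    have : Tendsto (fun x => |d x|) atBot (𝓝 0) := by simpa using hdl.abs
    exact this.eventually_le_const (by norm_num)
  obtain ⟨T, hT⟩ := eventually_atBot.1 (hkb.and (hsm.and hdb))
  have step : ∀ S : ℝ, (∀ x ≤ T, |d x| ≤ S) → ∀ x ≤ T, |d x| ≤ S / 2 := by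
    intro S hS
    have hS0 : 0 ≤ S := (abs_nonneg _).trans (hS T le_rfl)
    have b1 := bound_of_bot (T := T) (C := κ * S) two_pos hd' (fun x hx => by
      rw [abs_mul]
      have i1 := (hT x hx).1
      have i2 := hS x hx
      calc |k x| * |d x| ≤ (κ * Real.exp (2 * x)) * S := by gcongr
        _ = _ := by ring) hdl'
    have b2 := bound_of_bot (T := T) two_pos hd b1 hdl
    intro x hx
    refine (b2 x hx).trans ?_
    have := (hT x hx).2.1
    calc κ * S / 2 / 2 * Real.exp (2 * x) = (κ * Real.exp (2 * x)) * S / 4 := by ring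
      _ ≤ 2 * S / 4 := by gcongr
      _ = _ := by ring
  have it : ∀ n : ℕ, ∀ x ≤ T, |d x| ≤ (1 / 2) ^ n := by
    intro n
    induction n with
    | zero => intro x hx; simpa using (hT x hx).2.2
    | succ n ih => 
      intro x hx
      have := step _ ih x hx
      rw [pow_succ]; linarith
  have hz : ∀ x ≤ T, d x = 0 := by
    intro x hx
    have : |d x| ≤ 0 := ge_of_tendsto (tendsto_pow_atTop_nhds_zero_of_lt_one (by norm_num) (by norm_num : (1/2:ℝ) < 1))
      (Eventually.of_forall fun n => it n x hx)
    exact abs_nonpos_iff.1 this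
  have hz' : d' (T - 1) = 0 := by
    have : d =ᶠ[𝓝 (T - 1)] fun _ => 0 := by
      filter_upwards [Iio_mem_nhds (show T - 1 < T by linarith)] with x hx using hz x (le_of_lt hx)
    exact (hd (T - 1)).unique ((hasDerivAt_const _ (0:ℝ)).congr_of_eventuallyEq this)
  have := lin_unique hk hd hd' (hz (T - 1) (by linarith)) hz'
  ext x
  have := this x
  simp only [d] at this
  linarith

end Part8

section Part9
open Set Filter Topology
open scoped Pointwise ENNReal NNReal

lemma not_int_of_ge {f : ℝ → ℝ} (hf : Integrable f) {c : ℝ} (hc : 0 < c) (h : ∀ᶠ x in atTop, c ≤ f x) : False := by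
  obtain ⟨T, hT⟩ := eventually_atTop.1 h
  have h1 : IntegrableOn (fun _ : ℝ => c) (Ici T) := by
    refine Integrable.mono (hf.integrableOn (s := Ici T)) aestronglyMeasurable_const ?_
    refine (ae_restrict_mem measurableSet_Ici).mono fun x hx => ?_
    rw [Real.norm_eq_abs, Real.norm_eq_abs, abs_of_pos hc]
    exact (hT x hx).trans (le_abs_self _)
  rw [integrableOn_const_iff] at h1
  simp [hc.ne'] at h1

def JJ (u u' : ℝ → ℝ) (x : ℝ) : ℝ :=
  Real.exp (-(2/3) * x) * (1/2 * u' x ^ 2 + 1/3 * (u x * u' x) + 1/9 * u x ^ 2) +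
    Real.exp (4/3 * x) * (-(1/2) * u x ^ 2 + 1/4 * u x ^ 4)

def kJ (x : ℝ) : ℝ := 1/3 * Real.exp (4/3 * x) + 2/27 * Real.exp (-(2/3) * x)

lemma kJ_pos (x : ℝ) : 0 < kJ x := by unfold kJ; positivity

lemma Sol.JJ_deriv {u u' : ℝ → ℝ} (h : Sol u u') (x : ℝ) : HasDerivAt (JJ u u') (-(kJ x * u x ^ 2)) x := by
  have h1 := h.d1 x
  have h2 := h.d2 x
  have e : Real.exp (4/3 * x) = Real.exp (-(2/3) * x) * Real.exp (2 * x) := by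
    rw [← Real.exp_add]; ring_nf
  have := ((hasDerivAt_expmul (-(2/3)) x).mul ((((h2.pow 2).const_mul (1/2)).add ((h1.mul h2).const_mul (1/3))).add
    ((h1.pow 2).const_mul (1/9)))).add ((hasDerivAt_expmul (4/3) x).mul (((h1.pow 2).const_mul (-(1/2))).add
    ((h1.pow 4).const_mul (1/4))))
  refine (this.congr_deriv ?_)
  simp only [kJ, Pi.add_apply, Pi.mul_apply, Pi.pow_apply, e]
  push_cast
  ring

namespace PS
variable {u u' : ℝ → ℝ} {α : ℝ} (h : PS u u' α)
include h

lemma J_pos (x : ℝ) : 0 < JJ u u' x := by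
  by_contra! hx
  have ha : StrictAnti (JJ u u') := strictAnti_of_deriv_neg fun y => by
    rw [(h.sol.JJ_deriv y).deriv]
    have := mul_pos (kJ_pos y) (pow_pos (h.pos y) 2)
    linarith
  have h1 : JJ u u' (x + 1) < 0 := (ha (by linarith : x < x + 1)).trans_le hx
  refine not_int_of_ge h.int (c := -2 * JJ u u' (x+1)) (by linarith) ?_
  filter_upwards [eventually_ge_atTop (x+1), eventually_ge_atTop 0] with y hy hy0
  have h2 : JJ u u' y ≤ JJ u u' (x + 1) := ha.antitone hy
  have e : Real.exp (4/3 * y) ≤ Real.exp (2 * y) := Real.exp_le_exp.2 (by linarith)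
  have h3 : -(1/2) * (Real.exp (4/3*y) * u y ^ 2) ≤ JJ u u' y := by
    unfold JJ
    have p1 := Real.exp_pos (-(2/3) * y)
    have p2 := Real.exp_pos (4/3 * y)
    have q1 : 0 ≤ 1/2 * u' y ^ 2 + 1/3 * (u y * u' y) + 1/9 * u y ^ 2 := by nlinarith [sq_nonneg (u' y + u y/3)]
    have q2 := mul_nonneg p1.le q1
    have q3 : 0 ≤ Real.exp (4/3 * y) * u y ^ 4 := by positivity
    linarith
  have := mul_le_mul_of_nonneg_right e (sq_nonneg (u y))
  linarith

lemma J_not_ge {δ : ℝ} (hδ : 0 < δ) (hJ : ∀ x ≥ 0, δ ≤ JJ u u' x) : False := by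
  obtain ⟨T, hT⟩ := eventually_atTop.1 (h.top.eventually_lt_const one_pos)
  have hmono : MonotoneOn u' (Ici T) := by
    apply monotoneOn_of_deriv_nonneg (convex_Ici T)
    · exact fun x _ => (h.sol.d2 x).continuousAt.continuousWithinAt
    · exact fun x _ => (h.sol.d2 x).differentiableAt.differentiableWithinAt
    · intro x hx
      have hx := interior_subset hx
      rw [(h.sol.d2 x).deriv]
      have p := h.pos x
      have q := hT x hx
      have : 0 ≤ u x - u x ^ 3 := by nlinarith [mul_pos p (by linarith : 0 < 1 - u x)]
      positivity
  have hnp : ∀ x ≥ T, u' x ≤ 0 := by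
    intro x hx
    by_contra! hc
    have hm : MonotoneOn u (Ici x) := by
      apply monotoneOn_of_deriv_nonneg (convex_Ici x)
      · exact fun x _ => (h.sol.d1 x).continuousAt.continuousWithinAt
      · exact fun x _ => (h.sol.d1 x).differentiableAt.differentiableWithinAt
      · intro y hy
        have hy : x ≤ y := interior_subset hy
        rw [(h.sol.d1 y).deriv]
        exact hc.le.trans (hmono hx (le_trans hx hy) hy)
    have : u x ≤ 0 := ge_of_tendsto h.top (by
      filter_upwards [eventually_ge_atTop x] with y hy
      exact hm self_mem_Ici hy hy)
    exact absurd (h.pos x) (not_lt.2 this)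
  set K := 1/2 * u' T ^ 2 + 1/9
  have hlim : Tendsto (fun x => Real.exp (-(2/3) * x) * K) atTop (𝓝 0) := by
    have : Tendsto (fun x : ℝ => Real.exp (-(2/3) * x)) atTop (𝓝 0) :=
      Real.tendsto_exp_atBot.comp (tendsto_id.const_mul_atTop_of_neg (by norm_num))
    simpa using this.mul_const K
  refine not_int_of_ge h.int (c := 2 * δ) (by linarith) ?_
  filter_upwards [eventually_ge_atTop T, eventually_ge_atTop 0, hlim.eventually_lt_const (half_pos hδ)] with y hy hy0 hy1
  have h1 := hJ y hy0
  have p := h.pos y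
  have q := hT y hy
  have r := hnp y hy
  have s := hmono self_mem_Ici hy hy
  have e : Real.exp (4/3 * y) ≤ Real.exp (2 * y) := Real.exp_le_exp.2 (by linarith)
  have hu2 : u y ^ 2 ≤ 1 := by nlinarith
  have hB : 1/2 * u' y ^ 2 + 1/3 * (u y * u' y) + 1/9 * u y ^ 2 ≤ K := by
    have a1 : u' y ^ 2 ≤ u' T ^ 2 := by nlinarith
    have a2 : u y * u' y ≤ 0 := mul_nonpos_of_nonneg_of_nonpos p.le r
    simp only [K]; linarith
  have := mul_le_mul_of_nonneg_left hB (Real.exp_pos (-(2/3)*y)).le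
  unfold JJ at h1
  have h4 : Real.exp (4/3*y) * u y ^ 4 ≤ Real.exp (2 * y) * u y ^ 2 := by
    have : u y ^ 4 ≤ u y ^ 2 := by nlinarith [sq_nonneg (u y)]
    gcongr
  have h5 : 0 ≤ Real.exp (4/3*y) * u y ^ 2 := by positivity
  linarith

lemma lim' : Tendsto (fun x => Real.exp (-(2/3) * x) * u' x) atBot (𝓝 0) ∧ Tendsto u' atBot (𝓝 0) := by
  obtain ⟨C, T, hb⟩ := h.bd
  constructor
  · refine squeeze_zero_norm' (a := fun x => C * Real.exp (1/3 * x)) ?_ ?_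
    · filter_upwards [eventually_le_atBot T] with x hx
      rw [norm_mul, Real.norm_eq_abs, Real.norm_eq_abs, abs_of_pos (Real.exp_pos _)]
      calc _ ≤ Real.exp (-(2/3) * x) * (C * Real.exp x) := by gcongr; exact hb x hx
        _ = C * (Real.exp (-(2/3) * x) * Real.exp x) := by ring
        _ = _ := by rw [← Real.exp_add]; ring_nf
    · simpa using (tendsto_expmul (l := 1/3) (by norm_num)).const_mul C
  · refine squeeze_zero_norm' (a := fun x => C * Real.exp x) ?_ ?_
    · filter_upwards [eventually_le_atBot T] with x hx using hb x hx
    · simpa using Real.tendsto_exp_atBot.const_mul C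
end PS

lemma PS.no_lt {u1 u1' u2 u2' : ℝ → ℝ} {α1 α2 : ℝ} (h1 : PS u1 u1' α1) (h2 : PS u2 u2' α2) (ha : 0 < α1) (hlt : α2 < α1) :
    False := by
  set P : ℝ → ℝ := fun x => u1 x * u2' x - u2 x * u1' x with hPdef
  set w : ℝ → ℝ := fun x => u2 x / u1 x with hw
  have wpos : ∀ x, 0 < w x := fun x => div_pos (h2.pos x) (h1.pos x)
  have wu : ∀ x, u2 x = w x * u1 x := fun x => by rw [hw]; have := (h1.pos x).ne'; field_simp
  have hP : ∀ x, HasDerivAt P (Real.exp (2*x) * (u1 x * u2 x * (u1 x ^ 2 - u2 x ^ 2))) x := fun x => by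
    refine (((h1.sol.d1 x).mul (h2.sol.d2 x)).sub ((h2.sol.d1 x).mul (h1.sol.d2 x))).congr_deriv ?_
    ring
  have hw' : ∀ x, HasDerivAt w (P x / u1 x ^ 2) x := fun x => by
    refine ((h2.sol.d1 x).div (h1.sol.d1 x) (h1.pos x).ne').congr_deriv ?_
    simp only [P]; ring
  set X : ℝ → ℝ := fun x => w x ^ 2 * JJ u1 u1' x - JJ u2 u2' x with hX
  have hX' : ∀ x, HasDerivAt X (2 * w x * (P x / u1 x ^ 2) * JJ u1 u1' x) x := fun x => by
    refine ((((hw' x).pow 2).mul (h1.sol.JJ_deriv x)).sub (h2.sol.JJ_deriv x)).congr_deriv ?_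
    simp only [Pi.pow_apply, wu x]; push_cast; ring
  have Xeq : ∀ x, X x = 1/2 * (w x ^ 2 * ((Real.exp (-(2/3) * x) * u1' x) * u1' x) - (Real.exp (-(2/3) * x) * u2' x) * u2' x)
      - 1/3 * w x * (u1 x * (Real.exp (-(2/3) * x) * u2' x) - u2 x * (Real.exp (-(2/3) * x) * u1' x))
      + 1/4 * Real.exp (4/3 * x) * (u2 x ^ 2 * (u1 x ^ 2 - u2 x ^ 2)) := fun x => by
    simp only [hX, JJ, wu x]; ring
  have Pl : Tendsto P atBot (𝓝 0) := by
    have := (h1.bot.mul h2.lim'.2).sub (h2.bot.mul h1.lim'.2)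
    simpa using this
  have wl : Tendsto w atBot (𝓝 (α2/α1)) := h2.bot.div h1.bot ha.ne'
  have Xl : Tendsto X atBot (𝓝 0) := by
    have a := ((((wl.pow 2).mul (h1.lim'.1.mul h1.lim'.2)).sub (h2.lim'.1.mul h2.lim'.2)).const_mul (1/2)).sub
      ((wl.const_mul (1/3)).mul ((h1.bot.mul h2.lim'.1).sub (h2.bot.mul h1.lim'.1)))
    have b := a.add (((tendsto_expmul (l := 4/3) (by norm_num)).const_mul (1/4)).mul ((h2.bot.pow 2).mul ((h1.bot.pow 2).sub (h2.bot.pow 2))))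
    have c := b.congr (fun x => (Xeq x).symm)
    simpa using c
  have hev : ∀ᶠ x in atBot, u2 x < u1 x := h2.bot.eventually_lt h1.bot hlt
  obtain ⟨T, hT⟩ := eventually_atBot.1 hev
  have Pder : ∀ x, u2 x < u1 x → 0 < Real.exp (2*x) * (u1 x * u2 x * (u1 x ^ 2 - u2 x ^ 2)) := fun x hx => by
    have a := h1.pos x
    have b := h2.pos x
    have : 0 < u1 x ^ 2 - u2 x ^ 2 := by nlinarith
    positivity
  have PT : ∀ x ≤ T, 0 < P x := pos_of_bot hP (fun x hx => Pder x (hT x hx.le)) Pl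
  have Pc : Continuous P := continuous_iff_continuousAt.2 fun x => (hP x).continuousAt
  have Xpos : ∀ S, (∀ x < S, 0 < P x) → ∀ x ≤ S, 0 < X x := fun S hS => pos_of_bot hX' (fun x hx => by
    have a := wpos x
    have b := hS x hx
    have c := h1.J_pos x
    have d := h1.pos x
    positivity) Xl
  have Ppos : ∀ x, 0 < P x := by
    by_contra! hc
    obtain ⟨z, hz⟩ := hc
    set Z := {x | P x ≤ 0}
    have Zc : IsClosed Z := isClosed_le Pc continuous_const
    have Zb : BddBelow Z := ⟨T, fun x hx => by
      by_contra! hh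
      exact absurd (PT x hh.le) (not_lt.2 hx)⟩
    have hm : sInf Z ∈ Z := Zc.csInf_mem ⟨z, hz⟩ Zb
    set t := sInf Z
    have hlt' : ∀ x < t, 0 < P x := fun x hx => by
      by_contra! hh
      exact absurd (csInf_le Zb hh) (not_le.2 hx)
    have hP0 : P t = 0 := by
      refine le_antisymm hm (ge_of_tendsto (Pc.continuousAt.continuousWithinAt (s := Iio t)).tendsto ?_)
      filter_upwards [self_mem_nhdsWithin] with x hx using (hlt' x hx).le
    have hXt := Xpos t hlt' t le_rfl
    have e1 : u2' t = w t * u1' t := by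
      have : u1 t * u2' t = u1 t * (w t * u1' t) := by
        have : u1 t * u2' t - u2 t * u1' t = 0 := hP0
        rw [wu t] at this; linarith
      exact mul_left_cancel₀ (h1.pos t).ne' this
    have e2 : X t = 1/4 * Real.exp (4/3 * t) * u2 t ^ 2 * (u1 t ^ 2 - u2 t ^ 2) := by
      rw [Xeq, e1, wu t]; ring
    rw [e2] at hXt
    have h3 : 0 < u1 t ^ 2 - u2 t ^ 2 := pos_of_mul_pos_right hXt (by positivity)
    have h4 : u2 t < u1 t := by
      have := h1.pos t; have := h2.pos t
      nlinarith
    have wm : MonotoneOn w (Iic t) := by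
      apply monotoneOn_of_deriv_nonneg (convex_Iic t)
      · exact fun x _ => (hw' x).continuousAt.continuousWithinAt
      · exact fun x _ => (hw' x).differentiableAt.differentiableWithinAt
      · intro x hx
        rw [interior_Iic] at hx
        rw [(hw' x).deriv]
        have := hlt' x hx
        positivity
    have h5 : ∀ x < t, u2 x < u1 x := fun x hx => by
      have : w x ≤ w t := wm hx.le self_mem_Iic hx.le
      have h6 : w t < 1 := (div_lt_one (h1.pos t)).2 h4
      exact (div_lt_one (h1.pos x)).1 (this.trans_lt h6)
    have := pos_of_bot hP (fun x hx => Pder x (h5 x hx)) Pl t le_rfl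
    linarith
  set Y : ℝ → ℝ := fun x => JJ u1 u1' x - JJ u2 u2' x / w x ^ 2 with hY
  have hY' : ∀ x, HasDerivAt Y (2 * JJ u2 u2' x * (P x / u1 x ^ 2) / w x ^ 3) x := fun x => by
    refine ((h1.sol.JJ_deriv x).sub ((h2.sol.JJ_deriv x).div ((hw' x).pow 2) (pow_pos (wpos x) 2).ne')).congr_deriv ?_
    have a := (wpos x).ne'
    have b := (h1.pos x).ne'
    simp only [Pi.pow_apply]
    rw [wu x]
    push_cast
    field_simp
    ring
  have Ym : Monotone Y := monotone_of_deriv_nonneg (fun x => (hY' x).differentiableAt) fun x => by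
    rw [(hY' x).deriv]
    have a := h2.J_pos x
    have b := Ppos x
    have c := wpos x
    positivity
  have Y0 : 0 < Y 0 := by
    have := Xpos 0 (fun x _ => Ppos x) 0 le_rfl
    have e : Y 0 = X 0 / w 0 ^ 2 := by
      have := (wpos 0).ne'
      simp only [hY, hX]; field_simp
    rw [e]
    have := wpos 0
    positivity
  refine h1.J_not_ge Y0 fun x hx => (Ym hx).trans ?_
  have a := h2.J_pos x
  have c := wpos x
  have : 0 < JJ u2 u2' x / w x ^ 2 := by positivity
  simp only [hY]; linarith

lemma PS.unique {u1 u1' u2 u2' : ℝ → ℝ} {α1 α2 : ℝ} (h1 : PS u1 u1' α1) (h2 : PS u2 u2' α2) (ha : 0 < α1) :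
    u2 = u1 := by
  rcases lt_trichotomy α2 α1 with h | h | h
  · exact (h1.no_lt h2 ha h).elim
  · subst h; exact h2.eq_of_eq h1
  · exact (h2.no_lt h1 (ha.trans h) h).elim

end Part9

section Part10
open Set Filter Topology
open scoped Pointwise ENNReal NNReal

lemma Sol.bot_limit {u u' : ℝ → ℝ} (h : Sol u u') (hpos : ∀ x, 0 < u x) {c : ℝ} (hc : 0 < c)
    (hle : ∀ x ≤ 0, u x ≤ c * (2 + √(-x))) :
    ∃ α, Tendsto u atBot (𝓝 α) ∧ ∃ C T, ∀ x ≤ T, |u' x| ≤ C * Real.exp x := by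
  set K := 64 * (c + c ^ 3)
  have hK : 0 < K := by positivity
  have hb : ∀ x ≤ 0, |Real.exp (2 * x) * (u x - u x ^ 3)| ≤ K * Real.exp x := by
    intro x hx
    set y := 2 + √(-x)
    have hs := Real.sqrt_nonneg (-x)
    have hy : 2 ≤ y := by simp only [y]; linarith
    have hsq := Real.sq_sqrt (neg_nonneg.2 hx)
    have hy2 : y ^ 2 ≤ 8 * Real.exp (-x/2) := by
      have := Real.add_one_le_exp (-x/2)
      simp only [y]
      nlinarith [sq_nonneg (√(-x) - 2)]
    have hy4 : y ^ 4 ≤ 64 * Real.exp (-x) := by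
      have e : Real.exp (-x) = Real.exp (-x/2) ^ 2 := by rw [← Real.exp_nat_mul]; congr 1; push_cast; ring
      rw [e]
      have := Real.exp_pos (-x/2)
      calc y ^ 4 = (y^2)^2 := by ring
        _ ≤ (8 * Real.exp (-x/2))^2 := by gcongr
        _ = _ := by ring
    have hu := hle x hx
    have hp := hpos x
    have h3 : u x ^ 3 ≤ c ^ 3 * y ^ 4 := by
      calc u x ^ 3 ≤ (c * y) ^ 3 := by gcongr
        _ = c ^ 3 * (y ^ 3 * 1) := by ring
        _ ≤ c ^ 3 * (y ^ 3 * y) := by gcongr; linarith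
        _ = _ := by ring
    have h1 : u x ≤ c * y ^ 4 := by
      have : y ≤ y ^ 4 := by
        calc y = y * 1 := by ring
          _ ≤ y * y ^ 3 := by gcongr; exact one_le_pow₀ (by linarith)
          _ = _ := by ring
      nlinarith
    have h4 : |u x - u x ^ 3| ≤ (c + c ^ 3) * y ^ 4 := by
      have : 0 < u x ^ 3 := by positivity
      rw [abs_le]; constructor <;> nlinarith [show 0 < c * y^4 by positivity, show 0 < c^3 * y^4 by positivity]
    rw [abs_mul, abs_of_pos (Real.exp_pos _)]
    calc _ ≤ Real.exp (2*x) * ((c + c ^ 3) * (64 * Real.exp (-x))) := by gcongr; exact h4.trans (by gcongr)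
      _ = K * (Real.exp (2 * x) * Real.exp (-x)) := by simp only [K]; ring
      _ = _ := by rw [← Real.exp_add]; ring_nf
  have hd := fun x => (Real.hasDerivAt_exp x).const_mul K
  have m1 : MonotoneOn (fun x => u' x + K * Real.exp x) (Iic 0) := by
    apply monotoneOn_of_deriv_nonneg (convex_Iic 0)
    · exact fun x _ => ((h.d2 x).add (hd x)).continuousAt.continuousWithinAt
    · exact fun x _ => ((h.d2 x).add (hd x)).differentiableAt.differentiableWithinAt
    · intro x hx
      have := ((h.d2 x).add (hd x)).deriv
      erw [this]
      have := abs_le.1 (hb x (mem_Iic.1 (interior_subset hx)))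
      linarith
  have m2 : AntitoneOn (fun x => u' x - K * Real.exp x) (Iic 0) := by
    apply antitoneOn_of_deriv_nonpos (convex_Iic 0)
    · exact fun x _ => ((h.d2 x).sub (hd x)).continuousAt.continuousWithinAt
    · exact fun x _ => ((h.d2 x).sub (hd x)).differentiableAt.differentiableWithinAt
    · intro x hx
      have := ((h.d2 x).sub (hd x)).deriv
      erw [this]
      have := abs_le.1 (hb x (mem_Iic.1 (interior_subset hx)))
      linarith
  have hu'1 : ∀ x ≤ 0, u' x ≤ K * Real.exp x := by
    intro x0 hx0
    by_contra! hh
    set δ := u' x0 - K * Real.exp x0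
    have hδ : 0 < δ := by simp only [δ]; linarith
    have mm : MonotoneOn (fun x => u x - δ * x) (Iic x0) := by
      have hd1 := fun x => (h.d1 x).sub ((hasDerivAt_id x).const_mul δ)
      apply monotoneOn_of_deriv_nonneg (convex_Iic x0)
      · exact fun x _ => (hd1 x).continuousAt.continuousWithinAt
      · exact fun x _ => (hd1 x).differentiableAt.differentiableWithinAt
      · intro x hx
        have hx : x ≤ x0 := mem_Iic.1 (interior_subset hx)
        have := (hd1 x).deriv
        erw [this]
        have h1 : δ ≤ u' x - K * Real.exp x := m2 (hx.trans hx0) hx0 hx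
        have := mul_pos hK (Real.exp_pos x)
        linarith
    have hx : x0 - u x0 / δ ≤ x0 := by have := div_pos (hpos x0) hδ; linarith
    have := mm hx self_mem_Iic hx
    simp only at this
    have e : δ * (x0 - u x0 / δ) = δ * x0 - u x0 := by field_simp
    have := hpos (x0 - u x0 / δ)
    linarith
  have hu'2 : ∀ x ≤ 0, -(K * Real.exp x) ≤ u' x := by
    intro x0 hx0
    by_contra! hh
    set δ := -(u' x0 + K * Real.exp x0)
    have hδ : 0 < δ := by simp only [δ]; linarith
    have mm : AntitoneOn (fun x => u x + δ * x) (Iic x0) := by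
      have hd1 := fun x => (h.d1 x).add ((hasDerivAt_id x).const_mul δ)
      apply antitoneOn_of_deriv_nonpos (convex_Iic x0)
      · exact fun x _ => (hd1 x).continuousAt.continuousWithinAt
      · exact fun x _ => (hd1 x).differentiableAt.differentiableWithinAt
      · intro x hx
        have hx : x ≤ x0 := mem_Iic.1 (interior_subset hx)
        have := (hd1 x).deriv
        erw [this]
        have h1 : u' x + K * Real.exp x ≤ u' x0 + K * Real.exp x0 := m1 (hx.trans hx0) hx0 hx
        have := mul_pos hK (Real.exp_pos x)
        simp only [δ]
        linarith
    set G := 2 * c + c ^ 2 / (2 * δ) - δ * x0 with hG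
    have hG0 : 0 < G := by
      have : 0 ≤ δ * (-x0) := mul_nonneg hδ.le (by linarith)
      have : 0 < c ^ 2 / (2 * δ) := by positivity
      simp only [G]; linarith
    have hx : x0 - 2 * G / δ ≤ x0 := by have : 0 < 2 * G / δ := by positivity
                                        linarith
    have h1 := mm hx self_mem_Iic hx
    simp only at h1
    set x := x0 - 2 * G / δ
    have h2 := hle x (hx.trans hx0)
    have hsq := Real.sq_sqrt (neg_nonneg.2 (hx.trans hx0))
    have h3 : c * √(-x) ≤ δ * (-x) / 2 + c ^ 2 / (2 * δ) := by
      have : δ * (-x) / 2 + c ^ 2 / (2 * δ) - c * √(-x) = (δ * √(-x) - c) ^ 2 / (2 * δ) := by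
        nth_rewrite 1 [← hsq]; field_simp; ring
      have h' : 0 ≤ (δ * √(-x) - c) ^ 2 / (2 * δ) := by positivity
      linarith
    have e : δ * x = δ * x0 - 2 * G := by simp only [x]; field_simp
    have := hpos x0
    have : 0 ≤ δ * (-x0) := mul_nonneg hδ.le (by linarith)
    nlinarith
  have hab : ∀ x ≤ 0, |u' x| ≤ K * Real.exp x := fun x hx => abs_le.2 ⟨hu'2 x hx, hu'1 x hx⟩
  have m3 : MonotoneOn (fun x => u x + K * Real.exp x) (Iic 0) := by
    apply monotoneOn_of_deriv_nonneg (convex_Iic 0)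
    · exact fun x _ => ((h.d1 x).add (hd x)).continuousAt.continuousWithinAt
    · exact fun x _ => ((h.d1 x).add (hd x)).differentiableAt.differentiableWithinAt
    · intro x hx
      have := ((h.d1 x).add (hd x)).deriv
      erw [this]
      have := hu'2 x (mem_Iic.1 (interior_subset hx))
      linarith
  set F : ℝ → ℝ := fun x => u (min x 0) + K * Real.exp (min x 0)
  have Fm : Monotone F := fun x y hxy => m3 (mem_Iic.2 (min_le_right _ _)) (mem_Iic.2 (min_le_right _ _)) (min_le_min_right 0 hxy)
  have Fl := tendsto_atBot_ciInf Fm ⟨0, by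
    rintro _ ⟨x, rfl⟩
    have := hpos (min x 0)
    simp only [F]; positivity⟩
  refine ⟨⨅ x, F x, ?_, K, 0, hab⟩
  have h0 : Tendsto (fun x => K * Real.exp x) atBot (𝓝 0) := by simpa using Real.tendsto_exp_atBot.const_mul K
  have := Fl.sub h0
  rw [sub_zero] at this
  refine this.congr' ?_
  filter_upwards [eventually_le_atBot 0] with x hx
  simp only [F, min_eq_left hx]; ring

lemma Lim.ps {v : ℝ → ℝ} (hv : Lim v) (hK : 0 < KK) : ∃ u' α, PS (fun x => √(2 / KK) * v x) u' α := by
  obtain ⟨u', hs⟩ := hv.sol hK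
  have hc : 0 < √(2 / KK) := Real.sqrt_pos.2 (by positivity)
  have hpos : ∀ x, 0 < √(2 / KK) * v x := by
    refine hs.pos_of_nonneg (fun x => mul_nonneg hc.le (hv.nn x)) ?_
    obtain ⟨x, hx⟩ := hv.ne
    exact ⟨x, mul_ne_zero hc.ne' hx⟩
  obtain ⟨α, h1, h2⟩ := hs.bot_limit hpos hc (fun x hx => by gcongr; exact hv.le' x hx)
  refine ⟨u', α, hs, hpos, ?_, ?_, h1, h2⟩
  · have := hv.m.const_mul (√(2 / KK) ^ 2)
    refine this.congr (Eventually.of_forall fun x => ?_)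
    simp only; ring
  · have h0 : Tendsto (fun x : ℝ => √(2 / KK) * (2 * Real.exp (-(1/2) * x))) atTop (𝓝 0) := by
      have : Tendsto (fun x : ℝ => Real.exp (-(1/2) * x)) atTop (𝓝 0) :=
        Real.tendsto_exp_atBot.comp (tendsto_id.const_mul_atTop_of_neg (by norm_num))
      simpa using (this.const_mul 2).const_mul (√(2/KK))
    refine squeeze_zero (fun x => (hpos x).le) (fun x => ?_) h0
    have := hv.le x
    rw [show -x/2 = -(1/2) * x by ring] at this
    gcongr

lemma KK_le {q q' : ℝ → ℝ} {α : ℝ} (hq : PS q q' α) (hα : 0 < α) : M1 q * KK ≤ 2 := by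
  rcases le_or_gt KK 0 with hK | hK
  · have := M1_nonneg q
    nlinarith
  obtain ⟨v, hv⟩ := exists_lim hK
  obtain ⟨u', β, hps⟩ := hv.ps hK
  have e := hq.unique hps hα
  have : M1 q = 2 / KK * M1 v := by
    rw [← e]
    simp only [M1, mul_pow]
    rw [Real.sq_sqrt (by positivity), ← integral_const_mul]
    congr 1; ext x; ring
  have hM := hv.M
  rw [this]
  calc _ = 2 * M1 v := by field_simp
    _ ≤ 2 := by linarith

lemma gn_sharp {q q' : ℝ → ℝ} {α : ℝ} (hq : PS q q' α) (hα : 0 < α) {v g : ℝ → ℝ} (h : Pair v g) :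
    M1 q * N1 v ≤ 2 * D1 g * M1 v := by
  have h1 := h.gn
  have h2 := KK_le hq hα
  have h3 : 0 ≤ D1 g * M1 v := mul_nonneg (D1_nonneg g) (M1_nonneg v)
  calc M1 q * N1 v ≤ M1 q * (KK * D1 g * M1 v) := mul_le_mul_of_nonneg_left h1 (M1_nonneg q)
    _ = (M1 q * KK) * (D1 g * M1 v) := by ring
    _ ≤ 2 * (D1 g * M1 v) := by gcongr
    _ = _ := by ring

end Part10

section Part11
open Set Filter Topology
open scoped Pointwise ENNReal NNReal

lemma exp_lintegral (F : ℝ → ℝ≥0∞) :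
    ∫⁻ r in Ioi (0:ℝ), F r = ∫⁻ τ, ENNReal.ofReal (Real.exp τ) * F (Real.exp τ) := by
  have := lintegral_image_eq_lintegral_abs_deriv_mul (s := univ) (f := Real.exp) (f' := Real.exp) MeasurableSet.univ
    (fun x _ => (Real.hasDerivAt_exp x).hasDerivWithinAt) Real.exp_injective.injOn F
  rw [image_univ, Real.range_exp] at this
  rw [this]; simp

lemma exp_integral (F : ℝ → ℝ) :
    ∫ r in Ioi (0:ℝ), F r = ∫ τ, Real.exp τ * F (Real.exp τ) := by
  have := integral_image_eq_integral_abs_deriv_smul (s := univ) (f := Real.exp) (f' := Real.exp) MeasurableSet.univ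
    (fun x _ => (Real.hasDerivAt_exp x).hasDerivWithinAt) Real.exp_injective.injOn F
  rw [image_univ, Real.range_exp] at this
  rw [this]; simp

lemma exp_integrable (F : ℝ → ℝ) :
    IntegrableOn F (Ioi (0:ℝ)) ↔ Integrable fun τ => Real.exp τ * F (Real.exp τ) := by
  have := integrableOn_image_iff_integrableOn_abs_deriv_smul (s := univ) (f := Real.exp) (f' := Real.exp) MeasurableSet.univ
    (fun x _ => (Real.hasDerivAt_exp x).hasDerivWithinAt) Real.exp_injective.injOn F
  rw [image_univ, Real.range_exp] at this
  rw [this]; simp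

lemma norm_integrable (F : ℝ → ℝ) :
    Integrable (fun x : E2 => F ‖x‖) ↔ Integrable fun τ => F (Real.exp τ) * Real.exp (2 * τ) := by
  rw [integrable_fun_norm_addHaar, exp_integrable]
  apply iff_of_eq; congr 1; ext τ
  simp only [finrank_euclideanSpace, Fintype.card_fin, smul_eq_mul]
  rw [two_mul, Real.exp_add]; ring

lemma norm_integral (F : ℝ → ℝ) :
    ∫ x : E2, F ‖x‖ = 2 * Real.pi * ∫ τ, F (Real.exp τ) * Real.exp (2 * τ) := by
  rw [integral_fun_norm_addHaar, exp_integral]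
  simp only [finrank_euclideanSpace, Fintype.card_fin, smul_eq_mul, Measure.real, EuclideanSpace.volume_ball_fin_two]
  simp only [ENNReal.ofReal_one, one_pow, one_mul, ENNReal.toReal_ofReal Real.pi_pos.le, nsmul_eq_mul]
  push_cast
  rw [mul_assoc]
  congr 3; ext τ
  rw [two_mul, Real.exp_add]; ring

abbrev e0 : E2 := EuclideanSpace.single 0 1
abbrev e1 : E2 := EuclideanSpace.single 1 1

lemma norm_e0 : ‖e0‖ = 1 := by simp [e0]

section Qsec
variable {Q : E2 → ℝ} (hs : ContDiff ℝ (⊤ : ℕ∞) Q) (hpos : ∀ x, 0 < Q x) (hrad : ∀ x y : E2, ‖x‖ = ‖y‖ → Q x = Q y)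
  (hpde : ∀ x, -lap Q x + Q x - Q x ^ 3 = 0)

include hs in
lemma Q_d1 (x : E2) : HasFDerivAt Q (fderiv ℝ Q x) x :=
  ((hs.differentiable (by simp)) x).hasFDerivAt

include hs in
lemma Q_d2 (x : E2) : HasFDerivAt (fderiv ℝ Q) (fderiv ℝ (fderiv ℝ Q) x) x := by
  have : ContDiff ℝ 1 (fderiv ℝ Q) := (contDiff_infty.1 hs 2).fderiv_right (by norm_num)
  exact ((this.differentiable (by simp)) x).hasFDerivAt

include hs in
lemma Q_c1 : Continuous (fderiv ℝ Q) := continuous_iff_continuousAt.2 fun x => (Q_d2 hs x).continuousAt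

include hs in
lemma f_d1 (w : E2) (r : ℝ) : HasDerivAt (fun r : ℝ => Q (r • w)) (fderiv ℝ Q (r • w) w) r := by
  have h := (hasDerivAt_id r).smul_const w
  simp only [id, one_smul] at h
  exact (Q_d1 hs (r • w)).comp_hasDerivAt r h

include hs in
lemma f_d2 (w : E2) (r : ℝ) : HasDerivAt (fun r : ℝ => fderiv ℝ Q (r • w) w) (fderiv ℝ (fderiv ℝ Q) (r • w) w w) r := by
  have h := (hasDerivAt_id r).smul_const w
  simp only [id, one_smul] at h
  have h2 := (Q_d2 hs (r • w)).comp_hasDerivAt r h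
  simpa using h2.clm_apply (hasDerivAt_const r w)

lemma norm_cs (r t : ℝ) : ‖(r * Real.cos t) • e0 + (r * Real.sin t) • e1‖ = |r| := by
  rw [EuclideanSpace.norm_eq]
  simp only [Fin.sum_univ_two]
  simp [e0, e1]
  rw [← Real.sqrt_sq_eq_abs]
  congr 1
  simp only [mul_pow, sq_abs, Real.sq_sqrt (sq_nonneg r)]
  linear_combination r ^ 2 * Real.sin_sq_add_cos_sq t

include hs hrad in
lemma Q_ang {r : ℝ} (hr : 0 < r) : r * fderiv ℝ (fderiv ℝ Q) (r • e0) e1 e1 = fderiv ℝ Q (r • e0) e0 := by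
  set c : ℝ → E2 := fun t => (r * Real.cos t) • e0 + (r * Real.sin t) • e1 with hc
  set c' : ℝ → E2 := fun t => (r * (-Real.sin t)) • e0 + (r * Real.cos t) • e1 with hc'
  have h1 : ∀ t, HasDerivAt c (c' t) t := fun t =>
    (((Real.hasDerivAt_cos t).const_mul r).smul_const e0).add (((Real.hasDerivAt_sin t).const_mul r).smul_const e1)
  have h2 : ∀ t, HasDerivAt c' ((r * (-Real.cos t)) • e0 + (r * (-Real.sin t)) • e1) t := fun t =>
    (((Real.hasDerivAt_sin t).neg.const_mul r).smul_const e0).add (((Real.hasDerivAt_cos t).const_mul r).smul_const e1)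
  have hz : ∀ t, fderiv ℝ Q (c t) (c' t) = 0 := fun t => by
    have a := (Q_d1 hs (c t)).comp_hasDerivAt t (h1 t)
    have e : Q ∘ c = fun _ => Q (r • e0) := by
      ext s
      refine hrad _ _ ?_
      rw [hc, norm_cs, norm_smul, norm_e0, mul_one, Real.norm_eq_abs]
    rw [e] at a
    exact a.unique (hasDerivAt_const _ _)
  have hz' : (fun t => fderiv ℝ Q (c t) (c' t)) = fun _ => 0 := funext hz
  have b := ((Q_d2 hs (c 0)).comp_hasDerivAt 0 (h1 0)).clm_apply (h2 0)
  have b' := b.unique ((hasDerivAt_const (0:ℝ) (0:ℝ)).congr_of_eventuallyEq (Eventually.of_forall fun t => hz t))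
  have c0 : c 0 = r • e0 := by simp [hc]
  have c0' : c' 0 = r • e1 := by simp [hc']
  rw [c0, c0'] at b'
  simp [c0] at b'
  rw [← sub_eq_add_neg, sub_eq_zero] at b'
  simpa [hr.ne'] using b'

/-- the profile of `Q` in logarithmic variable -/
def qf (Q : E2 → ℝ) (τ : ℝ) : ℝ := Q (Real.exp τ • e0)
def qf' (Q : E2 → ℝ) (τ : ℝ) : ℝ := Real.exp τ * fderiv ℝ Q (Real.exp τ • e0) e0

include hs hrad hpde in
lemma qf_sol : Sol (qf Q) (qf' Q) where
  d1 x := by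
    refine ((f_d1 hs e0 (Real.exp x)).comp x (Real.hasDerivAt_exp x)).congr_deriv ?_
    rw [qf', mul_comm]
  d2 x := by
    refine ((Real.hasDerivAt_exp x).mul ((f_d2 hs e0 (Real.exp x)).comp x (Real.hasDerivAt_exp x))).congr_deriv ?_
    have p := hpde (Real.exp x • e0)
    have a := Q_ang hs hrad (Real.exp_pos x)
    simp only [lap, Fin.sum_univ_two, iteratedFDeriv_two_apply] at p
    simp at p
    simp only [Function.comp, qf]
    rw [two_mul, Real.exp_add]
    rw [← a]
    linear_combination (-Real.exp x * Real.exp x) * p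

include hrad in
lemma Q_norm (x : E2) : Q x = Q (‖x‖ • e0) := hrad _ _ (by rw [norm_smul, norm_e0]; simp)

include hs hrad in
lemma Q_fd_le (x : E2) : |fderiv ℝ Q (‖x‖ • e0) e0| ≤ ‖fderiv ℝ Q x‖ := by
  obtain ⟨w, hw, hx⟩ : ∃ w : E2, ‖w‖ = 1 ∧ x = ‖x‖ • w := by
    by_cases h : x = 0
    · exact ⟨e0, norm_e0, by simp [h]⟩
    · have := norm_ne_zero_iff.2 h
      refine ⟨‖x‖⁻¹ • x, ?_, ?_⟩
      · rw [norm_smul]; simp [this]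
      · rw [smul_smul, mul_inv_cancel₀ this, one_smul]
  have h1 := f_d1 hs e0 ‖x‖
  have h2 := f_d1 hs w ‖x‖
  have e : (fun r : ℝ => Q (r • e0)) = fun r : ℝ => Q (r • w) := by
    ext r
    exact hrad _ _ (by rw [norm_smul, norm_smul, hw, norm_e0])
  rw [e] at h1
  rw [h1.unique h2, ← hx, ← Real.norm_eq_abs]
  have := (fderiv ℝ Q x).le_opNorm w
  rwa [hw, mul_one] at this

include hs hpos hrad hpde in
lemma Q_ps (h2 : Integrable (fun x => Q x ^ 2)) (hg : Integrable (fun x => ‖fderiv ℝ Q x‖ ^ 2)) :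
    PS (qf Q) (qf' Q) (Q 0) ∧ ∫ x, Q x ^ 2 = 2 * Real.pi * M1 (qf Q) := by
  have hsol := qf_sol hs hrad hpde
  have hcQ := hs.continuous
  have hc1 := Q_c1 hs
  have e2 : (fun x => Q x ^ 2) = fun x : E2 => (fun r : ℝ => Q (r • e0) ^ 2) ‖x‖ := by
    ext x; rw [Q_norm hrad x]
  have hqint : Integrable (fun x => qf Q x ^ 2 * Real.exp (2 * x)) := by
    rw [e2] at h2
    exact (norm_integrable (fun r : ℝ => Q (r • e0) ^ 2)).1 h2
  have hg' : Integrable (fun x : E2 => (fun r : ℝ => (fderiv ℝ Q (r • e0) e0) ^ 2) ‖x‖) := by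
    refine hg.mono (Continuous.aestronglyMeasurable (by fun_prop)) (Eventually.of_forall fun x => ?_)
    simp only [norm_pow, norm_norm]
    gcongr
    exact Q_fd_le hs hrad x
  replace hg' := (norm_integrable (fun r : ℝ => (fderiv ℝ Q (r • e0) e0) ^ 2)).1 hg'
  have hpair : Pair (qf Q) (qf' Q) := by
    refine ⟨?_, ?_, hqint⟩
    · rw [memLp_two_iff_integrable_sq hsol.cont'.aestronglyMeasurable]
      refine hg'.congr (Eventually.of_forall fun x => ?_)
      simp only [qf']
      rw [two_mul, Real.exp_add]; ring
    · intro a b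
      rw [intervalIntegral.integral_eq_sub_of_hasDerivAt (fun x _ => hsol.d1 x) (hsol.cont'.intervalIntegrable _ _)]
  refine ⟨⟨hsol, fun x => hpos _, hqint, ?_, ?_, ?_⟩, ?_⟩
  · have hD := D1_nonneg (qf' Q)
    have hM := M1_nonneg (qf Q)
    set l := (1 + D1 (qf' Q) + M1 (qf Q))⁻¹
    have hl : 0 < l := by positivity
    have hl1 : l * (1 + D1 (qf' Q) + M1 (qf Q)) = 1 := inv_mul_cancel₀ (by positivity)
    have a1 : l ≤ 1 := by nlinarith
    have hb := (hpair.scale l 0).bound (by rw [Pair.D1_scale]; nlinarith [mul_nonneg hl.le hD, mul_nonneg hl.le hM])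
      (by rw [Pair.M1_scale]; simp only [mul_zero, neg_zero, Real.exp_zero]; nlinarith [mul_nonneg hl.le hD, mul_nonneg hl.le hM])
    have h0 : Tendsto (fun x : ℝ => l⁻¹ * (2 * Real.exp (-(1/2) * x))) atTop (𝓝 0) := by
      have : Tendsto (fun x : ℝ => Real.exp (-(1/2) * x)) atTop (𝓝 0) :=
        Real.tendsto_exp_atBot.comp (tendsto_id.const_mul_atTop_of_neg (by norm_num))
      simpa using (this.const_mul 2).const_mul (l⁻¹)
    refine squeeze_zero (fun x => (hpos _).le) (fun x => ?_) h0
    have := hb x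
    rw [add_zero, abs_mul, abs_of_pos hl, show -x/2 = -(1/2) * x by ring] at this
    have h3 := (le_abs_self (qf Q x))
    calc qf Q x ≤ l⁻¹ * (l * |qf Q x|) := by rw [← mul_assoc, inv_mul_cancel₀ hl.ne', one_mul]; exact h3
      _ ≤ _ := by gcongr
  · have : Tendsto (fun τ => Real.exp τ • e0) atBot (𝓝 ((0:ℝ) • e0)) := Real.tendsto_exp_atBot.smul_const e0
    rw [zero_smul] at this
    exact (hcQ.tendsto 0).comp this
  · obtain ⟨C, hC⟩ := (isCompact_Icc (a := (0:ℝ)) (b := 1)).exists_bound_of_continuousOn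
      (f := fun r : ℝ => fderiv ℝ Q (r • e0) e0) (Continuous.continuousOn (by fun_prop))
    refine ⟨C, 0, fun x hx => ?_⟩
    have := hC (Real.exp x) ⟨(Real.exp_pos x).le, by simpa using hx⟩
    rw [qf', abs_mul, abs_of_pos (Real.exp_pos x), mul_comm]
    gcongr
    exact this
  · rw [e2]; exact norm_integral (fun r : ℝ => Q (r • e0) ^ 2)

end Qsec

end Part11

section Part12
open Set Filter Topology
open scoped Pointwise ENNReal NNReal

lemma lintegral_nu {F : ℝ → ℝ} :
    ∫⁻ r, ENNReal.ofReal (F r) ∂nu = ∫⁻ τ, ENNReal.ofReal (2 * Real.pi * (F (Real.exp τ) * Real.exp (2 * τ))) := by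
  unfold nu
  rw [lintegral_withDensity_eq_lintegral_mul_non_measurable _ (by fun_prop) (by simp), exp_lintegral]
  congr 1; ext τ
  have := Real.exp_pos τ
  have := Real.pi_pos
  rw [Pi.mul_apply, ← ENNReal.ofReal_mul (by positivity), ← ENNReal.ofReal_mul (by positivity)]
  congr 1
  rw [two_mul τ, Real.exp_add]; ring

lemma ofReal_of_lint {F : ℝ → ℝ} (hF : ∀ x, 0 ≤ F x) (hm : Measurable F)
    (hfin : ∫⁻ x, ENNReal.ofReal (2 * Real.pi * F x) ≠ ∞) :
    Integrable F ∧ ∫⁻ x, ENNReal.ofReal (2 * Real.pi * F x) = ENNReal.ofReal (2 * Real.pi * ∫ x, F x) := by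
  have hpi : 0 < 2 * Real.pi := by positivity
  have h1 : Integrable (fun x => 2 * Real.pi * F x) := by
    refine ⟨(hm.const_mul _).aestronglyMeasurable, ?_⟩
    rw [hasFiniteIntegral_iff_ofReal (Eventually.of_forall fun x => mul_nonneg hpi.le (hF x))]
    exact hfin.lt_top
  refine ⟨?_, ?_⟩
  · have := h1.const_mul (2 * Real.pi)⁻¹
    refine this.congr (Eventually.of_forall fun x => ?_)
    simp only; field_simp
  · rw [← integral_const_mul, ofReal_integral_eq_lintegral_ofReal h1 (Eventually.of_forall fun x => mul_nonneg hpi.le (hF x))]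

namespace Good
variable {u : E2 → ℝ} (hu : Good u)
include hu

lemma deriv_v (τ : ℝ) : deriv (fun τ => prof u (Real.exp τ)) τ = deriv (prof u) (Real.exp τ) * Real.exp τ := by
  by_cases hd : DifferentiableAt ℝ (prof u) (Real.exp τ)
  · exact (hd.hasDerivAt.comp τ (Real.hasDerivAt_exp τ)).deriv
  · rw [deriv_zero_of_not_differentiableAt hd, zero_mul]
    apply deriv_zero_of_not_differentiableAt
    intro hc
    apply hd
    have h1 : DifferentiableAt ℝ ((fun τ => prof u (Real.exp τ)) ∘ Real.log) (Real.exp τ) := by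
      apply DifferentiableAt.comp
      · rw [Real.log_exp]; exact hc
      · exact Real.differentiableAt_log (Real.exp_pos τ).ne'
    refine h1.congr_of_eventuallyEq ?_
    filter_upwards [Ioi_mem_nhds (Real.exp_pos τ)] with r hr
    simp [Real.exp_log hr]

lemma int_pow (n : ℕ) (hn : n ≠ 0) : Integrable (fun x => u x ^ n) :=
  (hu.c1.continuous.pow n).integrable_of_hasCompactSupport (by
    have := hu.cs.comp_left (g := fun t : ℝ => t ^ n) (by simp [hn])
    exact this)

lemma int_grad : Integrable (fun x => ‖fderiv ℝ u x‖ ^ 2) :=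
  ((hu.c1.continuous_fderiv (by simp)).norm.pow 2).integrable_of_hasCompactSupport (by
    have := (hu.cs.fderiv (𝕜 := ℝ)).comp_left (g := fun t : E2 →L[ℝ] ℝ => ‖t‖ ^ 2) (by simp)
    exact this)

lemma fin_pow (n : ℕ) (hn : n ≠ 0) : ∫⁻ x, ENNReal.ofReal (u x ^ n) ≠ ∞ := by
  have := (hasFiniteIntegral_iff_ofReal (Eventually.of_forall fun x => pow_nonneg (hu.nn x) n)).1 (hu.int_pow n hn).2
  exact this.ne

lemma lint_pow (n : ℕ) (hn : n ≠ 0) :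
    Integrable (fun τ => prof u (Real.exp τ) ^ n * Real.exp (2 * τ)) ∧
    ∫⁻ x, ENNReal.ofReal (u x ^ n) = ENNReal.ofReal (2 * Real.pi * ∫ τ, prof u (Real.exp τ) ^ n * Real.exp (2 * τ)) := by
  have h1 := hu.lintegral_prof (p := n) (by positivity)
  simp only [Real.rpow_natCast] at h1
  rw [lintegral_nu] at h1
  have hfin := hu.fin_pow n hn
  rw [← h1] at hfin ⊢
  have hm := hu.prof_anti.measurable
  exact ofReal_of_lint (fun x => mul_nonneg (pow_nonneg (hu.prof_nonneg _) n) (Real.exp_pos _).le) (by fun_prop) hfin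

lemma pair : Pair (fun τ => prof u (Real.exp τ)) (deriv (fun τ => prof u (Real.exp τ))) ∧
    ENNReal.ofReal (2 * Real.pi * D1 (deriv (fun τ => prof u (Real.exp τ)))) ≤ ∫⁻ x, ENNReal.ofReal (‖fderiv ℝ u x‖ ^ 2) := by
  have he := hu.energy
  rw [lintegral_nu] at he
  have hg : ∀ τ, deriv (prof u) (Real.exp τ) ^ 2 * Real.exp (2 * τ) = deriv (fun τ => prof u (Real.exp τ)) τ ^ 2 := by
    intro τ
    rw [hu.deriv_v, two_mul, Real.exp_add]; ring
  simp only [hg] at he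
  have hfin : ∫⁻ x, ENNReal.ofReal (‖fderiv ℝ u x‖ ^ 2) < ∞ :=
    (hasFiniteIntegral_iff_ofReal (Eventually.of_forall fun x => by positivity)).1 hu.int_grad.2
  obtain ⟨h1, h2⟩ := ofReal_of_lint (F := fun τ => deriv (fun τ => prof u (Real.exp τ)) τ ^ 2) (fun x => sq_nonneg _)
    ((measurable_deriv _).pow_const 2) (he.trans_lt hfin).ne
  rw [h2] at he
  refine ⟨⟨?_, ?_, (hu.lint_pow 2 two_ne_zero).1⟩, he⟩
  · rw [memLp_two_iff_integrable_sq (measurable_deriv _).aestronglyMeasurable]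
    exact h1
  · intro a b
    obtain ⟨L, _, hL⟩ := hu.exists_lip
    have hl := hu.prof_lip hL
    obtain ⟨K, hK⟩ : ∃ K, LipschitzOnWith K Real.exp (uIcc a b) := by
      refine ⟨Real.toNNReal (Real.exp (max a b)), ?_⟩
      refine (convex_uIcc a b).lipschitzOnWith_of_nnnorm_deriv_le (fun x _ => Real.differentiableAt_exp) (fun x hx => ?_)
      rw [Real.deriv_exp, ← NNReal.coe_le_coe]
      rw [Real.coe_toNNReal _ (Real.exp_pos _).le]
      simp only [coe_nnnorm, Real.norm_eq_abs, abs_of_pos (Real.exp_pos x)]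
      exact Real.exp_le_exp.2 hx.2
    have := (hl.comp_lipschitzOnWith hK).absolutelyContinuousOnInterval.integral_deriv_eq_sub
    exact this.symm

lemma gn2 {q q' : ℝ → ℝ} {α : ℝ} (hq : PS q q' α) (hα : 0 < α) :
    ENNReal.ofReal ((2 * Real.pi * M1 q) / 2) * ∫⁻ x, ENNReal.ofReal (u x ^ 4) ≤
      (∫⁻ x, ENNReal.ofReal (‖fderiv ℝ u x‖ ^ 2)) * ∫⁻ x, ENNReal.ofReal (u x ^ 2) := by
  obtain ⟨hp, hD⟩ := hu.pair
  have h := gn_sharp hq hα hp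
  rw [(hu.lint_pow 4 (by norm_num)).2, (hu.lint_pow 2 (by norm_num)).2]
  refine le_trans ?_ (mul_le_mul_left hD _)
  have a1 := M1_nonneg q
  have a2 := D1_nonneg (deriv (fun τ => prof u (Real.exp τ)))
  have hpi := Real.pi_pos
  rw [← ENNReal.ofReal_mul (by positivity), ← ENNReal.ofReal_mul (by positivity)]
  apply ENNReal.ofReal_le_ofReal
  change 2 * Real.pi * M1 q / 2 * (2 * Real.pi * N1 _) ≤ 2 * Real.pi * D1 _ * (2 * Real.pi * M1 _)
  nlinarith [mul_le_mul_of_nonneg_left h (by positivity : 0 ≤ 2 * Real.pi ^ 2)]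
end Good

end Part12

section Part13
open Set Filter Topology
open scoped Pointwise ENNReal NNReal

lemma ftc_enorm {u : E2 → ℂ} (hu : Differentiable ℝ u) (z v : E2) :
    ‖u (z + v) - u z‖ₑ ≤ ‖v‖ₑ * ∫⁻ s in Ioc (0:ℝ) 1, ‖fderiv ℝ u (z + s • v)‖ₑ := by
  set p : ℝ → ℂ := fun s => u (z + s • v) with hp
  have hd : ∀ s, HasDerivAt p (fderiv ℝ u (z + s • v) v) s := by
    intro s
    have h1 : HasDerivAt (fun s : ℝ => z + s • v) v s := by
      simpa using ((hasDerivAt_id s).smul_const v).const_add z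
    exact (hu (z + s • v)).hasFDerivAt.comp_hasDerivAt s h1
  have hK : ∫⁻ s in Ioc (0:ℝ) 1, ‖deriv p s‖ₑ ≤ ‖v‖ₑ * ∫⁻ s in Ioc (0:ℝ) 1, ‖fderiv ℝ u (z + s • v)‖ₑ := by
    rw [← lintegral_const_mul' _ _ enorm_ne_top]
    apply lintegral_mono
    intro s
    show ‖deriv p s‖ₑ ≤ ‖v‖ₑ * ‖fderiv ℝ u (z + s • v)‖ₑ
    rw [(hd s).deriv, mul_comm]
    exact ContinuousLinearMap.le_opENorm _ _
  refine le_trans ?_ hK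
  by_cases hT : ∫⁻ s in Ioc (0:ℝ) 1, ‖deriv p s‖ₑ = ∞
  · rw [hT]; exact le_top
  have hi : IntegrableOn (deriv p) (Ioc 0 1) :=
    ⟨(measurable_deriv p).aestronglyMeasurable, lt_of_le_of_ne le_top hT⟩
  have := intervalIntegral.integral_eq_sub_of_hasDerivAt (f := p) (f' := deriv p) (a := 0) (b := 1)
    (fun s _ => (hd s).differentiableAt.hasDerivAt)
    ((intervalIntegrable_iff_integrableOn_Ioc_of_le zero_le_one).2 hi)
  have e : u (z + v) - u z = p 1 - p 0 := by simp [hp]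
  rw [e, ← this, intervalIntegral.integral_of_le zero_le_one]
  exact enorm_integral_le_lintegral_enorm _

/-- Mollification by the normalized bump. -/
def moll (φ : ContDiffBump (0 : E2)) (h : E2 → ℝ) : E2 → ℝ :=
  convolution (φ.normed volume) h (ContinuousLinearMap.lsmul ℝ ℝ) volume

lemma moll_apply (φ : ContDiffBump (0 : E2)) (h : E2 → ℝ) (x : E2) :
    moll φ h x = ∫ t, φ.normed volume t * h (x - t) := rfl

lemma moll_int (φ : ContDiffBump (0 : E2)) {h : E2 → ℝ} (hh : LocallyIntegrable h) (x : E2) :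
    Integrable fun t => φ.normed volume t * h (x - t) :=
  (φ.hasCompactSupport_normed.convolutionExists_left (ContinuousLinearMap.lsmul ℝ ℝ)
    φ.continuous_normed hh x)

lemma moll_cont (φ : ContDiffBump (0 : E2)) {h : E2 → ℝ} (hh : LocallyIntegrable h) :
    Continuous (moll φ h) :=
  φ.hasCompactSupport_normed.continuous_convolution_left _ φ.continuous_normed hh

lemma moll_c1 (φ : ContDiffBump (0 : E2)) {h : E2 → ℝ} (hh : LocallyIntegrable h) :
    ContDiff ℝ 1 (moll φ h) :=
  φ.hasCompactSupport_normed.contDiff_convolution_left (n := 1) _ φ.contDiff_normed hh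

lemma moll_nonneg (φ : ContDiffBump (0 : E2)) {h : E2 → ℝ} (h0 : ∀ x, 0 ≤ h x) (x : E2) :
    0 ≤ moll φ h x :=
  integral_nonneg fun t => mul_nonneg (φ.nonneg_normed t) (h0 _)

lemma moll_ofReal (φ : ContDiffBump (0 : E2)) {h : E2 → ℝ} (hh : LocallyIntegrable h)
    (h0 : ∀ x, 0 ≤ h x) (x : E2) :
    ENNReal.ofReal (moll φ h x) =
      ∫⁻ t, ENNReal.ofReal (φ.normed volume t) * ENNReal.ofReal (h (x - t)) := by
  rw [moll_apply, ofReal_integral_eq_lintegral_ofReal (moll_int φ hh x)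
    (Eventually.of_forall fun t => mul_nonneg (φ.nonneg_normed t) (h0 _))]
  congr 1; ext t
  rw [ENNReal.ofReal_mul (φ.nonneg_normed t)]

lemma moll_diff (φ : ContDiffBump (0 : E2)) {u : E2 → ℂ} (hu : Differentiable ℝ u)
    (hg : LocallyIntegrable fun x => ‖fderiv ℝ u x‖) (x v : E2) :
    ‖moll φ (fun x => ‖u x‖) (x + v) - moll φ (fun x => ‖u x‖) x‖ₑ ≤
      ‖v‖ₑ * ∫⁻ s in Ioc (0:ℝ) 1, ENNReal.ofReal (moll φ (fun x => ‖fderiv ℝ u x‖) (x + s • v)) := by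
  have hf : LocallyIntegrable fun x => ‖u x‖ := hu.continuous.norm.locallyIntegrable
  have hm : Measurable fun x => ‖fderiv ℝ u x‖ₑ := (measurable_fderiv ℝ u).enorm
  rw [moll_apply, moll_apply, ← integral_sub (moll_int φ hf _) (moll_int φ hf _)]
  refine (enorm_integral_le_lintegral_enorm _).trans ?_
  have h1 : ∀ t, ‖φ.normed volume t * ‖u (x + v - t)‖ - φ.normed volume t * ‖u (x - t)‖‖ₑ ≤
      ‖v‖ₑ * ∫⁻ s in Ioc (0:ℝ) 1, ENNReal.ofReal (φ.normed volume t) * ‖fderiv ℝ u (x + s • v - t)‖ₑ := by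
    intro t
    rw [lintegral_const_mul' _ _ ENNReal.ofReal_ne_top, ← mul_sub, enorm_mul,
      Real.enorm_of_nonneg (φ.nonneg_normed t), mul_left_comm]
    gcongr
    have := ftc_enorm hu (x - t) v
    have e1 : x - t + v = x + v - t := by abel
    have e2 : ∀ s : ℝ, x - t + s • v = x + s • v - t := fun s => by abel
    simp only [e1, e2] at this
    refine le_trans ?_ this
    rw [← ofReal_norm, ← ofReal_norm]
    exact ENNReal.ofReal_le_ofReal (by rw [Real.norm_eq_abs]; exact abs_norm_sub_norm_le _ _)
  refine (lintegral_mono h1).trans ?_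
  rw [lintegral_const_mul' _ _ enorm_ne_top, lintegral_lintegral_swap]
  · gcongr with s
    rw [moll_ofReal φ hg (fun _ => norm_nonneg _)]
    simp only [ofReal_norm]
    exact le_rfl
  · apply Measurable.aemeasurable
    exact (φ.continuous_normed.measurable.comp measurable_fst).ennreal_ofReal.mul
      (hm.comp (by fun_prop : Measurable fun p : E2 × ℝ => x + p.2 • v - p.1))

lemma moll_fderiv (φ : ContDiffBump (0 : E2)) {u : E2 → ℂ} (hu : Differentiable ℝ u)
    (hg : LocallyIntegrable fun x => ‖fderiv ℝ u x‖) (x : E2) :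
    ‖fderiv ℝ (moll φ (fun x => ‖u x‖)) x‖ ≤ moll φ (fun x => ‖fderiv ℝ u x‖) x := by
  have hf : LocallyIntegrable fun x => ‖u x‖ := hu.continuous.norm.locallyIntegrable
  have hd := ((moll_c1 φ hf).differentiable (by norm_num) x).hasFDerivAt
  have hG0 := moll_nonneg φ (h := fun x => ‖fderiv ℝ u x‖) (fun _ => norm_nonneg _)
  refine le_of_forall_pos_le_add fun ε ε0 => ?_
  refine hd.le_of_lip' (add_nonneg (hG0 x) ε0.le) ?_
  have hc := (moll_cont φ hg).continuousAt (x := x)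
  obtain ⟨δ, δ0, hδ⟩ := Metric.continuousAt_iff.1 hc ε ε0
  filter_upwards [Metric.ball_mem_nhds x δ0] with y hy
  have h := moll_diff φ hu hg x (y - x)
  rw [add_sub_cancel] at h
  have h2 : ∫⁻ s in Ioc (0:ℝ) 1, ENNReal.ofReal (moll φ (fun x => ‖fderiv ℝ u x‖) (x + s • (y - x)))
      ≤ ENNReal.ofReal (moll φ (fun x => ‖fderiv ℝ u x‖) x + ε) := by
    have : ∫⁻ s in Ioc (0:ℝ) 1, ENNReal.ofReal (moll φ (fun x => ‖fderiv ℝ u x‖) x + ε) =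
      ENNReal.ofReal (moll φ (fun x => ‖fderiv ℝ u x‖) x + ε) := by simp
    rw [← this]
    refine setLIntegral_mono' measurableSet_Ioc fun s hs => ENNReal.ofReal_le_ofReal ?_
    have : dist (x + s • (y - x)) x < δ := by
      rw [dist_eq_norm, add_sub_cancel_left, norm_smul, Real.norm_of_nonneg hs.1.le]
      rw [Metric.mem_ball, dist_eq_norm] at hy
      nlinarith [norm_nonneg (y - x), hs.2]
    have := hδ this
    rw [Real.dist_eq] at this
    linarith [(abs_lt.1 this).2]
  have h3 := h.trans (mul_le_mul_right h2 _)
  rw [← ofReal_norm, ← ofReal_norm, ← ENNReal.ofReal_mul (norm_nonneg _),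
    ENNReal.ofReal_le_ofReal_iff (mul_nonneg (norm_nonneg _) (add_nonneg (hG0 x) ε0.le))] at h3
  linarith

lemma moll_L2 (φ : ContDiffBump (0 : E2)) {h : E2 → ℝ} (hh : LocallyIntegrable h)
    (hm : Measurable h) (h0 : ∀ x, 0 ≤ h x) :
    ∫⁻ x, ENNReal.ofReal (moll φ h x ^ 2) ≤ ∫⁻ x, ENNReal.ofReal (h x ^ 2) := by
  set ρ : E2 → ℝ≥0∞ := fun t => ENNReal.ofReal (φ.normed volume t) with hρ
  have hρm : Measurable ρ := φ.continuous_normed.measurable.ennreal_ofReal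
  have hρ1 : ∫⁻ t, ρ t = 1 := by
    rw [hρ, ← ofReal_integral_eq_lintegral_ofReal φ.integrable_normed
      (Eventually.of_forall φ.nonneg_normed), φ.integral_normed, ENNReal.ofReal_one]
  have hH : Measurable fun x => ENNReal.ofReal (h x) := hm.ennreal_ofReal
  have key : ∀ x, ENNReal.ofReal (moll φ h x ^ 2) ≤ ∫⁻ t, ρ t * ENNReal.ofReal (h (x - t) ^ 2) := by
    intro x
    rw [ENNReal.ofReal_pow (moll_nonneg φ h0 x), moll_ofReal φ hh h0]
    set μ := (volume : Measure E2).withDensity ρ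
    have hmx : Measurable fun t => ENNReal.ofReal (h (x - t)) := hH.comp (by fun_prop)
    have e1 : ∫⁻ t, ENNReal.ofReal (φ.normed volume t) * ENNReal.ofReal (h (x - t)) =
        ∫⁻ t, (1 : E2 → ℝ≥0∞) t * ENNReal.ofReal (h (x - t)) ∂μ := by
      rw [lintegral_withDensity_eq_lintegral_mul _ hρm (by simpa using hmx)]
      simp [hρ]
    have e2 : ∫⁻ t, ρ t * ENNReal.ofReal (h (x - t) ^ 2) = ∫⁻ t, ENNReal.ofReal (h (x - t)) ^ (2:ℝ) ∂μ := by
      rw [lintegral_withDensity_eq_lintegral_mul _ hρm (by fun_prop)]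
      congr 1; ext t
      simp only [Pi.mul_apply]
      rw [ENNReal.ofReal_pow (h0 _)]
      norm_cast
    rw [e1, e2]
    have cs := ENNReal.lintegral_mul_le_Lp_mul_Lq μ (Real.HolderConjugate.two_two)
      (f := (1 : E2 → ℝ≥0∞)) (g := fun t => ENNReal.ofReal (h (x - t))) aemeasurable_const hmx.aemeasurable
    have hμ : ∫⁻ t, (1 : E2 → ℝ≥0∞) t ^ (2:ℝ) ∂μ = 1 := by
      simp only [Pi.one_apply, ENNReal.one_rpow, lintegral_one]
      rw [withDensity_apply _ MeasurableSet.univ, setLIntegral_univ, hρ1]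
    rw [hμ, ENNReal.one_rpow] at cs
    calc _ ≤ ((∫⁻ t, ENNReal.ofReal (h (x - t)) ^ (2:ℝ) ∂μ) ^ (1 / 2 : ℝ)) ^ 2 := by
            gcongr; simpa using cs
      _ = _ := by
        rw [← ENNReal.rpow_natCast, ← ENNReal.rpow_mul]; norm_num
  refine (lintegral_mono key).trans ?_
  rw [lintegral_lintegral_swap]
  · have : ∀ t, ∫⁻ x, ρ t * ENNReal.ofReal (h (x - t) ^ 2) = ρ t * ∫⁻ x, ENNReal.ofReal (h x ^ 2) := by
      intro t
      rw [lintegral_const_mul' _ _ ENNReal.ofReal_ne_top,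
        lintegral_sub_right_eq_self (fun x => ENNReal.ofReal (h x ^ 2)) t]
    simp only [this]
    rw [lintegral_mul_const _ hρm, hρ1, one_mul]
  · apply Measurable.aemeasurable
    exact (hρm.comp measurable_snd).mul (((hm.comp (by fun_prop : Measurable fun p : E2 × E2 => p.1 - p.2)).pow_const 2).ennreal_ofReal)

end Part13

section Part14
open Set Filter Topology
open scoped Pointwise ENNReal NNReal

/-- The fixed cutoff. -/
def chi : ContDiffBump (0 : E2) := ⟨1, 2, by norm_num, by norm_num⟩

/-- Mollifier number `n`. -/
def phin (n : ℕ) : ContDiffBump (0 : E2) :=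
  ⟨1 / ((n:ℝ) + 1) / 2, 1 / ((n:ℝ) + 1), by positivity, half_lt_self (by positivity)⟩

lemma chi_bound : ∃ C : ℝ, 0 ≤ C ∧ ∀ x, ‖fderiv ℝ chi x‖ ≤ C := by
  have hc : Continuous (fderiv ℝ chi) := (chi.contDiff (n := 1)).continuous_fderiv (by norm_num)
  obtain ⟨C, hC⟩ := hc.bounded_above_of_compact_support (chi.hasCompactSupport.fderiv ℝ)
  exact ⟨C, (norm_nonneg _).trans (hC 0), hC⟩

/-- The approximating sequence. -/
def appr (f : E2 → ℝ) (n : ℕ) (x : E2) : ℝ :=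
  chi (((n:ℝ) + 1)⁻¹ • x) * moll (phin n) f x

lemma appr_good {f : E2 → ℝ} (hf : LocallyIntegrable f) (h0 : ∀ x, 0 ≤ f x) (n : ℕ) :
    Good (appr f n) where
  c1 := ContDiff.mul (chi.contDiff.comp (contDiff_const_smul _)) (moll_c1 _ hf)
  cs := by
    apply HasCompactSupport.mul_right
    have hn : ((n:ℝ) + 1)⁻¹ ≠ 0 := by positivity
    exact chi.hasCompactSupport.comp_homeomorph (Homeomorph.smulOfNeZero _ hn)
  nn x := mul_nonneg chi.nonneg (moll_nonneg _ h0 x)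

lemma appr_le {f : E2 → ℝ} (h0 : ∀ x, 0 ≤ f x) (n : ℕ) (x : E2) :
    appr f n x ≤ moll (phin n) f x :=
  mul_le_of_le_one_left (moll_nonneg _ h0 x) chi.le_one

lemma appr_fderiv {f : E2 → ℝ} (hf : LocallyIntegrable f) (h0 : ∀ x, 0 ≤ f x) {C : ℝ}
    (hC : ∀ x, ‖fderiv ℝ chi x‖ ≤ C) (n : ℕ) (x : E2) :
    ‖fderiv ℝ (appr f n) x‖ ≤ ‖fderiv ℝ (moll (phin n) f) x‖ +
      C * ((n:ℝ) + 1)⁻¹ * moll (phin n) f x := by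
  have hm := ((moll_c1 (phin n) hf).differentiable (by norm_num) x).hasFDerivAt
  have hch := ((chi.contDiff (n := 1)).differentiable (by norm_num) (((n:ℝ) + 1)⁻¹ • x)).hasFDerivAt
  have hs : HasFDerivAt (fun x : E2 => ((n:ℝ) + 1)⁻¹ • x)
      (((n:ℝ) + 1)⁻¹ • ContinuousLinearMap.id ℝ E2) x := (hasFDerivAt_id (𝕜 := ℝ) x).const_smul (((n:ℝ) + 1)⁻¹)
  have hcc := hch.comp x hs
  have hp := hcc.mul hm
  have : fderiv ℝ (appr f n) x = _ := hp.fderiv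
  rw [this]
  refine (norm_add_le _ _).trans (add_le_add ?_ ?_)
  · rw [norm_smul]
    refine mul_le_of_le_one_left (norm_nonneg _) ?_
    rw [Function.comp_apply, Real.norm_of_nonneg chi.nonneg]; exact chi.le_one
  · rw [norm_smul, Real.norm_of_nonneg (moll_nonneg _ h0 x), mul_comm]
    refine mul_le_mul_of_nonneg_right ?_ (moll_nonneg _ h0 x)
    rw [ContinuousLinearMap.comp_smul, norm_smul, ContinuousLinearMap.comp_id,
      Real.norm_of_nonneg (by positivity), mul_comm]
    exact mul_le_mul_of_nonneg_right (hC _) (by positivity)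

lemma appr_tendsto {f : E2 → ℝ} (hf : Continuous f) (x : E2) :
    Tendsto (fun n => appr f n x) atTop (𝓝 (f x)) := by
  have h1 : Tendsto (fun n => moll (phin n) f x) atTop (𝓝 (f x)) := by
    apply ContDiffBump.convolution_tendsto_right_of_continuous _ hf
    exact tendsto_one_div_add_atTop_nhds_zero_nat
  have h2 : Tendsto (fun n : ℕ => ((n:ℝ) + 1)⁻¹ • x) atTop (𝓝 ((0:ℝ) • x)) := by
    have := tendsto_one_div_add_atTop_nhds_zero_nat (𝕜 := ℝ)
    simp only [one_div] at this
    exact this.smul_const x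
  rw [zero_smul] at h2
  have h3 : Tendsto (fun n : ℕ => chi (((n:ℝ) + 1)⁻¹ • x)) atTop (𝓝 1) := by
    have := (chi.continuous.tendsto 0).comp h2
    rwa [show chi 0 = 1 from chi.one_of_mem_closedBall (by simp [chi.rIn_pos.le])] at this
  simpa [appr] using h3.mul h1

theorem gn_final {c : ℝ}
    (hGN : ∀ w : E2 → ℝ, Good w → ENNReal.ofReal c * ∫⁻ x, ENNReal.ofReal (w x ^ 4) ≤
      (∫⁻ x, ENNReal.ofReal (‖fderiv ℝ w x‖ ^ 2)) * ∫⁻ x, ENNReal.ofReal (w x ^ 2))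
    {u : E2 → ℂ} (hu : Differentiable ℝ u) (h2 : Integrable (fun x : E2 => ‖u x‖ ^ 2))
    (hg : Integrable (fun x : E2 => ‖fderiv ℝ u x‖ ^ 2)) :
    ENNReal.ofReal c * ∫⁻ x, ENNReal.ofReal (‖u x‖ ^ 4) ≤
      (∫⁻ x, ENNReal.ofReal (‖fderiv ℝ u x‖ ^ 2)) * ∫⁻ x, ENNReal.ofReal (‖u x‖ ^ 2) := by
  set f : E2 → ℝ := fun x => ‖u x‖ with hfd
  have hfc : Continuous f := hu.continuous.norm
  have hfl : LocallyIntegrable f := hfc.locallyIntegrable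
  have hf0 : ∀ x, 0 ≤ f x := fun x => norm_nonneg _
  set g : E2 → ℝ := fun x => ‖fderiv ℝ u x‖ with hgd
  have hgm : Measurable g := (measurable_fderiv ℝ u).norm
  have hg0 : ∀ x, 0 ≤ g x := fun x => norm_nonneg _
  have hgl : LocallyIntegrable g := by
    have : LocallyIntegrable (fun x => 1 + g x ^ 2) :=
      (locallyIntegrable_const (1:ℝ)).add hg.locallyIntegrable
    refine this.mono hgm.aestronglyMeasurable (Eventually.of_forall fun x => ?_)
    rw [Real.norm_of_nonneg (hg0 x), Real.norm_of_nonneg (by positivity)]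
    nlinarith [sq_nonneg (g x - 1)]
  obtain ⟨C, hC0, hC⟩ := chi_bound
  set A := ∫⁻ x, ENNReal.ofReal (g x ^ 2) with hA
  set B := ∫⁻ x, ENNReal.ofReal (f x ^ 2) with hB
  have hAf : A ≠ ∞ := by
    have := hg.2
    rw [hasFiniteIntegral_iff_ofReal (Eventually.of_forall fun x => by positivity)] at this
    exact this.ne
  have hBf : B ≠ ∞ := by
    have := h2.2
    rw [hasFiniteIntegral_iff_ofReal (Eventually.of_forall fun x => by positivity)] at this
    exact this.ne
  set b : ℕ → ℝ≥0∞ := fun n => ENNReal.ofReal (1 + 1 / ((n:ℝ) + 1)) * A +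
    ENNReal.ofReal (C ^ 2 * (1 / ((n:ℝ) + 1) * (1 + 1 / ((n:ℝ) + 1)))) * B with hb
  have hD : ∀ n, ∫⁻ x, ENNReal.ofReal (‖fderiv ℝ (appr f n) x‖ ^ 2) ≤ b n := by
    intro n
    have hR : (0:ℝ) < (n:ℝ) + 1 := by positivity
    have pt : ∀ x, ENNReal.ofReal (‖fderiv ℝ (appr f n) x‖ ^ 2) ≤
        ENNReal.ofReal (1 + 1 / ((n:ℝ) + 1)) * ENNReal.ofReal (moll (phin n) g x ^ 2) +
        ENNReal.ofReal (C ^ 2 * (1 / ((n:ℝ) + 1) * (1 + 1 / ((n:ℝ) + 1)))) *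
          ENNReal.ofReal (moll (phin n) f x ^ 2) := by
      intro x
      rw [← ENNReal.ofReal_mul (by positivity), ← ENNReal.ofReal_mul (by positivity),
        ← ENNReal.ofReal_add (by positivity) (by positivity)]
      apply ENNReal.ofReal_le_ofReal
      have a1 := appr_fderiv hfl hf0 hC n x
      have a2 := moll_fderiv (phin n) hu hgl x
      have a3 := norm_nonneg (fderiv ℝ (appr f n) x)
      have a4 := moll_nonneg (phin n) hf0 x
      have a5 := moll_nonneg (phin n) hg0 x
      generalize moll (phin n) f x = F at *
      have a6 : ‖fderiv ℝ (appr f n) x‖ ≤ moll (phin n) g x + C * ((n:ℝ) + 1)⁻¹ * F := by linarith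
      generalize moll (phin n) g x = G at *
      refine (pow_le_pow_left₀ a3 a6 2).trans ?_
      have : (1 + 1 / ((n:ℝ) + 1)) * G ^ 2 + C ^ 2 * (1 / ((n:ℝ) + 1) * (1 + 1 / ((n:ℝ) + 1))) * F ^ 2
        - (G + C * ((n:ℝ) + 1)⁻¹ * F) ^ 2 = (1 / ((n:ℝ) + 1)) * (G - C * F) ^ 2 := by
        field_simp; ring
      have : 0 ≤ (1 / ((n:ℝ) + 1)) * (G - C * F) ^ 2 := by positivity
      linarith
    refine (lintegral_mono pt).trans ?_
    rw [lintegral_add_left (by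
        exact (((moll_cont (phin n) hgl).measurable.pow_const 2).ennreal_ofReal).const_mul _),
      lintegral_const_mul' _ _ ENNReal.ofReal_ne_top, lintegral_const_mul' _ _ ENNReal.ofReal_ne_top]
    exact add_le_add (mul_le_mul_right (moll_L2 _ hgl hgm hg0) _)
      (mul_le_mul_right (moll_L2 _ hfl hfc.measurable hf0) _)
  have hM : ∀ n, ∫⁻ x, ENNReal.ofReal (appr f n x ^ 2) ≤ B := by
    intro n
    refine le_trans (lintegral_mono fun x => ENNReal.ofReal_le_ofReal ?_)
      (moll_L2 (phin n) hfl hfc.measurable hf0)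
    exact pow_le_pow_left₀ ((appr_good hfl hf0 n).nn x) (appr_le hf0 n x) 2
  have hbt : Tendsto b atTop (𝓝 A) := by
    have t0 := tendsto_one_div_add_atTop_nhds_zero_nat (𝕜 := ℝ)
    have t1 : Tendsto (fun n : ℕ => 1 + 1 / ((n:ℝ) + 1)) atTop (𝓝 1) := by
      simpa using t0.const_add 1
    have t2 : Tendsto (fun n : ℕ => C ^ 2 * (1 / ((n:ℝ) + 1) * (1 + 1 / ((n:ℝ) + 1)))) atTop (𝓝 0) := by
      simpa using (t0.mul t1).const_mul (C ^ 2)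
    have s1 := ENNReal.Tendsto.mul_const (ENNReal.tendsto_ofReal t1) (Or.inr hAf)
    have s2 := ENNReal.Tendsto.mul_const (ENNReal.tendsto_ofReal t2) (Or.inr hBf)
    simpa [hb] using s1.add s2
  have hbB : Tendsto (fun n => b n * B) atTop (𝓝 (A * B)) :=
    ENNReal.Tendsto.mul_const hbt (Or.inr hBf)
  rw [← lintegral_const_mul' _ _ ENNReal.ofReal_ne_top]
  have hpt : ∀ x, ENNReal.ofReal c * ENNReal.ofReal (f x ^ 4) =
      liminf (fun n => ENNReal.ofReal c * ENNReal.ofReal (appr f n x ^ 4)) atTop := by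
    intro x
    refine (Tendsto.liminf_eq ?_).symm
    exact ENNReal.Tendsto.const_mul (ENNReal.tendsto_ofReal ((appr_tendsto hfc x).pow 4))
      (Or.inr ENNReal.ofReal_ne_top)
  rw [lintegral_congr hpt]
  refine (lintegral_liminf_le fun n => ?_).trans ?_
  · exact ((((appr_good hfl hf0 n).c1.continuous.measurable).pow_const 4).ennreal_ofReal).const_mul _
  rw [← hbB.liminf_eq]
  refine liminf_le_liminf (Eventually.of_forall fun n => ?_)
  show ∫⁻ x, ENNReal.ofReal c * ENNReal.ofReal (appr f n x ^ 4) ≤ b n * B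
  rw [lintegral_const_mul' _ _ ENNReal.ofReal_ne_top]
  exact (hGN _ (appr_good hfl hf0 n)).trans (mul_le_mul' (hD n) (hM n))

end Part14

end GNProof

/-- Gagliardo–Nirenberg inequality in 2D with the optimal constant
`a_* = ‖Q‖²_{L²}`, where `Q` is the unique positive radial solution of
`-ΔQ + Q - Q³ = 0`. -/
theorem stmt3 (Q : E2 → ℝ) (hQsmooth : ContDiff ℝ (⊤ : ℕ∞) Q)
    (hQpos : ∀ x, 0 < Q x)
    (hQrad : ∀ x y : E2, ‖x‖ = ‖y‖ → Q x = Q y)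
    (hQ2 : Integrable (fun x : E2 => Q x ^ 2))
    (hQgrad : Integrable (fun x : E2 => ‖fderiv ℝ Q x‖ ^ 2))
    (hQpde : ∀ x, -lap Q x + Q x - (Q x) ^ 3 = 0)
    (astar : ℝ) (hastar : astar = ∫ x : E2, Q x ^ 2) :
    ∀ u : E2 → ℂ, Differentiable ℝ u →
      Integrable (fun x : E2 => ‖u x‖ ^ 2) →
      Integrable (fun x : E2 => ‖fderiv ℝ u x‖ ^ 2) →
      astar / 2 * ∫ x : E2, ‖u x‖ ^ 4
        ≤ (∫ x : E2, ‖fderiv ℝ u x‖ ^ 2) * ∫ x : E2, ‖u x‖ ^ 2 := by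
  intro u hu h2 hg
  obtain ⟨hps, hI⟩ := Q_ps hQsmooth hQpos hQrad hQpde hQ2 hQgrad
  have hc : astar / 2 = (2 * Real.pi * M1 (qf Q)) / 2 := by rw [hastar, hI]
  have h := gn_final (c := astar / 2) (fun w hw => by rw [hc]; exact hw.gn2 hps (hQpos 0)) hu h2 hg
  have ha : 0 ≤ astar / 2 := by
    rw [hastar]; exact div_nonneg (integral_nonneg fun x => sq_nonneg _) (by norm_num)
  rw [← ofReal_integral_eq_lintegral_ofReal hg (Filter.Eventually.of_forall fun x => by positivity),
    ← ofReal_integral_eq_lintegral_ofReal h2 (Filter.Eventually.of_forall fun x => by positivity),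
    ← ENNReal.ofReal_mul (integral_nonneg fun x => by positivity)] at h
  have hr : 0 ≤ (∫ x : E2, ‖fderiv ℝ u x‖ ^ 2) * ∫ x : E2, ‖u x‖ ^ 2 :=
    mul_nonneg (integral_nonneg fun x => by positivity) (integral_nonneg fun x => by positivity)
  by_cases h4 : Integrable fun x : E2 => ‖u x‖ ^ 4
  · rw [← ofReal_integral_eq_lintegral_ofReal h4 (Filter.Eventually.of_forall fun x => by positivity),
      ← ENNReal.ofReal_mul ha, ENNReal.ofReal_le_ofReal_iff hr] at h
    exact h
  · rw [integral_undef h4, mul_zero]; exact hr
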